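/- Let Q=(0,1)² and fix a constant M>2. The set A := {f ∈ X : there exists E ⊆ Q with Lebesgue measure |E| = 0 and |f(E)| = 1} is dense in the metric space (X,d); in particular A is non-empty. -/

import Mathlib

open MeasureTheory Set
open scoped ENNReal

noncomputable section

abbrev Plane := EuclideanSpace ℝ (Fin 2)

/-- The open unit square `(0,1)²`. -/
def unitSq : Set Plane := {x | 0 < x 0 ∧ x 0 < 1 ∧ 0 < x 1 ∧ x 1 < 1}

/-- Standard basis vectors of the plane. -/
def e2 (i : Fin 2) : Plane := EuclideanSpace.single i 1

/-- The set of approximating values in the definition of the variation of `f` on `U`: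
integrals against `C¹_c` test fields `φ = (φ₁, φ₂)` all of whose four components are
bounded by `1` in absolute value. -/
def varSet (f : Plane → Plane) (U : Set Plane) : Set ℝ :=
  {v | ∃ φ : Plane → Plane × Plane,
    ContDiff ℝ 1 φ ∧ HasCompactSupport φ ∧ tsupport φ ⊆ U ∧
    (∀ x i, |(φ x).1 i| ≤ 1 ∧ |(φ x).2 i| ≤ 1) ∧
    v = ∫ x in U, ((f x 0) * (fderiv ℝ (fun y => (φ y).1 0) x (e2 0)
                    + fderiv ℝ (fun y => (φ y).1 1) x (e2 1))
        + (f x 1) * (fderiv ℝ (fun y => (φ y).2 0) x (e2 0)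
                    + fderiv ℝ (fun y => (φ y).2 1) x (e2 1)))}

/-- The variation of `f` in `U`. -/
def Var (f : Plane → Plane) (U : Set Plane) : ℝ := sSup (varSet f U)

/-- `f` is a `BV` map on `U`. -/
def IsBV (f : Plane → Plane) (U : Set Plane) : Prop :=
  IntegrableOn f U volume ∧ BddAbove (varSet f U)

/-- `f` is a homeomorphism of `U` onto `V`, with inverse `g`. -/
def IsHomeoOn (f g : Plane → Plane) (U V : Set Plane) : Prop :=
  BijOn f U V ∧ ContinuousOn f U ∧ InvOn g f U V ∧ ContinuousOn g V

/-- `f` (as a total function, representing its own continuous extension) extends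
continuously to the closure of the unit square, with `f = Id` on the boundary. -/
def ExtendsToId (f : Plane → Plane) : Prop :=
  ContinuousOn f (closure unitSq) ∧ EqOn f id (frontier unitSq)

/-- The space `X` of `BV` homeomorphisms of the unit square fixing the boundary with
variation smaller than `M`; an element is a pair (homeomorphism, inverse). -/
def X (M : ℝ) : Set ((Plane → Plane) × (Plane → Plane)) :=
  {p | IsHomeoOn p.1 p.2 unitSq unitSq ∧ ExtendsToId p.1 ∧
    IsBV p.1 unitSq ∧ Var p.1 unitSq < M}

/-- Sup distance `‖f - g‖_∞` over the set `U`. -/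
def supDist (f g : Plane → Plane) (U : Set Plane) : ℝ := ⨆ x : U, dist (f x) (g x)

/-- The distance `d` on `X`. -/
def dX (M : ℝ) (p q : (Plane → Plane) × (Plane → Plane)) : ℝ :=
  supDist p.1 q.1 unitSq + supDist p.2 q.2 unitSq +
    |1 / (M - Var p.1 unitSq) - 1 / (M - Var q.1 unitSq)|

/-- `A` is open in the metric space `(X, d)`. -/
def OpenInX (M : ℝ) (A : Set ((Plane → Plane) × (Plane → Plane))) : Prop :=
  A ⊆ X M ∧ ∀ p ∈ A, ∃ ε > 0, ∀ q ∈ X M, dX M p q < ε → q ∈ A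

/-- `A` is dense in the metric space `(X, d)`. -/
def DenseInX (M : ℝ) (A : Set ((Plane → Plane) × (Plane → Plane))) : Prop :=
  A ⊆ X M ∧ ∀ p ∈ X M, ∀ ε > 0, ∃ q ∈ A, dX M p q < ε

/-- An open triangle in the plane. -/
def IsOpenTriangle (T : Set Plane) : Prop :=
  ∃ a b c : Plane, T = interior (convexHull ℝ {a, b, c})

/-- A finite union of pairwise disjoint open triangles. -/
def FinUnionTriangles (E : Set Plane) : Prop :=
  ∃ (k : ℕ) (T : Fin k → Set Plane), (∀ i, IsOpenTriangle (T i)) ∧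
    (∀ i j, i ≠ j → Disjoint (T i) (T j)) ∧ E = ⋃ i, T i

/-- The set `A` of homeomorphisms mapping a null set onto a set of full measure. -/
def Afull (M : ℝ) : Set ((Plane → Plane) × (Plane → Plane)) :=
  {p ∈ X M | ∃ E ⊆ unitSq, volume E = 0 ∧ volume (p.1 '' E) = 1}

/-- The set `A_n`. -/
def An (M : ℝ) (n : ℕ) : Set ((Plane → Plane) × (Plane → Plane)) :=
  {p ∈ X M | ∃ E ⊆ unitSq, FinUnionTriangles E ∧
    volume E < 1 / (n : ℝ≥0∞) ∧ 1 - 1 / (n : ℝ≥0∞) < volume (p.1 '' E)}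

section

open Filter Topology

/-- There is a nonatomic probability measure of full support on the circle that is
singular with respect to Lebesgue measure. -/
theorem exists_singular_measure_circle :
    ∃ (κ : Measure UnitAddCircle) (C : Set UnitAddCircle), IsProbabilityMeasure κ ∧
      (∀ z, κ {z} = 0) ∧ (∀ U, IsOpen U → U.Nonempty → 0 < κ U) ∧
      MeasurableSet C ∧ volume C = 0 ∧ κ Cᶜ = 0 := by
  have hsing : ∀ z : UnitAddCircle, volume {z} = 0 := fun z => by
    rw [← Metric.closedBall_zero, AddCircle.volume_closedBall]
    simp
  have hna : NullSingletonClass (volume : Measure UnitAddCircle) := ⟨hsing⟩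
  have hvp : IsProbabilityMeasure (volume : Measure UnitAddCircle) :=
    ⟨UnitAddCircle.measure_univ⟩
  have hunc : ¬ Countable UnitAddCircle := by
    intro h
    have := Set.countable_univ (α := UnitAddCircle)
    have h2 := this.measure_zero volume
    simp at h2
  have hunc2 : ¬ Countable (UnitAddCircle × UnitAddCircle) := by
    intro h
    exact hunc (Prod.fst_surjective (α := UnitAddCircle) (β := UnitAddCircle)).countable
  let e : UnitAddCircle × UnitAddCircle ≃ᵐ UnitAddCircle :=
    PolishSpace.measurableEquivOfNotCountable hunc2 hunc
  have hmeas : ∀ s : UnitAddCircle, MeasurableSet (e '' ({s} ×ˢ univ)) := fun s =>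
    e.measurableEmbedding.measurableSet_image.2
      ((measurableSet_singleton s).prod MeasurableSet.univ)
  have hdisj : Pairwise (Function.onFun Disjoint fun s : UnitAddCircle => e '' ({s} ×ˢ univ)) := by
    intro s t hst
    refine (disjoint_image_iff e.injective).2 ?_
    exact Set.disjoint_prod.2 (Or.inl (by simpa using hst))
  have hcount := Measure.countable_meas_pos_of_disjoint_iUnion
      (μ := (volume : Measure UnitAddCircle))
    hmeas hdisj
  obtain ⟨s, hs⟩ : ∃ s : UnitAddCircle, volume (e '' ({s} ×ˢ univ)) = 0 := by
    by_contra! h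
    apply hunc
    rw [← Set.countable_univ_iff]
    exact hcount.mono fun x _ => pos_iff_ne_zero.2 (h x)
  let g : UnitAddCircle → UnitAddCircle := fun x => e (s, x)
  have hg : Measurable g := e.measurable.comp (by fun_prop)
  have ginj : Function.Injective g := fun x y h => by
    have := e.injective h
    simpa using this
  let κ₀ : Measure UnitAddCircle := Measure.map g volume
  have hκ₀p : IsProbabilityMeasure κ₀ := Measure.isProbabilityMeasure_map hg.aemeasurable
  have hκ₀a : ∀ z, κ₀ {z} = 0 := by
    intro z
    rw [Measure.map_apply hg (measurableSet_singleton z)]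
    exact ((Set.subsingleton_singleton).preimage ginj).measure_zero volume
  let C₀ := e '' ({s} ×ˢ univ)
  have hκ₀C : κ₀ C₀ᶜ = 0 := by
    rw [Measure.map_apply hg (hmeas s).compl]
    convert! measure_empty (μ := (volume : Measure UnitAddCircle))
    ext x
    simp [g]
  let d := TopologicalSpace.denseSeq UnitAddCircle
  let κ : Measure UnitAddCircle :=
    Measure.sum fun n : ℕ => ((2 : ℝ≥0∞)⁻¹ ^ (n + 1)) • Measure.map (fun z => z + d n) κ₀
  have hadd : ∀ n, Measurable fun z : UnitAddCircle => z + d n := fun n => by fun_prop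
  have hκ : ∀ A, MeasurableSet A →
      κ A = ∑' n : ℕ, (2 : ℝ≥0∞)⁻¹ ^ (n + 1) * κ₀ ((fun z => z + d n) ⁻¹' A) := by
    intro A hA
    rw [Measure.sum_apply _ hA]
    refine tsum_congr fun n => ?_
    rw [Measure.smul_apply, Measure.map_apply (hadd n) hA, smul_eq_mul]
  refine ⟨κ, ⋃ n, (fun z => z - d n) ⁻¹' C₀, ⟨?_⟩, ?_, ?_, ?_, ?_, ?_⟩
  · rw [hκ _ MeasurableSet.univ]
    simp [ENNReal.tsum_geometric_add_one]
    rw [ENNReal.inv_mul_cancel] <;> simp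
  · intro z
    rw [hκ _ (measurableSet_singleton z)]
    simp only [ENNReal.tsum_eq_zero, mul_eq_zero]
    intro n
    right
    have : (fun z => z + d n) ⁻¹' {z} = {z - d n} := by
      ext x; simp only [mem_preimage, mem_singleton_iff, eq_sub_iff_add_eq]
    rw [this, hκ₀a]
  · intro U hU hUne
    rw [hκ _ hU.measurableSet, pos_iff_ne_zero]
    intro h0
    simp only [ENNReal.tsum_eq_zero, mul_eq_zero] at h0
    have h1 : ∀ n, κ₀ ((fun z => z + d n) ⁻¹' U) = 0 := fun n =>
      (h0 n).resolve_left (by simp)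
    have h2 : (⋃ n, (fun z => z + d n) ⁻¹' U) = univ := by
      rw [eq_univ_iff_forall]
      intro z
      have hop : IsOpen ((fun w => z + w) ⁻¹' U) := hU.preimage (by fun_prop)
      obtain ⟨u, hu⟩ := hUne
      obtain ⟨n, hn⟩ := (TopologicalSpace.denseRange_denseSeq UnitAddCircle).exists_mem_open hop
        ⟨u - z, by simpa using hu⟩
      exact mem_iUnion.2 ⟨n, hn⟩
    have h3 := measure_iUnion_null h1
    rw [h2, measure_univ] at h3
    exact one_ne_zero h3
  · refine MeasurableSet.iUnion fun n => ?_
    exact (by fun_prop : Measurable fun z : UnitAddCircle => z - d n) (hmeas s)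
  · refine measure_iUnion_null fun n => ?_
    have := measure_preimage_add_right (volume : Measure UnitAddCircle) (-d n) C₀
    simp only [sub_eq_add_neg]
    rw [this]; exact hs
  · rw [hκ _ (by
      refine (MeasurableSet.iUnion fun n => ?_).compl
      exact (by fun_prop : Measurable fun z : UnitAddCircle => z - d n) (hmeas s))]
    simp only [ENNReal.tsum_eq_zero, mul_eq_zero]
    intro n
    right
    refine measure_mono_null ?_ hκ₀C
    intro z hz
    simp only [compl_iUnion, mem_preimage, mem_iInter, mem_compl_iff] at hz ⊢
    simpa using hz n

theorem sum_unit_steps_near (a : ℕ → ℝ) (Y : ℝ) (hY : 0 ≤ Y) (h0 : ∀ k, 0 ≤ a k)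
    (h1 : ∀ k, a k ≤ 1) (hlow : ∀ k : ℕ, (k : ℝ) + 1 ≤ Y → a k = 1)
    (hhigh : ∀ k : ℕ, Y ≤ k → a k = 0) (n : ℕ) :
    ((n : ℝ) ≤ Y → ∑ k ∈ Finset.range n, a k = n) ∧
      (Y < n → |∑ k ∈ Finset.range n, a k - Y| ≤ 1) := by
  induction n with
  | zero => exact ⟨fun _ => by simp, fun h => absurd hY (not_le.2 (by simpa using h))⟩
  | succ n ih =>
    rw [Finset.sum_range_succ]
    push_cast
    refine ⟨fun h => by rw [ih.1 (by linarith), hlow n h], fun h => ?_⟩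
    by_cases hn : (n : ℝ) ≤ Y
    · rw [ih.1 hn, abs_le]
      constructor <;> linarith [h0 n, h1 n]
    · push Not at hn
      rw [hhigh n hn.le, add_zero]
      exact ih.2 hn

theorem sum_lintegral_affine (V : ℝ → ℝ≥0∞) (N : ℕ) (hN : 0 < N) :
    (N : ℝ≥0∞)⁻¹ * ∑ k ∈ Finset.range N, ∫⁻ x in Ioc (0 : ℝ) 1, V ((k + x) / N)
      = ∫⁻ x in Ioc (0 : ℝ) 1, V x := by
  have hN' : (0 : ℝ) < N := by exact_mod_cast hN
  have h1 : ∀ k : ℕ, (N : ℝ≥0∞)⁻¹ * ∫⁻ x in Ioc (0 : ℝ) 1, V ((k + x) / N)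
      = ∫⁻ x in Ioc ((k : ℝ) / N) ((k + 1 : ℕ) / N), V x := by
    intro k
    have himg : (fun x : ℝ => (k + x) / N) '' Ioc (0 : ℝ) 1
        = Ioc ((k : ℝ) / N) ((k + 1 : ℕ) / N) := by
      ext y
      simp only [mem_image, mem_Ioc]
      constructor
      · rintro ⟨x, ⟨hx0, hx1⟩, rfl⟩
        constructor
        · gcongr; linarith
        · push_cast; gcongr
      · rintro ⟨hy0, hy1⟩
        rw [div_lt_iff₀ hN'] at hy0
        rw [le_div_iff₀ hN'] at hy1
        push_cast at hy1
        exact ⟨y * N - k, ⟨by linarith, by linarith⟩, by field_simp; ring⟩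
    rw [← himg, lintegral_image_eq_lintegral_abs_deriv_mul (f' := fun _ => 1 / (N : ℝ))
      measurableSet_Ioc]
    · rw [lintegral_const_mul' _ _ ENNReal.ofReal_ne_top]
      congr 1
      rw [abs_of_pos (by positivity), one_div, ENNReal.ofReal_inv_of_pos hN',
        ENNReal.ofReal_natCast]
    · intro x _
      exact (((hasDerivAt_id x).const_add (k : ℝ)).div_const (N : ℝ)).hasDerivWithinAt
    · intro x _ y _ h
      simp only at h
      field_simp at h
      linarith
  rw [Finset.mul_sum, Finset.sum_congr rfl fun k _ => h1 k]
  have h2 : ∀ n : ℕ, ∑ k ∈ Finset.range n, ∫⁻ x in Ioc ((k : ℝ) / N) ((k + 1 : ℕ) / N), V x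
      = ∫⁻ x in Ioc (0 : ℝ) (n / N), V x := by
    intro n
    induction n with
    | zero => simp
    | succ n ih =>
      rw [Finset.sum_range_succ, ih, ← lintegral_union measurableSet_Ioc, Ioc_union_Ioc_eq_Ioc]
      · positivity
      · push_cast; gcongr; linarith
      · rw [Set.disjoint_left]
        intro x hx hx'
        exact absurd hx.2 (not_le.2 hx'.1)
  rw [h2, div_self hN'.ne']

theorem exists_good_measure {Ω : Type*} [MeasurableSpace Ω] (μ : Measure Ω) [SFinite μ]
    (a : Ω → ℝ) (ha : Measurable a) (V : ℝ → ℝ≥0∞) (hV : Measurable V) (N : ℕ) (hN : 0 < N) :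
    ∃ ν : Measure ℝ, IsProbabilityMeasure ν ∧ (∀ x, ν {x} = 0) ∧ ν (Ioo 0 1)ᶜ = 0 ∧
      (∀ a b, 0 ≤ a → a < b → b ≤ 1 → 0 < ν (Ioo a b)) ∧
      (∀ y, 0 ≤ y → y ≤ 1 → |ν.real (Iic y) - y| ≤ 1 / N) ∧
      (∫⁻ y, V y ∂ν ≤ ∫⁻ y in Ioo (0 : ℝ) 1, V y) ∧
      ∃ Z : Set ℝ, MeasurableSet Z ∧ ν Zᶜ = 0 ∧ ∀ᵐ w ∂μ, a w ∉ Z := by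
  obtain ⟨κ, C, hκp, hκa, hκo, hCm, hC0, hκC⟩ := exists_singular_measure_circle
  have hvp : IsProbabilityMeasure (volume : Measure UnitAddCircle) :=
    ⟨UnitAddCircle.measure_univ⟩
  have hN' : (0 : ℝ) < N := by exact_mod_cast hN
  have hNe : (N : ℝ≥0∞) ≠ 0 := by exact_mod_cast hN.ne'
  let r : UnitAddCircle → ℝ := fun z => (AddCircle.equivIoc (1 : ℝ) 0 z : ℝ)
  have hr0 : ∀ z, 0 < r z := fun z => (AddCircle.equivIoc (1 : ℝ) 0 z).2.1
  have hr1 : ∀ z, r z ≤ 1 := fun z => by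
    have := (AddCircle.equivIoc (1 : ℝ) 0 z).2.2
    simpa [r] using this
  have hrc : ∀ z, (r z : UnitAddCircle) = z := fun z => AddCircle.coe_equivIoc
  have hrm : Measurable r :=
    measurable_subtype_coe.comp (AddCircle.measurableEquivIoc (1 : ℝ) 0).measurable
  have hrcoe : ∀ x : ℝ, 0 < x → x ≤ 1 → r (x : UnitAddCircle) = x := fun x h0 h1 =>
    AddCircle.equivIoc_coe_of_mem ⟨h0, by simpa using h1⟩
  have hrinj : Function.Injective r := fun x y h => by rw [← hrc x, ← hrc y, h]
  let ρ : UnitAddCircle → ℕ → UnitAddCircle → ℝ := fun θ k z => (k + r (z + θ)) / N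
  have hρm : ∀ θ k, Measurable (ρ θ k) := fun θ k => by
    have : Measurable fun z => r (z + θ) := hrm.comp (by fun_prop)
    exact (this.const_add (k : ℝ)).div_const (N : ℝ)
  have hρi : ∀ θ k, Function.Injective (ρ θ k) := by
    intro θ k x y h
    simp only [ρ] at h
    field_simp at h
    have h' : r (x + θ) = r (y + θ) := by linarith
    simpa using hrinj h'
  let ν : UnitAddCircle → Measure ℝ := fun θ =>
    (N : ℝ≥0∞)⁻¹ • ∑ k ∈ Finset.range N, Measure.map (ρ θ k) κ
  have hν : ∀ θ A, MeasurableSet A →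
      ν θ A = (N : ℝ≥0∞)⁻¹ * ∑ k ∈ Finset.range N, κ (ρ θ k ⁻¹' A) := by
    intro θ A hA
    simp only [ν, Measure.smul_apply, Measure.finsetSum_apply, smul_eq_mul]
    congr 1
    exact Finset.sum_congr rfl fun k _ => Measure.map_apply (hρm θ k) hA
  have hνp : ∀ θ, IsProbabilityMeasure (ν θ) := fun θ => ⟨by
    rw [hν θ _ MeasurableSet.univ]
    simp [ENNReal.inv_mul_cancel hNe]⟩
  have hν0 : ∀ θ A, MeasurableSet A → (∀ k < N, κ (ρ θ k ⁻¹' A) = 0) → ν θ A = 0 := by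
    intro θ A hA h
    rw [hν θ A hA, Finset.sum_eq_zero fun k hk => h k (Finset.mem_range.1 hk), mul_zero]
  have hνa : ∀ θ x, ν θ {x} = 0 := fun θ x => by
    refine hν0 θ _ (measurableSet_singleton x) fun k _ => ?_
    rcases (Set.subsingleton_singleton.preimage (hρi θ k)).eq_empty_or_singleton
        (s := ρ θ k ⁻¹' {x})
      with h | ⟨z, h⟩
    · rw [h, measure_empty]
    · rw [h, hκa]
  have hνI : ∀ θ, ν θ (Ioo 0 1)ᶜ = 0 := by
    intro θ
    have h1 : ν θ (Ioc 0 1)ᶜ = 0 := by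
      refine hν0 θ _ measurableSet_Ioc.compl fun k hk => ?_
      convert! measure_empty (μ := κ)
      ext z
      simp only [mem_preimage, mem_compl_iff, mem_Ioc, mem_empty_iff_false, iff_false, not_not]
      have hk' : (k : ℝ) + 1 ≤ N := by exact_mod_cast hk
      constructor
      · exact div_pos (by have := hr0 (z + θ); positivity) hN'
      · exact (div_le_one hN').2 (by linarith [hr1 (z + θ)])
    refine measure_mono_null (t := (Ioc 0 1)ᶜ ∪ {1}) ?_ (measure_union_null h1 (hνa θ 1))
    intro x hx
    by_cases h : x = 1
    · right; exact h
    · left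
      exact fun h' => hx ⟨h'.1, lt_of_le_of_ne h'.2 h⟩
  have hνo : ∀ θ a b, 0 ≤ a → a < b → b ≤ 1 → 0 < ν θ (Ioo a b) := by
    intro θ a b ha hab hb
    set k := ⌊N * a⌋₊ with hk
    have hk0 : (k : ℝ) ≤ N * a := Nat.floor_le (by positivity)
    have hk1 : (N : ℝ) * a < k + 1 := Nat.lt_floor_add_one _
    have hkN : k < N := by
      have : (k : ℝ) < N := hk0.trans_lt (by nlinarith)
      exact_mod_cast this
    have hNab : (N : ℝ) * a < N * b := by gcongr
    let α := N * a - k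
    let β := min (N * b - k) 1
    have hαβ : α < β := lt_min (by simp only [α]; linarith) (by simp only [α]; linarith)
    let U : Set UnitAddCircle := (fun z => z + θ) ⁻¹' (((↑) : ℝ → UnitAddCircle) '' Ioo α β)
    have hU : IsOpen U :=
      (QuotientAddGroup.isOpenMap_coe _ isOpen_Ioo).preimage (by fun_prop)
    have hUne : U.Nonempty := by
      obtain ⟨x, hx⟩ := nonempty_Ioo.2 hαβ
      exact ⟨(x : UnitAddCircle) - θ, x, hx, by simp⟩
    have hsub : U ⊆ ρ θ k ⁻¹' Ioo a b := by
      rintro z ⟨x, hx, hxz⟩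
      have hx0 : 0 < x := lt_of_le_of_lt (by simp only [α]; linarith) hx.1
      have hx1 : x ≤ 1 := hx.2.le.trans (min_le_right _ _)
      have hx2 : x < N * b - k := hx.2.trans_le (min_le_left _ _)
      have hx3 : N * a - k < x := hx.1
      simp only [mem_preimage, ρ, ← hxz, mem_Ioo, hrcoe x hx0 hx1]
      rw [lt_div_iff₀ hN', div_lt_iff₀ hN']
      constructor <;> linarith
    rw [hν θ _ measurableSet_Ioo]
    refine ENNReal.mul_pos (by simp) ?_
    rw [← pos_iff_ne_zero]
    exact ((hκo U hU hUne).trans_le (measure_mono hsub)).trans_le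
      (Finset.single_le_sum (f := fun k => κ (ρ θ k ⁻¹' Ioo a b)) (fun _ _ => zero_le)
        (Finset.mem_range.2 hkN))
  have hνδ : ∀ θ y, 0 ≤ y → y ≤ 1 → |(ν θ).real (Iic y) - y| ≤ 1 / N := by
    intro θ y h0 h1
    have e1 : (ν θ).real (Iic y) = (N : ℝ)⁻¹ * ∑ k ∈ Finset.range N, κ.real (ρ θ k ⁻¹' Iic y) := by
      rw [measureReal_def, hν θ _ measurableSet_Iic, ENNReal.toReal_mul,
        ENNReal.toReal_sum fun _ _ => measure_ne_top _ _]
      simp [measureReal_def]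
    have key := sum_unit_steps_near (fun k => κ.real (ρ θ k ⁻¹' Iic y)) (N * y) (by positivity)
      (fun _ => measureReal_nonneg) (fun _ => measureReal_le_one) (fun k hk => by
        rw [(_ : ρ θ k ⁻¹' Iic y = univ), probReal_univ]
        rw [eq_univ_iff_forall]
        intro z
        simp only [mem_preimage, mem_Iic, ρ]
        rw [div_le_iff₀ hN']
        linarith [hr1 (z + θ)]) (fun k hk => by
        rw [(_ : ρ θ k ⁻¹' Iic y = ∅), measureReal_empty]
        rw [eq_empty_iff_forall_notMem]
        intro z hz
        simp only [mem_preimage, mem_Iic, ρ] at hz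
        rw [div_le_iff₀ hN'] at hz
        linarith [hr0 (z + θ)]) N
    have hS : |∑ k ∈ Finset.range N, κ.real (ρ θ k ⁻¹' Iic y) - N * y| ≤ 1 := by
      rcases le_or_gt (N : ℝ) (N * y) with h | h
      · rw [key.1 h]
        have : N * y ≤ N := by nlinarith
        rw [le_antisymm this h]; simp
      · exact key.2 h
    rw [e1, (_ : (N : ℝ)⁻¹ * ∑ k ∈ Finset.range N, κ.real (ρ θ k ⁻¹' Iic y) - y =
      (∑ k ∈ Finset.range N, κ.real (ρ θ k ⁻¹' Iic y) - N * y) / N), abs_div, abs_of_pos hN']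
    · gcongr
    · field_simp
  have hνV : ∀ θ, ∫⁻ y, V y ∂(ν θ)
      = (N : ℝ≥0∞)⁻¹ * ∑ k ∈ Finset.range N, ∫⁻ z, V (ρ θ k z) ∂κ := by
    intro θ
    simp only [ν]
    rw [lintegral_smul_measure, lintegral_finsetSum_measure, smul_eq_mul]
    congr 1
    exact Finset.sum_congr rfl fun k _ => lintegral_map hV (hρm θ k)
  have hjm : ∀ k, Measurable fun p : UnitAddCircle × UnitAddCircle => V (ρ p.1 k p.2) := by
    intro k
    have : Measurable fun p : UnitAddCircle × UnitAddCircle => r (p.2 + p.1) :=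
      hrm.comp (by fun_prop)
    exact hV.comp ((this.const_add (k : ℝ)).div_const (N : ℝ))
  have h_int : ∀ k, Measurable fun θ => ∫⁻ z, V (ρ θ k z) ∂κ := fun k =>
    (hjm k).lintegral_prod_right'
  have hmeasI : Measurable fun θ => ∫⁻ y, V y ∂(ν θ) := by
    simp_rw [hνV]
    exact (Finset.measurable_sum _ fun k _ => h_int k).const_mul _
  have hav : ∫⁻ θ, ∫⁻ y, V y ∂(ν θ) = ∫⁻ y in Ioo (0 : ℝ) 1, V y := by
    simp_rw [hνV]
    rw [lintegral_const_mul' _ _ (by simp [hN.ne']), lintegral_finsetSum _ fun k _ => h_int k,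
      restrict_Ioo_eq_restrict_Ioc, ← sum_lintegral_affine V N hN]
    congr 1
    refine Finset.sum_congr rfl fun k _ => ?_
    rw [lintegral_lintegral_swap (hjm k).aemeasurable]
    have : ∀ z : UnitAddCircle, ∫⁻ θ, V (ρ θ k z) = ∫⁻ x in Ioc (0 : ℝ) 1, V ((k + x) / N) := by
      intro z
      have h1 := lintegral_add_left_eq_self (μ := (volume : Measure UnitAddCircle))
        (fun w => V ((k + r w) / N)) z
      simp only [ρ]
      rw [h1, ← UnitAddCircle.lintegral_preimage 0]
      rw [zero_add]
      refine setLIntegral_congr_fun measurableSet_Ioc fun x hx => ?_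
      rw [hrcoe x hx.1 hx.2]
    simp_rw [this]
    simp
  have haeZ : ∀ᵐ θ : UnitAddCircle, ∀ᵐ w ∂μ, ((N * a w : ℝ) : UnitAddCircle) - θ ∉ C := by
    rw [← Measure.ae_ae_comm (p := fun w (θ : UnitAddCircle) =>
      ((N * a w : ℝ) : UnitAddCircle) - θ ∉ C)]
    · refine Filter.Eventually.of_forall fun w => ?_
      rw [ae_iff]
      simp only [not_not]
      have h := Measure.measurePreserving_sub_left (volume : Measure UnitAddCircle)
        ((N * a w : ℝ) : UnitAddCircle)
      have := h.measure_preimage hCm.nullMeasurableSet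
      rw [hC0] at this
      exact this
    · have h1 : Measurable fun p : Ω × UnitAddCircle =>
        ((N * a p.1 : ℝ) : UnitAddCircle) - p.2 := by
        refine Measurable.fun_sub ?_ measurable_snd
        exact AddCircle.measurable_mk'.comp ((ha.comp measurable_fst).const_mul _)
      exact h1 hCm.compl
  obtain ⟨θ, hθZ, hθV⟩ := exists_notMem_null_le_lintegral (μ := (volume : Measure UnitAddCircle))
    hmeasI.aemeasurable (ae_iff.1 haeZ)
  simp only [mem_ofPred_eq, not_not] at hθZ
  have hZm : MeasurableSet {y : ℝ | ((N * y : ℝ) : UnitAddCircle) - θ ∈ C} := by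
    have h1 : Measurable fun y : ℝ => ((N * y : ℝ) : UnitAddCircle) - θ :=
      (AddCircle.measurable_mk'.comp (measurable_id.const_mul (N : ℝ))).sub_const θ
    exact h1 hCm
  refine ⟨ν θ, hνp θ, hνa θ, hνI θ, hνo θ, hνδ θ, hθV.trans_eq hav,
    {y | ((N * y : ℝ) : UnitAddCircle) - θ ∈ C}, hZm, ?_, hθZ⟩
  refine hν0 θ _ hZm.compl fun k hk => ?_
  refine measure_mono_null ?_ hκC
  intro z hz hzC
  apply hz
  simp only [mem_ofPred_eq, ρ]
  have : (N : ℝ) * ((k + r (z + θ)) / N) = k + r (z + θ) := by field_simp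
  rw [this, AddCircle.coe_add, hrc]
  have hk0 : ((k : ℝ) : UnitAddCircle) = 0 := by
    rw [AddCircle.coe_eq_zero_iff]
    exact ⟨k, by simp⟩
  rw [hk0]
  simpa using hzC

theorem exists_orderIso_map_eq (ν : Measure ℝ) [IsProbabilityMeasure ν]
    (hat : ∀ x, ν {x} = 0) (hsupp : ν (Ioo 0 1)ᶜ = 0)
    (hpos : ∀ a b, 0 ≤ a → a < b → b ≤ 1 → 0 < ν (Ioo a b))
    (δ : ℝ) (hδ : ∀ y, 0 ≤ y → y ≤ 1 → |ν.real (Iic y) - y| ≤ δ) :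
    ∃ t : ℝ ≃o ℝ, (∀ y ∉ Ioo (0 : ℝ) 1, t y = y) ∧ (∀ y, 0 ≤ y → y ≤ 1 → |t y - y| ≤ δ) ∧
      Measure.map t (volume.restrict (Ioo 0 1)) = ν := by
  have hF0 : ∀ y, y ≤ 0 → ν.real (Iic y) = 0 := fun y hy => by
    rw [measureReal_def, measure_mono_null _ hsupp, ENNReal.toReal_zero]
    intro x hx hx'
    exact absurd (hx'.1.trans_le hx) (not_lt.2 hy)
  have hF1 : ∀ y, 1 ≤ y → ν.real (Iic y) = 1 := fun y hy => by
    have h : ν.real (Iic y)ᶜ = 0 := by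
      rw [measureReal_def, measure_mono_null _ hsupp, ENNReal.toReal_zero]
      intro x hx hx'
      exact hx (hx'.2.le.trans hy)
    rw [probReal_compl_eq_one_sub measurableSet_Iic] at h
    linarith
  have hFm : Monotone fun y => ν.real (Iic y) := fun a b hab =>
    measureReal_mono (Iic_subset_Iic.2 hab)
  have hFs : ∀ a b, 0 ≤ a → a < b → b ≤ 1 → ν.real (Iic a) < ν.real (Iic b) := by
    intro a b ha hab hb
    have h1 : ν.real (Iic a) + ν.real (Ioo a b) ≤ ν.real (Iic b) := by
      rw [← measureReal_union _ measurableSet_Ioo]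
      · refine measureReal_mono ?_
        rintro x (hx | hx)
        · exact (le_trans hx hab.le : x ≤ b)
        · exact hx.2.le
      · rw [Set.disjoint_left]; intro x hx hx'; exact absurd hx'.1 (not_lt.2 hx)
    have h2 : 0 < ν.real (Ioo a b) := by
      rw [measureReal_def]
      exact ENNReal.toReal_pos (hpos a b ha hab hb).ne' (measure_ne_top _ _)
    linarith
  have hFc : Continuous fun y => ν.real (Iic y) := by
    have : (fun y => ν.real (Iic y)) = ProbabilityTheory.cdf ν := by
      ext y; rw [ProbabilityTheory.cdf_eq_real]
    rw [this, continuous_iff_continuousAt]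
    intro y
    rw [(ProbabilityTheory.monotone_cdf ν).continuousAt_iff_leftLim_eq_rightLim,
      StieltjesFunction.rightLim_eq]
    have h := hat y
    rw [← ProbabilityTheory.measure_cdf (μ := ν), StieltjesFunction.measure_singleton,
      ENNReal.ofReal_eq_zero] at h
    exact le_antisymm ((ProbabilityTheory.monotone_cdf ν).leftLim_le le_rfl) (by linarith)
  let H : ℝ → ℝ := fun y => ν.real (Iic y) + min y 0 + max (y - 1) 0
  have hHc : Continuous H := by fun_prop
  have hH0 : ∀ y, y ≤ 0 → H y = y := fun y hy => by
    simp only [H]; rw [hF0 y hy, min_eq_left hy, max_eq_right (by linarith)]; ring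
  have hH1 : ∀ y, 1 ≤ y → H y = y := fun y hy => by
    simp only [H]; rw [hF1 y hy, min_eq_right (by linarith), max_eq_left (by linarith)]; ring
  have hHm : ∀ y, 0 ≤ y → y ≤ 1 → H y = ν.real (Iic y) := fun y h0 h1 => by
    simp only [H]; rw [min_eq_right h0, max_eq_right (by linarith)]; ring
  have hHs : StrictMono H := by
    intro a b hab
    have m1 := hFm hab.le
    have m2 : min a 0 ≤ min b 0 := min_le_min_right 0 hab.le
    have m3 : max (a - 1) 0 ≤ max (b - 1) 0 := max_le_max_right 0 (by linarith)
    simp only at m1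
    by_cases ha : a < 0
    · have : min a 0 < min b 0 := by
        rw [min_eq_left ha.le]; exact lt_min hab ha
      simp only [H]; linarith
    by_cases hb : 1 < b
    · have : max (a - 1) 0 < max (b - 1) 0 := by
        rw [max_eq_left (by linarith : (0:ℝ) ≤ b - 1)]; exact max_lt (by linarith) (by linarith)
      simp only [H]; linarith
    push Not at ha hb
    have := hFs a b ha hab hb
    simp only [H]; linarith
  have hsurj : Function.Surjective H := by
    refine hHc.surjective ?_ ?_
    · refine Filter.tendsto_id.congr' ?_
      filter_upwards [Filter.eventually_ge_atTop 1] with y hy using (hH1 y hy).symm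
    · refine Filter.tendsto_id.congr' ?_
      filter_upwards [Filter.eventually_le_atBot 0] with y hy using (hH0 y hy).symm
  let e : ℝ ≃o ℝ := hHs.orderIsoOfSurjective H hsurj
  have he : ∀ y, e y = H y := fun y => rfl
  have h00 : e.symm 0 = 0 := by rw [OrderIso.symm_apply_eq, he, hH0 0 le_rfl]
  have h11 : e.symm 1 = 1 := by rw [OrderIso.symm_apply_eq, he, hH1 1 le_rfl]
  refine ⟨e.symm, fun y hy => ?_, ?_, ?_⟩
  · rw [OrderIso.symm_apply_eq, he]
    rcases le_or_gt y 0 with h | h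
    · exact (hH0 y h).symm
    · exact (hH1 y (not_lt.1 fun h' => hy ⟨h, h'⟩)).symm
  · intro y h0 h1
    have k0 : 0 ≤ e.symm y := by rw [← h00]; exact e.symm.monotone h0
    have k1 : e.symm y ≤ 1 := by rw [← h11]; exact e.symm.monotone h1
    have := hδ _ k0 k1
    rw [← hHm _ k0 k1, ← he, OrderIso.apply_symm_apply] at this
    rwa [abs_sub_comm]
  · have hmeas : Measurable e.symm := e.symm.continuous.measurable
    have hp : IsProbabilityMeasure (volume.restrict (Ioo (0:ℝ) 1)) := ⟨by simp⟩
    have := Measure.isProbabilityMeasure_map (μ := volume.restrict (Ioo (0:ℝ) 1)) hmeas.aemeasurable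
    refine Measure.ext_of_Iic _ _ fun z => ?_
    rw [Measure.map_apply hmeas measurableSet_Iic,
      Measure.restrict_apply (hmeas measurableSet_Iic)]
    have hpre : e.symm ⁻¹' Iic z = Iic (H z) := by
      ext y; simp only [mem_preimage, mem_Iic, OrderIso.symm_apply_le]; rfl
    rw [hpre, inter_comm]
    rw [← ofReal_measureReal (μ := ν)]
    rcases le_total z 0 with h | h
    · rw [hF0 z h, hH0 z h]
      rw [(_ : Ioo (0:ℝ) 1 ∩ Iic z = ∅)]
      · simp
      · ext x; simp only [mem_inter_iff, mem_Ioo, mem_Iic, mem_empty_iff_false, iff_false]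
        rintro ⟨⟨h1, _⟩, h2⟩; linarith
    rcases le_total 1 z with h' | h'
    · rw [hF1 z h', hH1 z h']
      rcases eq_or_lt_of_le h' with h'' | h''
      · subst h''; rw [inter_eq_left.2 fun x hx => hx.2.le]; simp
      · rw [inter_eq_left.2 fun x hx => hx.2.le.trans h']; simp
    · rw [hHm z h h']
      have hle : ν.real (Iic z) ≤ 1 := measureReal_le_one
      apply le_antisymm
      · refine (measure_mono (t := Ioc 0 (ν.real (Iic z))) fun x hx => ⟨hx.1.1, ?_⟩).trans ?_
        · exact hx.2
        · simp
      · refine le_trans ?_ (measure_mono (s := Ioo 0 (ν.real (Iic z)))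
          fun x hx => ⟨⟨hx.1, ?_⟩, hx.2.le⟩)
        · simp
        · exact hx.2.trans_le hle

/-- There are monotone reparametrisations of the unit interval, close to the identity, sending
almost every point into a set that is negligible for a prescribed random variable. -/
theorem exists_singular_orderIso {Ω : Type*} [MeasurableSpace Ω] (μ : Measure Ω) [SFinite μ]
    (a : Ω → ℝ) (ha : Measurable a) (V : ℝ → ℝ≥0∞) (hV : Measurable V) {ε : ℝ} (hε : 0 < ε) :
    ∃ t : ℝ ≃o ℝ, (∀ y ∉ Ioo (0 : ℝ) 1, t y = y) ∧ (∀ y, |t y - y| ≤ ε) ∧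
      ∫⁻ y in Ioo 0 1, V (t y) ≤ ∫⁻ y in Ioo 0 1, V y ∧
      ∃ Z, MeasurableSet Z ∧ volume {y ∈ Ioo (0 : ℝ) 1 | t y ∉ Z} = 0 ∧ ∀ᵐ w ∂μ, a w ∉ Z := by
  obtain ⟨N, hN⟩ := exists_nat_one_div_lt hε
  obtain ⟨ν, hν, hat, hsupp, hpos, hcl, hVν, Z, hZ, hνZ, haZ⟩ :=
    exists_good_measure μ a ha V hV (N + 1) N.succ_pos
  obtain ⟨t, ht, htc, hmap⟩ := exists_orderIso_map_eq ν hat hsupp hpos _ hcl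
  have htm : Measurable t := t.continuous.measurable
  refine ⟨t, ht, fun y => ?_, ?_, Z, hZ, ?_, haZ⟩
  · by_cases hy : y ∈ Ioo (0 : ℝ) 1
    · refine (htc y hy.1.le hy.2.le).trans ?_
      push_cast
      exact hN.le
    · rw [ht y hy, sub_self, abs_zero]; exact hε.le
  · rw [← hmap, lintegral_map hV htm] at hVν
    exact hVν
  · rw [← hmap, Measure.map_apply htm hZ.compl, Measure.restrict_apply (htm hZ.compl)] at hνZ
    rw [← hνZ]
    congr 1
    ext y
    exact and_comm

/-- `C¹` test functions compactly supported in `O` and bounded by `1`. -/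
structure IsTest {E : Type*} [NormedAddCommGroup E] [NormedSpace ℝ E] (O : Set E)
    (ψ : E → ℝ) : Prop where
  contDiff : ContDiff ℝ 1 ψ
  compact : HasCompactSupport ψ
  subset : tsupport ψ ⊆ O
  bound : ∀ x, |ψ x| ≤ 1

theorem IsTest.zero {E : Type*} [NormedAddCommGroup E] [NormedSpace ℝ E] (O : Set E) :
    IsTest O (fun _ => (0 : ℝ)) where
  contDiff := contDiff_const
  compact := HasCompactSupport.zero
  subset := by
    have : tsupport (fun _ : E => (0 : ℝ)) = ∅ := by
      rw [tsupport_eq_empty_iff]; rfl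
    rw [this]; exact empty_subset _
  bound := by simp

/-- A continuous function whose integrals against test functions are at most `K` has `L¹` norm
at most `K`. -/
theorem lintegral_enorm_le_of_forall_isTest {E : Type*} [NormedAddCommGroup E] [NormedSpace ℝ E]
    [FiniteDimensional ℝ E] [MeasurableSpace E] [BorelSpace E] (μ : Measure E)
    [IsFiniteMeasureOnCompacts μ] {O : Set E} (hO : IsOpen O) (hb : Bornology.IsBounded O)
    {d : E → ℝ} (hd : Continuous d) {K : ℝ}
    (h : ∀ ψ, IsTest O ψ → ∫ x, ψ x * d x ∂μ ≤ K) :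
    ∫⁻ x in O, ‖d x‖ₑ ∂μ ≤ ENNReal.ofReal K := by
  have hOc : IsCompact (closure O) := hb.isCompact_closure
  have hOfin : μ O < ∞ := (measure_mono subset_closure).trans_lt hOc.measure_lt_top
  obtain ⟨B, hB⟩ := (hOc.image hd).isBounded.exists_norm_le
  have hB' : ∀ x ∈ O, |d x| ≤ B := fun x hx => hB _ ⟨x, subset_closure hx, rfl⟩
  obtain ⟨C, hCc, hCO, hCU, hCm⟩ := hO.exists_iUnion_isClosed
  rw [← hCU, setLIntegral_iUnion_of_directed _ hCm.directed_le]
  refine iSup_le fun n => ?_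
  set S := C n
  have hSO : S ⊆ O := hCO n
  have hSc : IsClosed S := hCc n
  have hK : 0 ≤ K := by simpa using h _ (IsTest.zero O)
  have hScomp : IsCompact S := hOc.of_isClosed_subset hSc (hSO.trans subset_closure)
  have hdS : IntegrableOn d S μ := hd.continuousOn.integrableOn_compact hScomp
  have hdO : IntegrableOn d O μ :=
    (hd.continuousOn.integrableOn_compact hOc).mono_set subset_closure
  have : ∫⁻ x in S, ‖d x‖ₑ ∂μ = ENNReal.ofReal (∫ x in S, |d x| ∂μ) := by
    rw [ofReal_integral_eq_lintegral_ofReal hdS.abs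
        (Filter.Eventually.of_forall fun _ => abs_nonneg _)]
    simp [Real.enorm_eq_ofReal_abs]
  rw [this]
  apply ENNReal.ofReal_le_ofReal
  obtain ⟨χ, hχs, hχ1, hχI⟩ := exists_tsupport_one_of_isOpen_isClosed hO hOc hSc hSO
  have key : ∀ ε : ℝ, 0 < ε → ε < 1 →
      ∫ x in S, |d x| ∂μ ≤ (1 + ε) * K + ε * (1 + B) * μ.real O := by
    intro ε hε hε1
    have hpos : ∀ x, 0 < |d x| + ε := fun x => by positivity
    let w : E → ℝ := fun x => χ x * (d x / (|d x| + ε))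
    have hw : Continuous w :=
      χ.continuous.mul (hd.div (hd.abs.add continuous_const) fun x => (hpos x).ne')
    have hw1 : ∀ x, |w x| ≤ 1 := by
      intro x
      simp only [w, abs_mul, abs_div, abs_of_pos (hpos x)]
      have h1 : |d x| / (|d x| + ε) ≤ 1 := by
        rw [div_le_one (hpos x)]; linarith
      have h2 : |χ x| ≤ 1 := by rw [abs_le]; constructor <;> linarith [(hχI x).1, (hχI x).2]
      exact mul_le_one₀ h2 (by positivity) h1
    obtain ⟨q, hqs, hqw, hqsupp⟩ := hw.exists_contDiff_approx (1 : ℕ∞)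
      (ε := fun _ => ε) continuous_const (fun _ => hε)
    have hqw' : ∀ x, |q x - w x| < ε := fun x => by simpa [Real.dist_eq] using hqw x
    have hts : tsupport q ⊆ tsupport χ := by
      apply closure_mono
      refine hqsupp.trans ?_
      intro x hx
      simp only [w, Function.mem_support] at hx ⊢
      exact fun h0 => hx (by simp [h0])
    have hqO : tsupport q ⊆ O := hts.trans hχs
    have hqc : HasCompactSupport q :=
      hOc.of_isClosed_subset (isClosed_tsupport q) (hqO.trans subset_closure)
    have htest : IsTest O (fun x => (1 + ε)⁻¹ * q x) := by
      refine ⟨contDiff_const.mul (by exact_mod_cast hqs), hqc.mul_left, ?_, ?_⟩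
      · refine subset_trans (closure_mono ?_) hqO
        intro x hx
        simp only [Function.mem_support] at hx ⊢
        exact fun h0 => hx (by simp [h0])
      · intro x
        have : |q x| ≤ 1 + ε := by
          have := abs_sub_abs_le_abs_sub (q x) (w x)
          linarith [hqw' x, hw1 x]
        rw [abs_mul, abs_inv, abs_of_pos (by linarith : 0 < 1 + ε)]
        rw [inv_mul_le_one₀ (by linarith)]; exact this
    have h1 := h _ htest
    have h2 : ∫ x, q x * d x ∂μ ≤ (1 + ε) * K := by
      have : ∫ x, (1 + ε)⁻¹ * q x * d x ∂μ = (1 + ε)⁻¹ * ∫ x, q x * d x ∂μ := by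
        rw [← integral_const_mul]; simp only [mul_assoc]
      rw [this, inv_mul_le_iff₀ (by linarith)] at h1
      exact h1
    have hqd : Integrable (fun x => q x * d x) μ :=
      (hqs.continuous.mul hd).integrable_of_hasCompactSupport hqc.mul_right
    have h3 : ∫ x in O, S.indicator (fun x => |d x|) x ∂μ ≤
        ∫ x in O, (q x * d x + ε * (1 + B)) ∂μ := by
      have hc : IntegrableOn (fun _ : E => ε * (1 + B)) O μ := integrableOn_const hOfin.ne
      refine setIntegral_mono_on ((hdO.abs).indicator hSc.measurableSet)
        (hqd.integrableOn.add hc) hO.measurableSet ?_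
      intro x hx
      have hBx := hB' x hx
      have e1 : w x * d x ≥ χ x * (|d x| - ε) := by
        have : d x / (|d x| + ε) * d x ≥ |d x| - ε := by
          rw [ge_iff_le, div_mul_eq_mul_div, le_div_iff₀ (hpos x), ← abs_mul_abs_self (d x)]
          nlinarith [sq_nonneg ε]
        calc χ x * (|d x| - ε) ≤ χ x * (d x / (|d x| + ε) * d x) :=
              mul_le_mul_of_nonneg_left this (hχI x).1
          _ = w x * d x := by simp only [w]; ring
      have e2 : q x * d x ≥ w x * d x - ε * |d x| := by
        have := neg_abs_le ((q x - w x) * d x)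
        rw [abs_mul] at this
        nlinarith [mul_le_mul_of_nonneg_right (hqw' x).le (abs_nonneg (d x))]
      by_cases hxS : x ∈ S
      · have : χ x = 1 := hχ1 hxS
        rw [indicator_of_mem hxS]
        rw [this] at e1
        nlinarith
      · rw [indicator_of_notMem hxS]
        have : χ x * (|d x| - ε) ≥ - ε := by
          nlinarith [(hχI x).1, (hχI x).2, abs_nonneg (d x),
              mul_nonneg (hχI x).1 (abs_nonneg (d x))]
        nlinarith
    rw [setIntegral_indicator hSc.measurableSet, inter_eq_right.2 hSO] at h3
    have h4 : ∫ x in O, q x * d x ∂μ = ∫ x, q x * d x ∂μ :=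
      setIntegral_eq_integral_of_forall_compl_eq_zero fun x hx => by
        rw [image_eq_zero_of_notMem_tsupport fun hx' => hx (hqO hx'), zero_mul]
    rw [integral_add hqd.integrableOn (integrableOn_const hOfin.ne), setIntegral_const, h4,
      smul_eq_mul] at h3
    linarith
  have hlim : Filter.Tendsto (fun ε : ℝ => (1 + ε) * K + ε * (1 + B) * μ.real O)
      (nhdsWithin 0 (Ioi 0)) (nhds ((1 + 0) * K + 0 * (1 + B) * μ.real O)) := by
    apply Filter.Tendsto.mono_left _ nhdsWithin_le_nhds
    apply Continuous.tendsto (f := fun ε : ℝ => (1 + ε) * K + ε * (1 + B) * μ.real O)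
    fun_prop
  have := ge_of_tendsto hlim (b := ∫ x in S, |d x| ∂μ) (by
    filter_upwards [Ioo_mem_nhdsGT (zero_lt_one' ℝ)] with ε hε using key ε hε.1 hε.2)
  simpa using this

/-- The distributional pairing of `u` with the derivative of `ψ` in the direction `e`. -/
def pairing (e : ℝ × ℝ) (u ψ : ℝ × ℝ → ℝ) : ℝ := ∫ p, u p * fderiv ℝ ψ p e

theorem IsTest.comp_sub {E : Type*} [NormedAddCommGroup E] [NormedSpace ℝ E] {O O' : Set E}
    {ψ : E → ℝ} (hψ : IsTest O ψ) (a : E) (ha : ∀ x ∈ O, x + a ∈ O') :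
    IsTest O' (fun x => -ψ (x - a)) where
  contDiff := (hψ.contDiff.comp (contDiff_id.sub contDiff_const)).neg
  compact := by
    have := hψ.compact.comp_homeomorph (Homeomorph.subRight a)
    exact this.neg
  subset := by
    intro x hx
    have h1 : tsupport (fun x => -ψ (x - a)) ⊆ (fun x => x - a) ⁻¹' tsupport ψ := by
      apply closure_minimal
      · intro y hy
        apply subset_tsupport
        simpa using hy
      · exact (isClosed_tsupport ψ).preimage (by fun_prop)
    have := ha _ (hψ.subset (h1 hx))
    simpa using this
  bound x := by rw [abs_neg]; exact hψ.bound _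

theorem pairing_neg_comp_sub (e : ℝ × ℝ) (u ψ : ℝ × ℝ → ℝ) (a : ℝ × ℝ) :
    pairing e u (fun x => -ψ (x - a)) = ∫ p, u p * -(fderiv ℝ ψ (p - a) e) := by
  unfold pairing
  congr 1 with p
  have : fderiv ℝ (fun x => -ψ (x - a)) p = -fderiv ℝ ψ (p - a) := by
    simp only [sub_eq_add_neg]
    rw [fderiv_fun_neg, fderiv_comp_add_right]
  rw [this]; rfl

/-- Difference quotients are controlled by the distributional derivative. -/
theorem integral_mul_shift_sub_le {O O' : Set (ℝ × ℝ)} {u ψ : ℝ × ℝ → ℝ} (hu : Continuous u)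
    (e : ℝ × ℝ) {K h : ℝ} (hK : ∀ ψ, IsTest O' ψ → pairing e u ψ ≤ K) (hh : 0 ≤ h)
    (hO : ∀ x ∈ O, ∀ s ∈ Icc 0 h, x + s • e ∈ O') (hψ : IsTest O ψ) :
    ∫ p, ψ p * (u (p + h • e) - u p) ≤ h * K := by
  have hψc : Continuous ψ := hψ.contDiff.continuous
  have hdψ : Continuous (fderiv ℝ ψ) := hψ.contDiff.continuous_fderiv one_ne_zero
  have hti : ∀ a, Integrable (fun p => ψ (p - a) * u p) := fun a => by
    apply Continuous.integrable_of_hasCompactSupport (by fun_prop)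
    exact (hψ.compact.comp_homeomorph (Homeomorph.subRight a)).mul_right
  have h1 : ∫ p, ψ p * (u (p + h • e) - u p) = ∫ p, (ψ (p - h • e) - ψ p) * u p := by
    have e1 : ∫ p, ψ p * u (p + h • e) = ∫ p, ψ (p - h • e) * u p := by
      rw [← integral_add_right_eq_self (fun p => ψ (p - h • e) * u p) (h • e)]
      simp
    have hi : Integrable (fun p => ψ p * u (p + h • e)) := by
      apply Continuous.integrable_of_hasCompactSupport (by fun_prop)
      exact hψ.compact.mul_right
    have hi0 := hti 0
    simp only [sub_zero] at hi0
    simp only [mul_sub, sub_mul]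
    rw [integral_sub hi hi0, integral_sub (hti _) hi0, e1]
  have h2 : ∀ p, ψ (p - h • e) - ψ p = ∫ s in (0 : ℝ)..h, -(fderiv ℝ ψ (p - s • e) e) := by
    intro p
    have hd : ∀ s ∈ uIcc 0 h, HasDerivAt (fun s : ℝ => ψ (p - s • e))
        (-(fderiv ℝ ψ (p - s • e) e)) s := by
      intro s _
      have a1 : HasDerivAt (fun s : ℝ => p - s • e) (-e) s := by
        have := ((hasDerivAt_id s).smul_const e).const_sub p
        simpa using this
      have a2 := (hψ.contDiff.differentiable one_ne_zero (p - s • e)).hasFDerivAt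
      have := a2.comp_hasDerivAt s a1
      rw [map_neg] at this
      exact this
    rw [intervalIntegral.integral_eq_sub_of_hasDerivAt hd]
    · simp
    · apply Continuous.intervalIntegrable
      fun_prop
  have hG : Continuous (fun q : ℝ × (ℝ × ℝ) => u q.2 * -(fderiv ℝ ψ (q.2 - q.1 • e) e)) := by
    fun_prop
  let C : Set (ℝ × ℝ) := (fun q : ℝ × (ℝ × ℝ) => q.2 + q.1 • e) '' (Icc 0 h ×ˢ tsupport ψ)
  have hC : IsCompact C := by
    apply (isCompact_Icc.prod hψ.compact).image
    fun_prop
  have h_int : IntegrableOn (fun q : ℝ × (ℝ × ℝ) => u q.2 * -(fderiv ℝ ψ (q.2 - q.1 • e) e))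
      (Ioc 0 h ×ˢ univ) := by
    have h3 := hG.continuousOn.integrableOn_compact (μ := volume)
      ((isCompact_Icc (a := (0 : ℝ)) (b := h)).prod hC)
    refine (h3.of_forall_sdiff_eq_zero (measurableSet_Icc.prod MeasurableSet.univ)
      (t := Icc 0 h ×ˢ univ) ?_).mono_set (prod_mono Ioc_subset_Icc_self subset_rfl)
    rintro ⟨s, p⟩ ⟨⟨hs, -⟩, hn⟩
    have : p - s • e ∉ tsupport ψ := fun hp => hn ⟨hs, ⟨s, p - s • e⟩, ⟨hs, hp⟩, by simp⟩
    have h0 : fderiv ℝ ψ (p - s • e) = 0 :=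
      image_eq_zero_of_notMem_tsupport fun hx => this (tsupport_fderiv_subset ℝ hx)
    simp [h0]
  have h4 : ∫ p, (ψ (p - h • e) - ψ p) * u p =
      ∫ s in Ioc 0 h, ∫ p, u p * -(fderiv ℝ ψ (p - s • e) e) := by
    rw [integral_integral_swap]
    · congr 1 with p
      rw [h2, intervalIntegral.integral_of_le hh, integral_const_mul, mul_comm]
    · unfold IntegrableOn at h_int
      rw [Measure.volume_eq_prod, ← Measure.prod_restrict, Measure.restrict_univ] at h_int
      exact h_int
  rw [h1, h4]
  have h_int' : IntegrableOn (fun s => ∫ p, u p * -(fderiv ℝ ψ (p - s • e) e)) (Ioc 0 h) := by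
    unfold IntegrableOn at h_int
    rw [Measure.volume_eq_prod, ← Measure.prod_restrict, Measure.restrict_univ] at h_int
    exact h_int.integral_prod_left
  calc _ ≤ ∫ s in Ioc 0 h, K := by
        refine setIntegral_mono_on h_int' (integrableOn_const (by simp)) measurableSet_Ioc ?_
        intro s hs
        rw [← pairing_neg_comp_sub]
        exact hK _ (hψ.comp_sub _ fun x hx => hO x hx s (Ioc_subset_Icc_self hs))
    _ = h * K := by simp [hh]

theorem enorm_integral_mul_deriv_le_liminf {v φ : ℝ → ℝ} (hv : Continuous v)
    (hφ : IsTest (Ioo 0 1) φ) {h : ℕ → ℝ} (hpos : ∀ n, 0 < h n) (hle : ∀ n, h n ≤ 1)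
    (hlim : Filter.Tendsto h Filter.atTop (nhds 0)) :
    ‖∫ x, v x * deriv φ x‖ₑ ≤
      Filter.liminf (fun n => ∫⁻ x in Ioo 0 (1 - h n), ‖v (x + h n) - v x‖ₑ / ENNReal.ofReal (h n))
        Filter.atTop := by
  have hφc : Continuous φ := hφ.contDiff.continuous
  have hdiff : Differentiable ℝ φ := hφ.contDiff.differentiable one_ne_zero
  obtain ⟨L, hL⟩ := hφ.contDiff.lipschitzWith_of_hasCompactSupport hφ.compact one_ne_zero
  have hsupp : ∀ x, x ∉ Ioo (0 : ℝ) 1 → φ x = 0 := fun x hx =>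
    image_eq_zero_of_notMem_tsupport fun h' => hx (hφ.subset h')
  obtain ⟨δ, hδ, hthick⟩ := hφ.compact.exists_thickening_subset_open isOpen_Ioo hφ.subset
  have hT : Filter.Tendsto (fun n => ∫ x, v x * ((φ x - φ (x - h n)) / h n)) Filter.atTop
      (nhds (∫ x, v x * deriv φ x)) := by
    apply tendsto_integral_of_dominated_convergence
      (bound := (Icc (0 : ℝ) 2).indicator fun x => |v x| * L)
    · intro n
      apply Continuous.aestronglyMeasurable
      fun_prop
    · rw [integrable_indicator_iff measurableSet_Icc]
      apply Continuous.integrableOn_Icc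
      fun_prop
    · intro n
      refine Filter.Eventually.of_forall fun x => ?_
      by_cases hx : x ∈ Icc (0 : ℝ) 2
      · rw [indicator_of_mem hx, Real.norm_eq_abs, abs_mul]
        gcongr
        rw [abs_div, abs_of_pos (hpos n), div_le_iff₀ (hpos n)]
        have := hL.dist_le_mul x (x - h n)
        simp only [Real.dist_eq] at this
        simpa [abs_of_pos (hpos n)] using this
      · rw [indicator_of_notMem hx]
        have h1 : φ x = 0 := hsupp x fun h' => hx ⟨h'.1.le, by linarith [h'.2]⟩
        have h2 : φ (x - h n) = 0 := hsupp _ fun h' =>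
          hx ⟨by linarith [h'.1, hpos n], by linarith [h'.2, hle n]⟩
        simp [h1, h2]
    · refine Filter.Eventually.of_forall fun x => ?_
      apply Filter.Tendsto.const_mul
      have hs := (hdiff x).hasDerivAt.tendsto_slope_zero
      have h0 : Filter.Tendsto (fun n => -h n) Filter.atTop (nhdsWithin 0 {0}ᶜ) := by
        rw [tendsto_nhdsWithin_iff]
        refine ⟨by simpa using hlim.neg, Filter.Eventually.of_forall fun n => ?_⟩
        simpa using (hpos n).ne'
      refine (hs.comp h0).congr fun n => ?_
      simp only [Function.comp, smul_eq_mul, inv_neg, ← sub_eq_add_neg]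
      rw [div_eq_inv_mul]; ring
  have hTe := (continuous_enorm.tendsto _).comp hT
  rw [← hTe.liminf_eq]
  refine Filter.liminf_le_liminf ?_
  filter_upwards [hlim.eventually (gt_mem_nhds hδ)] with n hn
  have hne := (hpos n).ne'
  have hi0 : Integrable (fun x => v x * φ x) :=
    (hv.mul hφc).integrable_of_hasCompactSupport hφ.compact.mul_left
  have hcs : HasCompactSupport (fun x => φ (x - h n)) :=
    hφ.compact.comp_homeomorph (Homeomorph.subRight (h n))
  have hi1 : Integrable (fun x => v x * φ (x - h n)) := by
    apply Continuous.integrable_of_hasCompactSupport (by fun_prop) hcs.mul_left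
  have hi2 : Integrable (fun x => v (x + h n) * φ x) := by
    apply Continuous.integrable_of_hasCompactSupport (by fun_prop) hφ.compact.mul_left
  have e1 : ∫ x, v x * φ (x - h n) = ∫ x, v (x + h n) * φ x := by
    rw [← integral_add_right_eq_self (fun x => v x * φ (x - h n)) (h n)]
    simp
  have e2 : ∫ x, v x * ((φ x - φ (x - h n)) / h n) =
      ∫ x, -((v (x + h n) - v x) / h n * φ x) := by
    have a1 : ∀ x, v x * ((φ x - φ (x - h n)) / h n) =
        (h n)⁻¹ * (v x * φ x - v x * φ (x - h n)) := fun x => by ring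
    have a2 : ∀ x, -((v (x + h n) - v x) / h n * φ x) =
        (h n)⁻¹ * (v x * φ x - v (x + h n) * φ x) := fun x => by ring
    simp only [a1, a2]
    rw [integral_const_mul, integral_const_mul, integral_sub hi0 hi1, integral_sub hi0 hi2, e1]
  simp only [Function.comp]
  rw [e2]
  refine (enorm_integral_le_lintegral_enorm _).trans ?_
  rw [← lintegral_indicator measurableSet_Ioo]
  apply lintegral_mono
  intro x
  simp only
  by_cases hx : x ∈ Ioo 0 (1 - h n)
  · rw [indicator_of_mem hx, enorm_neg, enorm_mul, div_eq_mul_inv, enorm_mul, div_eq_mul_inv,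
      ← ENNReal.ofReal_inv_of_pos (hpos n), Real.enorm_of_nonneg (inv_nonneg.2 (hpos n).le)]
    refine mul_le_of_le_one_right' ?_
    rw [Real.enorm_eq_ofReal_abs]
    exact ENNReal.ofReal_le_one.2 (hφ.bound x)
  · have : φ x = 0 := by
      apply image_eq_zero_of_notMem_tsupport
      intro hxt
      have h1 := hφ.subset hxt
      have h2 : x + h n ∈ Ioo (0 : ℝ) 1 := by
        apply hthick
        rw [Metric.mem_thickening_iff]
        exact ⟨x, hxt, by simpa [Real.dist_eq, abs_of_pos (hpos n)] using hn⟩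
      exact hx ⟨h1.1, by linarith [h2.2]⟩
    simp [this]

theorem IsTest.slice {φ : ℝ × ℝ → ℝ} (hφ : IsTest (Ioo 0 1 ×ˢ Ioo 0 1) φ) (y : ℝ) :
    IsTest (Ioo 0 1) (fun x => φ (x, y)) := by
  have hts : tsupport (fun x => φ (x, y)) ⊆ (fun x => (x, y)) ⁻¹' tsupport φ := by
    apply closure_minimal
    · intro x hx
      exact subset_tsupport _ hx
    · exact (isClosed_tsupport φ).preimage (by fun_prop)
  have hsub : tsupport (fun x => φ (x, y)) ⊆ Ioo 0 1 := fun x hx => (hφ.subset (hts hx)).1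
  refine ⟨hφ.contDiff.comp (contDiff_id.prodMk contDiff_const), ?_, hsub, fun x => hφ.bound _⟩
  exact isCompact_Icc.of_isClosed_subset (isClosed_tsupport _) (hsub.trans Ioo_subset_Icc_self)

theorem IsTest.deriv_slice {O : Set (ℝ × ℝ)} {φ : ℝ × ℝ → ℝ} (hφ : IsTest O φ) (x y : ℝ) :
    deriv (fun x => φ (x, y)) x = fderiv ℝ φ (x, y) (1, 0) := by
  have h1 := (hφ.contDiff.differentiable one_ne_zero (x, y)).hasFDerivAt
  have h2 : HasDerivAt (fun x : ℝ => (x, y)) ((1 : ℝ), (0 : ℝ)) x :=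
    (hasDerivAt_id x).prodMk (hasDerivAt_const x y)
  exact (h1.comp_hasDerivAt x h2).deriv

theorem IsTest.integrable_mul_fderiv {O : Set (ℝ × ℝ)} {φ u : ℝ × ℝ → ℝ} (hφ : IsTest O φ)
    (hu : Continuous u) (e : ℝ × ℝ) : Integrable (fun p => u p * fderiv ℝ φ p e) := by
  have hdφ : Continuous (fderiv ℝ φ) := hφ.contDiff.continuous_fderiv one_ne_zero
  apply Continuous.integrable_of_hasCompactSupport (by fun_prop)
  exact HasCompactSupport.mul_left (hφ.compact.fderiv_apply ℝ e)

/-- A horizontal distributional derivative that is a finite measure stays controlled, slice by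
slice, under any reparametrisation of the slices. -/
theorem exists_slice_variation {u : ℝ × ℝ → ℝ} (hu : Continuous u) {K : ℝ}
    (hK : ∀ ψ, IsTest (Ioo 0 1 ×ˢ Ioo 0 1) ψ → pairing (1, 0) u ψ ≤ K) :
    ∃ V : ℝ → ℝ≥0∞, Measurable V ∧ ∫⁻ y in Ioo 0 1, V y ≤ ENNReal.ofReal K ∧
      ∀ t : ℝ → ℝ, Continuous t → ∀ φ, IsTest (Ioo 0 1 ×ˢ Ioo 0 1) φ →
        ENNReal.ofReal (pairing (1, 0) (fun p => u (p.1, t p.2)) φ) ≤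
          ∫⁻ y in Ioo 0 1, V (t y) := by
  let h : ℕ → ℝ := fun n => 1 / ((n : ℝ) + 1)
  have hpos : ∀ n, 0 < h n := fun n => by positivity
  have hle : ∀ n, h n ≤ 1 := fun n => by
    simp only [h]; rw [div_le_one (by positivity)]; linarith [Nat.cast_nonneg (α := ℝ) n]
  have hlim : Filter.Tendsto h Filter.atTop (nhds 0) := tendsto_one_div_add_atTop_nhds_zero_nat
  let W : ℕ → ℝ → ℝ≥0∞ := fun n y =>
    ∫⁻ x in Ioo 0 (1 - h n), ‖u (x + h n, y) - u (x, y)‖ₑ / ENNReal.ofReal (h n)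
  have hGm : ∀ n, Measurable fun p : ℝ × ℝ =>
      ‖u (p.1 + h n, p.2) - u (p.1, p.2)‖ₑ / ENNReal.ofReal (h n) := fun n => by
    apply Measurable.div_const
    exact (Continuous.measurable (by fun_prop : Continuous fun p : ℝ × ℝ =>
      u (p.1 + h n, p.2) - u (p.1, p.2))).enorm
  have hWm : ∀ n, Measurable (W n) := fun n => (hGm n).lintegral_prod_left'
  have hWi : ∀ n, ∫⁻ y in Ioo 0 1, W n y ≤ ENNReal.ofReal K := by
    intro n
    have h1 : ∫⁻ y in Ioo 0 1, W n y =
        ∫⁻ p in Ioo 0 (1 - h n) ×ˢ Ioo (0 : ℝ) 1,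
          ‖u (p.1 + h n, p.2) - u (p.1, p.2)‖ₑ / ENNReal.ofReal (h n) := by
      rw [Measure.volume_eq_prod, ← Measure.prod_restrict, lintegral_prod_symm _
          (hGm n).aemeasurable]
    rw [h1]
    simp only [div_eq_mul_inv]
    rw [lintegral_mul_const' _ _ (by simp [hpos n])]
    rw [← div_eq_mul_inv]
    apply ENNReal.div_le_of_le_mul
    rw [← ENNReal.ofReal_mul' (hpos n).le]
    refine lintegral_enorm_le_of_forall_isTest volume (isOpen_Ioo.prod isOpen_Ioo)
      ((Metric.isBounded_Ioo _ _).prod (Metric.isBounded_Ioo _ _)) (by fun_prop) ?_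
    intro ψ hψ
    have := integral_mul_shift_sub_le hu (1, 0) hK (hpos n).le (O := Ioo 0 (1 - h n) ×ˢ Ioo 0 1)
      ?_ hψ
    · rw [mul_comm K]
      refine le_trans (le_of_eq ?_) this
      congr 1 with p
      congr 3
      simp [Prod.ext_iff]
    · rintro ⟨x, y⟩ ⟨hx, hy⟩ s hs
      simp only [mem_Ioo, mem_Icc] at hx hy hs
      simp only [mem_prod, mem_Ioo, Prod.mk_add_mk, Prod.smul_mk, smul_eq_mul, mul_one, mul_zero,
        add_zero]
      refine ⟨⟨by linarith, by linarith⟩, hy⟩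
  refine ⟨fun y => Filter.liminf (fun n => W n y) Filter.atTop, .liminf hWm, ?_, ?_⟩
  · refine (lintegral_liminf_le hWm).trans ?_
    refine Filter.liminf_le_of_le ⟨0, by simp⟩ fun b hb => ?_
    obtain ⟨n, hn⟩ := hb.exists
    exact hn.trans (hWi n)
  · intro t ht φ hφ
    have hut : Continuous fun p : ℝ × ℝ => u (p.1, t p.2) := by fun_prop
    have h_int := hφ.integrable_mul_fderiv hut (1, 0)
    have h1 : pairing (1, 0) (fun p => u (p.1, t p.2)) φ =
        ∫ y, ∫ x, u (x, t y) * deriv (fun x => φ (x, y)) x := by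
      simp only [hφ.deriv_slice]
      unfold pairing
      rw [Measure.volume_eq_prod] at h_int ⊢
      rw [integral_prod_symm _ h_int]
    have h2 : pairing (1, 0) (fun p => u (p.1, t p.2)) φ =
        ∫ y in Ioo 0 1, ∫ x, u (x, t y) * deriv (fun x => φ (x, y)) x := by
      rw [h1, setIntegral_eq_integral_of_forall_compl_eq_zero]
      intro y hy
      have : (fun x => φ (x, y)) = fun _ => 0 := by
        ext x
        exact image_eq_zero_of_notMem_tsupport fun hx => hy (hφ.subset hx).2
      simp [this]
    rw [h2]
    refine (Real.ofReal_le_enorm _).trans ((enorm_integral_le_lintegral_enorm _).trans ?_)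
    apply lintegral_mono
    intro y
    exact enorm_integral_mul_deriv_le_liminf (v := fun x => u (x, t y)) (by fun_prop)
      (hφ.slice y) hpos hle hlim

/-- Steklov averages of an increasing homeomorphism of the line are `C¹` increasing
diffeomorphisms close to it. -/
theorem exists_smooth_orderIso_near (t : ℝ ≃o ℝ) {h : ℝ} (hh : 0 < h) :
    ∃ σ : ℝ ≃o ℝ, ContDiff ℝ 1 σ ∧ ∀ y, |σ.symm y - t y| ≤ h := by
  set τ : ℝ → ℝ := ⇑t.symm with hτ
  have hτc : Continuous τ := t.symm.continuous
  have hτm : StrictMono τ := t.symm.strictMono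
  let P : ℝ → ℝ := fun z => ∫ s in (0 : ℝ)..z, τ s
  have hP : ∀ z, HasDerivAt P (τ z) z := fun z =>
    (hτc.integral_hasStrictDerivAt 0 z).hasDerivAt
  let σ : ℝ → ℝ := fun z => h⁻¹ * (P (z + h) - P z)
  have hσd : ∀ z, HasDerivAt σ (h⁻¹ * (τ (z + h) - τ z)) z := fun z =>
    (((hP (z + h)).comp_add_const z h).sub (hP z)).const_mul _
  have hσC : ContDiff ℝ 1 σ := by
    rw [contDiff_one_iff_deriv]
    refine ⟨fun z => (hσd z).differentiableAt, ?_⟩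
    rw [show deriv σ = fun z => h⁻¹ * (τ (z + h) - τ z) from funext fun z => (hσd z).deriv]
    fun_prop
  have hσm : StrictMono σ := strictMono_of_deriv_pos fun z => by
    rw [(hσd z).deriv]
    exact mul_pos (inv_pos.2 hh) (sub_pos.2 (hτm (by linarith)))
  have hbd : ∀ z, τ z ≤ σ z ∧ σ z ≤ τ (z + h) := by
    intro z
    obtain ⟨c, hc, hc'⟩ := exists_hasDerivAt_eq_slope P τ (by linarith : z < z + h)
      (fun x _ => (hP x).continuousAt.continuousWithinAt) (fun x _ => hP x)
    have : σ z = τ c := by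
      rw [hc']; simp only [σ, add_sub_cancel_left]; rw [div_eq_inv_mul]
    rw [this]
    exact ⟨hτm.monotone hc.1.le, hτm.monotone hc.2.le⟩
  have hsurj : Function.Surjective σ := by
    apply hσC.continuous.surjective
    · exact Filter.tendsto_atTop_mono (fun z => (hbd z).1) t.symm.tendsto_atTop
    · refine Filter.tendsto_atBot_mono (fun z => (hbd z).2) ?_
      exact t.symm.tendsto_atBot.comp (Filter.tendsto_atBot_add_const_right _ h Filter.tendsto_id)
  refine ⟨hσm.orderIsoOfSurjective σ hsurj, hσC, fun y => ?_⟩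
  set z := (hσm.orderIsoOfSurjective σ hsurj).symm y with hz
  have hzy : σ z = y := (hσm.orderIsoOfSurjective σ hsurj).apply_symm_apply y
  have h1 := t.monotone (hbd z).1
  have h2 := t.monotone (hbd z).2
  simp only [hτ, OrderIso.apply_symm_apply, hzy] at h1 h2
  rw [abs_le]
  constructor <;> linarith

theorem integral_comp_mul_deriv_orderIso (σ : ℝ ≃o ℝ) (hσ : ContDiff ℝ 1 σ) (G : ℝ → ℝ) :
    ∫ z, G (σ z) * deriv σ z = ∫ y, G y := by
  have h := integral_image_eq_integral_abs_deriv_smul (s := univ) (f := σ) (f' := deriv σ)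
    MeasurableSet.univ
    (fun x _ => (hσ.differentiable one_ne_zero x).hasDerivAt.hasDerivWithinAt)
    σ.injective.injOn G
  rw [image_univ, σ.surjective.range_eq] at h
  simp only [Measure.restrict_univ, smul_eq_mul] at h
  rw [h]
  congr 1 with z
  rw [abs_of_nonneg σ.monotone.deriv_nonneg, mul_comm]

theorem pairing_comp_orderIso {O : Set (ℝ × ℝ)} {u φ : ℝ × ℝ → ℝ} (hu : Continuous u)
    (σ : ℝ ≃o ℝ) (hσ : ContDiff ℝ 1 σ) (hφ : IsTest O φ)
    (hψ : IsTest O fun p : ℝ × ℝ => φ (p.1, σ p.2)) :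
    pairing (0, 1) u (fun p => φ (p.1, σ p.2)) =
      pairing (0, 1) (fun p => u (p.1, σ.symm p.2)) φ := by
  have hd : ∀ x z, fderiv ℝ (fun p : ℝ × ℝ => φ (p.1, σ p.2)) (x, z) (0, 1) =
      fderiv ℝ φ (x, σ z) (0, 1) * deriv σ z := by
    intro x z
    have h1 := (hφ.contDiff.differentiable one_ne_zero (x, σ z)).hasFDerivAt
    have h2 := (hψ.contDiff.differentiable one_ne_zero (x, z)).hasFDerivAt
    have h3 : HasDerivAt (fun z : ℝ => (x, z)) ((0 : ℝ), (1 : ℝ)) z :=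
      (hasDerivAt_const z x).prodMk (hasDerivAt_id z)
    have h4 : HasDerivAt (fun z : ℝ => (x, σ z)) ((0 : ℝ), deriv σ z) z :=
      (hasDerivAt_const z x).prodMk (hσ.differentiable one_ne_zero z).hasDerivAt
    have h5 : HasDerivAt (fun z => φ (x, σ z)) _ z := h2.comp_hasDerivAt z h3
    have h6 : HasDerivAt (fun z => φ (x, σ z)) _ z :=
        h1.comp_hasDerivAt (f := fun z => (x, σ z)) z h4
    have h7 := h5.unique h6
    rw [h7, show ((0 : ℝ), deriv σ z) = deriv σ z • ((0 : ℝ), (1 : ℝ)) by simp, map_smul,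
      smul_eq_mul, mul_comm]
  have hc : Continuous fun p : ℝ × ℝ => u (p.1, σ.symm p.2) := by
    have := σ.symm.continuous
    fun_prop
  have i1 := hψ.integrable_mul_fderiv hu (0, 1)
  have i2 := hφ.integrable_mul_fderiv hc (0, 1)
  unfold pairing
  rw [Measure.volume_eq_prod] at i1 i2 ⊢
  rw [integral_prod _ i1, integral_prod _ i2]
  congr 1 with x
  rw [← integral_comp_mul_deriv_orderIso σ hσ
    fun y => u ((x, y).1, σ.symm (x, y).2) * fderiv ℝ φ (x, y) (0, 1)]
  congr 1 with z
  simp only [hd, σ.symm_apply_apply, mul_assoc]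

/-- The vertical variation does not increase under a vertical reparametrisation. -/
theorem pairing_vertical_comp_le {u : ℝ × ℝ → ℝ} (hu : Continuous u) {K : ℝ}
    (hK : ∀ ψ, IsTest (Ioo 0 1 ×ˢ Ioo 0 1) ψ → pairing (0, 1) u ψ ≤ K) (t : ℝ ≃o ℝ)
    (h0 : t 0 = 0) (h1 : t 1 = 1) {φ : ℝ × ℝ → ℝ} (hφ : IsTest (Ioo 0 1 ×ˢ Ioo 0 1) φ) :
    pairing (0, 1) (fun p => u (p.1, t p.2)) φ ≤ K := by
  let h : ℕ → ℝ := fun n => 1 / ((n : ℝ) + 1)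
  have hpos : ∀ n, 0 < h n := fun n => by positivity
  have hlim : Filter.Tendsto h Filter.atTop (nhds 0) := tendsto_one_div_add_atTop_nhds_zero_nat
  choose σ hσC hσt using fun n => exists_smooth_orderIso_near t (hpos n)
  have htmem : ∀ y ∈ Ioo (0 : ℝ) 1, t y ∈ Ioo (0 : ℝ) 1 := fun y hy => by
    rw [← h0, ← h1]
    exact ⟨t.strictMono hy.1, t.strictMono (by simpa [h1] using hy.2)⟩
  have hcomp : IsCompact ((fun p : ℝ × ℝ => t p.2) '' tsupport φ) :=
    hφ.compact.image (t.continuous.comp continuous_snd)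
  have hsub : (fun p : ℝ × ℝ => t p.2) '' tsupport φ ⊆ Ioo 0 1 := by
    rintro _ ⟨p, hp, rfl⟩
    exact htmem _ (hφ.subset hp).2
  obtain ⟨δ, hδ, hthick⟩ := hcomp.exists_thickening_subset_open isOpen_Ioo hsub
  have hmem : ∀ n, h n < δ → ∀ p ∈ tsupport φ, (σ n).symm p.2 ∈ Ioo (0 : ℝ) 1 := by
    intro n hn p hp
    apply hthick
    rw [Metric.mem_thickening_iff]
    exact ⟨_, ⟨p, hp, rfl⟩, by rw [Real.dist_eq]; exact (hσt n p.2).trans_lt hn⟩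
  have hev : ∀ᶠ n in Filter.atTop, h n < δ := hlim.eventually (gt_mem_nhds hδ)
  have htest : ∀ n, h n < δ → IsTest (Ioo 0 1 ×ˢ Ioo 0 1) fun p : ℝ × ℝ => φ (p.1, σ n p.2) := by
    intro n hn
    let H : ℝ × ℝ ≃ₜ ℝ × ℝ := (Homeomorph.refl ℝ).prodCongr (σ n).toHomeomorph
    have hts : tsupport (fun p : ℝ × ℝ => φ (p.1, σ n p.2)) ⊆ H ⁻¹' tsupport φ := by
      apply closure_minimal
      · intro x hx
        exact subset_tsupport _ hx
      · exact (isClosed_tsupport φ).preimage H.continuous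
    refine ⟨?_, hφ.compact.comp_homeomorph H, ?_, fun p => hφ.bound _⟩
    · exact hφ.contDiff.comp (contDiff_fst.prodMk ((hσC n).comp contDiff_snd))
    · intro p hp
      have hp' : (p.1, σ n p.2) ∈ tsupport φ := hts hp
      have := hmem n hn _ hp'
      simp only [OrderIso.symm_apply_apply] at this
      exact ⟨(hφ.subset hp').1, this⟩
  have hT : Filter.Tendsto (fun n => pairing (0, 1) (fun p => u (p.1, (σ n).symm p.2)) φ)
      Filter.atTop (nhds (pairing (0, 1) (fun p => u (p.1, t p.2)) φ)) := by
    obtain ⟨B, hB⟩ := (((isCompact_Icc (a := (0 : ℝ)) (b := 1)).prod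
      (isCompact_Icc (a := (0 : ℝ)) (b := 1))).image hu).isBounded.exists_norm_le
    apply tendsto_integral_filter_of_dominated_convergence
      (bound := fun p => ‖B * fderiv ℝ φ p (0, 1)‖)
    · refine Filter.Eventually.of_forall fun n => ?_
      refine (hφ.integrable_mul_fderiv ?_ (0, 1)).aestronglyMeasurable
      have := (σ n).symm.continuous
      fun_prop
    · filter_upwards [hev] with n hn
      refine Filter.Eventually.of_forall fun p => ?_
      by_cases hp : p ∈ tsupport φ
      · rw [norm_mul, norm_mul]
        gcongr
        refine (hB _ ⟨(p.1, (σ n).symm p.2), ⟨Ioo_subset_Icc_self (hφ.subset hp).1,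
          Ioo_subset_Icc_self (hmem n hn p hp)⟩, rfl⟩).trans (le_abs_self B)
      · have : fderiv ℝ φ p = 0 :=
          image_eq_zero_of_notMem_tsupport fun hx => hp (tsupport_fderiv_subset ℝ hx)
        simp [this]
    · exact (hφ.integrable_mul_fderiv (u := fun _ => B) continuous_const (0, 1)).norm
    · refine Filter.Eventually.of_forall fun p => ?_
      apply Filter.Tendsto.mul_const
      refine (hu.tendsto _).comp ?_
      refine Filter.Tendsto.prodMk_nhds tendsto_const_nhds ?_
      rw [tendsto_iff_dist_tendsto_zero]
      exact squeeze_zero (fun _ => dist_nonneg) (fun n => by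
        rw [Real.dist_eq]; exact hσt n p.2) hlim
  refine le_of_tendsto hT ?_
  filter_upwards [hev] with n hn
  rw [← pairing_comp_orderIso hu (σ n) (hσC n) hφ (htest n hn)]
  exact hK _ (htest n hn)

/-- The identification of `ℝ × ℝ` with the Euclidean plane. -/
def planeEquiv : (ℝ × ℝ) ≃L[ℝ] Plane :=
  (ContinuousLinearEquiv.finTwoArrow ℝ ℝ).symm.trans (EuclideanSpace.equiv (Fin 2) ℝ).symm

@[simp] theorem planeEquiv_apply_zero (p : ℝ × ℝ) : planeEquiv p 0 = p.1 := rfl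

@[simp] theorem planeEquiv_apply_one (p : ℝ × ℝ) : planeEquiv p 1 = p.2 := rfl

theorem planeEquiv_basis_zero : planeEquiv (1, 0) = e2 0 := by
  ext i; fin_cases i <;> simp [e2]

theorem planeEquiv_basis_one : planeEquiv (0, 1) = e2 1 := by
  ext i; fin_cases i <;> simp [e2]

theorem measurePreserving_planeEquiv : MeasurePreserving planeEquiv :=
  (PiLp.volume_preserving_toLp (Fin 2)).comp (volume_preserving_finTwoArrow ℝ).symm

theorem measurableEmbedding_planeEquiv : MeasurableEmbedding planeEquiv :=
  planeEquiv.toHomeomorph.measurableEmbedding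

theorem preimage_planeEquiv_unitSq : planeEquiv ⁻¹' unitSq = Ioo 0 1 ×ˢ Ioo 0 1 := by
  ext p; simp [unitSq, and_assoc]

theorem isOpen_unitSq : IsOpen unitSq := by
  rw [← planeEquiv.toHomeomorph.isOpen_preimage]
  exact preimage_planeEquiv_unitSq ▸ isOpen_Ioo.prod isOpen_Ioo

theorem volume_unitSq : volume unitSq = 1 := by
  rw [← measurePreserving_planeEquiv.measure_preimage_emb measurableEmbedding_planeEquiv,
    preimage_planeEquiv_unitSq, Measure.volume_eq_prod, Measure.prod_prod]
  simp

theorem isTest_comp_planeEquiv {ψ : Plane → ℝ} (h : IsTest unitSq ψ) :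
    IsTest (Ioo 0 1 ×ˢ Ioo 0 1) (fun p => ψ (planeEquiv p)) where
  contDiff := h.contDiff.comp planeEquiv.contDiff
  compact := h.compact.comp_homeomorph planeEquiv.toHomeomorph
  subset := by
    rw [← preimage_planeEquiv_unitSq]
    refine subset_trans ?_ (preimage_mono h.subset)
    apply closure_minimal
    · intro x hx
      exact subset_tsupport _ hx
    · exact (isClosed_tsupport ψ).preimage planeEquiv.continuous
  bound p := h.bound _

theorem isTest_comp_planeEquiv_symm {ψ : ℝ × ℝ → ℝ} (h : IsTest (Ioo 0 1 ×ˢ Ioo 0 1) ψ) :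
    IsTest unitSq (fun z => ψ (planeEquiv.symm z)) where
  contDiff := h.contDiff.comp planeEquiv.symm.contDiff
  compact := h.compact.comp_homeomorph planeEquiv.symm.toHomeomorph
  subset := by
    have h1 : tsupport (fun z => ψ (planeEquiv.symm z)) ⊆ planeEquiv.symm ⁻¹' tsupport ψ := by
      apply closure_minimal
      · intro x hx
        exact subset_tsupport _ hx
      · exact (isClosed_tsupport ψ).preimage planeEquiv.symm.continuous
    intro z hz
    have h2 := h.subset (h1 hz)
    rw [← preimage_planeEquiv_unitSq] at h2
    simpa using h2
  bound p := h.bound _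

theorem fderiv_comp_planeEquiv {ψ : Plane → ℝ} (h : IsTest unitSq ψ) (p e : ℝ × ℝ) :
    fderiv ℝ (fun p => ψ (planeEquiv p)) p e = fderiv ℝ ψ (planeEquiv p) (planeEquiv e) := by
  have h1 := (h.contDiff.differentiable one_ne_zero (planeEquiv p)).hasFDerivAt
  have h2 := h1.comp p planeEquiv.hasFDerivAt
  have h3 : fderiv ℝ (fun p => ψ (planeEquiv p)) p = _ := h2.fderiv
  rw [h3]; rfl

/-- `F₀, F₁` are the coordinates of `f` on the unit square. -/
structure IsCoords (f : Plane → Plane) (F₀ F₁ : ℝ × ℝ → ℝ) : Prop where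
  cont_zero : Continuous F₀
  cont_one : Continuous F₁
  eq_zero : ∀ p, planeEquiv p ∈ unitSq → F₀ p = f (planeEquiv p) 0
  eq_one : ∀ p, planeEquiv p ∈ unitSq → F₁ p = f (planeEquiv p) 1

/-- The pairing of `(F₀, F₁)` with a matrix of test functions. -/
def fieldPairing (F₀ F₁ a b c d : ℝ × ℝ → ℝ) : ℝ :=
  pairing (1, 0) F₀ a + pairing (0, 1) F₀ b + (pairing (1, 0) F₁ c + pairing (0, 1) F₁ d)

theorem setIntegral_eq_fieldPairing {f : Plane → Plane} {F₀ F₁ : ℝ × ℝ → ℝ}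
    (hF : IsCoords f F₀ F₁) {a b c d : Plane → ℝ} (ha : IsTest unitSq a) (hb : IsTest unitSq b)
    (hc : IsTest unitSq c) (hd : IsTest unitSq d) :
    ∫ x in unitSq, (f x 0 * (fderiv ℝ a x (e2 0) + fderiv ℝ b x (e2 1)) +
      f x 1 * (fderiv ℝ c x (e2 0) + fderiv ℝ d x (e2 1))) =
    fieldPairing F₀ F₁ (fun p => a (planeEquiv p)) (fun p => b (planeEquiv p))
      (fun p => c (planeEquiv p)) (fun p => d (planeEquiv p)) := by
  rw [← measurePreserving_planeEquiv.setIntegral_preimage_emb measurableEmbedding_planeEquiv]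
  have hz : ∀ {ψ : Plane → ℝ}, IsTest unitSq ψ → ∀ p, planeEquiv p ∉ unitSq →
      fderiv ℝ ψ (planeEquiv p) = 0 := fun h p hp =>
    image_eq_zero_of_notMem_tsupport fun hx => hp (h.subset (tsupport_fderiv_subset ℝ hx))
  have h1 : ∀ p ∈ planeEquiv ⁻¹' unitSq,
      f (planeEquiv p) 0 * (fderiv ℝ a (planeEquiv p) (e2 0) + fderiv ℝ b (planeEquiv p) (e2 1)) +
      f (planeEquiv p) 1 * (fderiv ℝ c (planeEquiv p) (e2 0) + fderiv ℝ d (planeEquiv p) (e2 1)) =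
      F₀ p * (fderiv ℝ a (planeEquiv p) (e2 0) + fderiv ℝ b (planeEquiv p) (e2 1)) +
      F₁ p * (fderiv ℝ c (planeEquiv p) (e2 0) + fderiv ℝ d (planeEquiv p) (e2 1)) := by
    intro p hp
    rw [hF.eq_zero p hp, hF.eq_one p hp]
  rw [setIntegral_congr_fun (planeEquiv.continuous.measurable isOpen_unitSq.measurableSet) h1,
    setIntegral_eq_integral_of_forall_compl_eq_zero fun p hp => by
      simp [hz ha p hp, hz hb p hp, hz hc p hp, hz hd p hp]]
  simp only [← planeEquiv_basis_zero, ← planeEquiv_basis_one]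
  simp only [← fderiv_comp_planeEquiv ha, ← fderiv_comp_planeEquiv hb,
    ← fderiv_comp_planeEquiv hc, ← fderiv_comp_planeEquiv hd, mul_add]
  have ia := (isTest_comp_planeEquiv ha).integrable_mul_fderiv hF.cont_zero (1, 0)
  have ib := (isTest_comp_planeEquiv hb).integrable_mul_fderiv hF.cont_zero (0, 1)
  have ic := (isTest_comp_planeEquiv hc).integrable_mul_fderiv hF.cont_one (1, 0)
  have id := (isTest_comp_planeEquiv hd).integrable_mul_fderiv hF.cont_one (0, 1)
  refine (integral_add (ia.add ib) (ic.add id)).trans ?_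
  rw [integral_add' ia ib, integral_add' ic id]
  rfl

theorem mem_varSet_iff {f : Plane → Plane} {F₀ F₁ : ℝ × ℝ → ℝ} (hF : IsCoords f F₀ F₁) (v : ℝ) :
    v ∈ varSet f unitSq ↔ ∃ a b c d, IsTest (Ioo 0 1 ×ˢ Ioo 0 1) a ∧
      IsTest (Ioo 0 1 ×ˢ Ioo 0 1) b ∧ IsTest (Ioo 0 1 ×ˢ Ioo 0 1) c ∧
      IsTest (Ioo 0 1 ×ˢ Ioo 0 1) d ∧ v = fieldPairing F₀ F₁ a b c d := by
  constructor
  · rintro ⟨φ, hφ, hφc, hφs, hφb, rfl⟩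
    have h1 : ContDiff ℝ 1 fun y => (φ y).1 := contDiff_fst.comp hφ
    have h2 : ContDiff ℝ 1 fun y => (φ y).2 := contDiff_snd.comp hφ
    have t1 : ∀ i, IsTest unitSq fun y => (φ y).1 i := fun i =>
      { contDiff := contDiff_euclidean.1 h1 i
        compact := hφc.comp_left (g := fun q : Plane × Plane => q.1 i) rfl
        subset := subset_trans (tsupport_comp_subset (g := fun q : Plane × Plane => q.1 i)
            rfl φ) hφs
        bound := fun x => (hφb x i).1 }
    have t2 : ∀ i, IsTest unitSq fun y => (φ y).2 i := fun i =>
      { contDiff := contDiff_euclidean.1 h2 i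
        compact := hφc.comp_left (g := fun q : Plane × Plane => q.2 i) rfl
        subset := subset_trans (tsupport_comp_subset (g := fun q : Plane × Plane => q.2 i)
            rfl φ) hφs
        bound := fun x => (hφb x i).2 }
    exact ⟨_, _, _, _, isTest_comp_planeEquiv (t1 0), isTest_comp_planeEquiv (t1 1),
      isTest_comp_planeEquiv (t2 0), isTest_comp_planeEquiv (t2 1),
      setIntegral_eq_fieldPairing hF (t1 0) (t1 1) (t2 0) (t2 1)⟩
  · rintro ⟨a, b, c, d, ha, hb, hc, hd, rfl⟩
    have ha' := isTest_comp_planeEquiv_symm ha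
    have hb' := isTest_comp_planeEquiv_symm hb
    have hc' := isTest_comp_planeEquiv_symm hc
    have hd' := isTest_comp_planeEquiv_symm hd
    refine ⟨fun z => (planeEquiv (a (planeEquiv.symm z), b (planeEquiv.symm z)),
      planeEquiv (c (planeEquiv.symm z), d (planeEquiv.symm z))), ?_, ?_, ?_, ?_, ?_⟩
    · exact (planeEquiv.contDiff.comp (ha'.contDiff.prodMk hb'.contDiff)).prodMk
        (planeEquiv.contDiff.comp (hc'.contDiff.prodMk hd'.contDiff))
    · refine HasCompactSupport.intro (((ha'.compact.isCompact.union hb'.compact.isCompact).union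
        hc'.compact.isCompact).union hd'.compact.isCompact) fun z hz => ?_
      simp only [mem_union, not_or] at hz
      have e1 := image_eq_zero_of_notMem_tsupport hz.1.1.1
      have e2 := image_eq_zero_of_notMem_tsupport hz.1.1.2
      have e3 := image_eq_zero_of_notMem_tsupport hz.1.2
      have e4 := image_eq_zero_of_notMem_tsupport hz.2
      rw [e1, e2, e3, e4, ← Prod.zero_eq_mk, map_zero, ← Prod.zero_eq_mk]
    · have hsub := union_subset (union_subset (union_subset ha'.subset hb'.subset) hc'.subset)
        hd'.subset
      refine subset_trans (closure_minimal ?_ ?_) hsub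
      · intro z hz
        by_contra hn
        simp only [mem_union, not_or] at hn
        have e1 := image_eq_zero_of_notMem_tsupport hn.1.1.1
        have e2 := image_eq_zero_of_notMem_tsupport hn.1.1.2
        have e3 := image_eq_zero_of_notMem_tsupport hn.1.2
        have e4 := image_eq_zero_of_notMem_tsupport hn.2
        refine hz ?_
        beta_reduce
        rw [e1, e2, e3, e4, ← Prod.zero_eq_mk, map_zero, ← Prod.zero_eq_mk]
      · exact (((isClosed_tsupport _).union (isClosed_tsupport _)).union
          (isClosed_tsupport _)).union (isClosed_tsupport _)
    · intro z i
      fin_cases i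
      · exact ⟨ha'.bound z, hc'.bound z⟩
      · exact ⟨hb'.bound z, hd'.bound z⟩
    · simp only [planeEquiv_apply_zero, planeEquiv_apply_one]
      rw [setIntegral_eq_fieldPairing hF ha' hb' hc' hd']
      simp

theorem pairing_zero (e : ℝ × ℝ) (u : ℝ × ℝ → ℝ) : pairing e u (fun _ => 0) = 0 := by
  simp [pairing]

/-- The four distributional partial derivatives have masses whose sum is at most the variation. -/
theorem exists_component_bounds {f : Plane → Plane} {F₀ F₁ : ℝ × ℝ → ℝ} (hF : IsCoords f F₀ F₁)
    (hb : BddAbove (varSet f unitSq)) :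
    ∃ A B C D : ℝ, (∀ ψ, IsTest (Ioo 0 1 ×ˢ Ioo 0 1) ψ → pairing (1, 0) F₀ ψ ≤ A) ∧
      (∀ ψ, IsTest (Ioo 0 1 ×ˢ Ioo 0 1) ψ → pairing (0, 1) F₀ ψ ≤ B) ∧
      (∀ ψ, IsTest (Ioo 0 1 ×ˢ Ioo 0 1) ψ → pairing (1, 0) F₁ ψ ≤ C) ∧
      (∀ ψ, IsTest (Ioo 0 1 ×ˢ Ioo 0 1) ψ → pairing (0, 1) F₁ ψ ≤ D) ∧
      A + B + (C + D) ≤ Var f unitSq := by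
  have hle : ∀ a b c d, IsTest (Ioo 0 1 ×ˢ Ioo 0 1) a → IsTest (Ioo 0 1 ×ˢ Ioo 0 1) b →
      IsTest (Ioo 0 1 ×ˢ Ioo 0 1) c → IsTest (Ioo 0 1 ×ˢ Ioo 0 1) d →
      fieldPairing F₀ F₁ a b c d ≤ Var f unitSq := fun a b c d ha hb' hc hd =>
    le_csSup hb ((mem_varSet_iff hF _).2 ⟨a, b, c, d, ha, hb', hc, hd, rfl⟩)
  have z : IsTest (Ioo 0 1 ×ˢ Ioo 0 1) (fun _ : ℝ × ℝ => (0 : ℝ)) := IsTest.zero _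
  let S : ℝ × ℝ → (ℝ × ℝ → ℝ) → Set ℝ := fun e u =>
    (fun ψ => pairing e u ψ) '' {ψ | IsTest (Ioo 0 1 ×ˢ Ioo 0 1) ψ}
  have hne : ∀ e u, (S e u).Nonempty := fun e u => ⟨_, _, z, rfl⟩
  have b1 : BddAbove (S (1, 0) F₀) := ⟨_, by
    rintro _ ⟨ψ, hψ, rfl⟩
    simpa [fieldPairing, pairing_zero] using hle ψ _ _ _ hψ z z z⟩
  have b2 : BddAbove (S (0, 1) F₀) := ⟨_, by
    rintro _ ⟨ψ, hψ, rfl⟩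
    simpa [fieldPairing, pairing_zero] using hle _ ψ _ _ z hψ z z⟩
  have b3 : BddAbove (S (1, 0) F₁) := ⟨_, by
    rintro _ ⟨ψ, hψ, rfl⟩
    simpa [fieldPairing, pairing_zero] using hle _ _ ψ _ z z hψ z⟩
  have b4 : BddAbove (S (0, 1) F₁) := ⟨_, by
    rintro _ ⟨ψ, hψ, rfl⟩
    simpa [fieldPairing, pairing_zero] using hle _ _ _ ψ z z z hψ⟩
  refine ⟨sSup (S (1, 0) F₀), sSup (S (0, 1) F₀), sSup (S (1, 0) F₁), sSup (S (0, 1) F₁),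
    fun ψ hψ => le_csSup b1 ⟨ψ, hψ, rfl⟩, fun ψ hψ => le_csSup b2 ⟨ψ, hψ, rfl⟩,
    fun ψ hψ => le_csSup b3 ⟨ψ, hψ, rfl⟩, fun ψ hψ => le_csSup b4 ⟨ψ, hψ, rfl⟩, ?_⟩
  refine le_of_forall_pos_le_add fun ε hε => ?_
  have key : ∀ e u, ∃ ψ, IsTest (Ioo 0 1 ×ˢ Ioo 0 1) ψ ∧ sSup (S e u) - ε / 4 < pairing e u ψ := by
    intro e u
    obtain ⟨_, ⟨ψ, hψ, rfl⟩, h⟩ := exists_lt_of_lt_csSup (hne e u)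
      (by linarith : sSup (S e u) - ε / 4 < sSup (S e u))
    exact ⟨ψ, hψ, h⟩
  obtain ⟨a, ha, ha'⟩ := key (1, 0) F₀
  obtain ⟨b, hb1, hb'⟩ := key (0, 1) F₀
  obtain ⟨c, hc, hc'⟩ := key (1, 0) F₁
  obtain ⟨d, hd, hd'⟩ := key (0, 1) F₁
  have := hle a b c d ha hb1 hc hd
  simp only [fieldPairing] at this
  linarith

/-- Vertical reparametrisations do not increase the masses of the partial derivatives, provided
they do not increase the integral of a suitable weight. -/
theorem exists_weight_variation {f : Plane → Plane} {F₀ F₁ : ℝ × ℝ → ℝ} (hF : IsCoords f F₀ F₁)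
    (hb : BddAbove (varSet f unitSq)) :
    ∃ V : ℝ → ℝ≥0∞, Measurable V ∧ ∀ t : ℝ ≃o ℝ, t 0 = 0 → t 1 = 1 →
      ∫⁻ y in Ioo 0 1, V (t y) ≤ ∫⁻ y in Ioo 0 1, V y → ∃ A B C D : ℝ,
      (∀ ψ, IsTest (Ioo 0 1 ×ˢ Ioo 0 1) ψ → pairing (1, 0) (fun p => F₀ (p.1, t p.2)) ψ ≤ A) ∧
      (∀ ψ, IsTest (Ioo 0 1 ×ˢ Ioo 0 1) ψ → pairing (0, 1) (fun p => F₀ (p.1, t p.2)) ψ ≤ B) ∧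
      (∀ ψ, IsTest (Ioo 0 1 ×ˢ Ioo 0 1) ψ → pairing (1, 0) (fun p => F₁ (p.1, t p.2)) ψ ≤ C) ∧
      (∀ ψ, IsTest (Ioo 0 1 ×ˢ Ioo 0 1) ψ → pairing (0, 1) (fun p => F₁ (p.1, t p.2)) ψ ≤ D) ∧
      A + B + (C + D) ≤ Var f unitSq := by
  obtain ⟨A, B, C, D, hA, hB, hC, hD, hsum⟩ := exists_component_bounds hF hb
  obtain ⟨V, hVm, hV, hVt⟩ := exists_slice_variation hF.cont_zero hA
  obtain ⟨W, hWm, hW, hWt⟩ := exists_slice_variation hF.cont_one hC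
  have z : IsTest (Ioo 0 1 ×ˢ Ioo 0 1) (fun _ : ℝ × ℝ => (0 : ℝ)) := IsTest.zero _
  have hA0 : 0 ≤ A := by simpa [pairing_zero] using hA _ z
  have hC0 : 0 ≤ C := by simpa [pairing_zero] using hC _ z
  refine ⟨fun y => V y + W y, hVm.add hWm, fun t h0 h1 hle => ?_⟩
  have htot : (∫⁻ y in Ioo 0 1, V (t y)) + ∫⁻ y in Ioo 0 1, W (t y) ≤ ENNReal.ofReal (A + C) :=
    calc _ = ∫⁻ y in Ioo 0 1, (V (t y) + W (t y)) :=
          (lintegral_add_left (hVm.comp t.continuous.measurable) _).symm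
      _ ≤ ∫⁻ y in Ioo 0 1, (V y + W y) := hle
      _ = (∫⁻ y in Ioo 0 1, V y) + ∫⁻ y in Ioo 0 1, W y := lintegral_add_left hVm _
      _ ≤ _ := (add_le_add hV hW).trans_eq (ENNReal.ofReal_add hA0 hC0).symm
  have hfin := htot.trans_lt ENNReal.ofReal_lt_top
  have f1 : (∫⁻ y in Ioo 0 1, V (t y)) ≠ ∞ := (le_self_add.trans_lt hfin).ne
  have f2 : (∫⁻ y in Ioo 0 1, W (t y)) ≠ ∞ := (le_add_self.trans_lt hfin).ne
  refine ⟨(∫⁻ y in Ioo 0 1, V (t y)).toReal, B, (∫⁻ y in Ioo 0 1, W (t y)).toReal, D,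
    fun ψ hψ => ?_, fun ψ hψ => pairing_vertical_comp_le hF.cont_zero hB t h0 h1 hψ,
    fun ψ hψ => ?_, fun ψ hψ => pairing_vertical_comp_le hF.cont_one hD t h0 h1 hψ, ?_⟩
  · exact (ENNReal.ofReal_le_iff_le_toReal f1).1 (hVt t t.continuous ψ hψ)
  · exact (ENNReal.ofReal_le_iff_le_toReal f2).1 (hWt t t.continuous ψ hψ)
  · have := ENNReal.toReal_mono ENNReal.ofReal_ne_top htot
    rw [ENNReal.toReal_add f1 f2, ENNReal.toReal_ofReal (by positivity)] at this
    linarith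

/-- Lower semicontinuity of the variation under uniform convergence. -/
theorem exists_delta_var_lower {f : Plane → Plane} {F₀ F₁ : ℝ × ℝ → ℝ} (hF : IsCoords f F₀ F₁)
    {η : ℝ} (hη : 0 < η) :
    ∃ δ > 0, ∀ (g : Plane → Plane) (G₀ G₁ : ℝ × ℝ → ℝ), IsCoords g G₀ G₁ →
      BddAbove (varSet g unitSq) →
          (∀ p ∈ Ioo 0 1 ×ˢ Ioo 0 1, |F₀ p - G₀ p| ≤ δ ∧ |F₁ p - G₁ p| ≤ δ) →
      Var f unitSq - η ≤ Var g unitSq := by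
  have z : IsTest (Ioo 0 1 ×ˢ Ioo 0 1) (fun _ : ℝ × ℝ => (0 : ℝ)) := IsTest.zero _
  have hne : (varSet f unitSq).Nonempty :=
    ⟨_, (mem_varSet_iff hF _).2 ⟨_, _, _, _, z, z, z, z, rfl⟩⟩
  obtain ⟨v, hv, hlt⟩ := exists_lt_of_lt_csSup hne
    (by simp only [Var]; linarith : Var f unitSq - η / 2 < sSup (varSet f unitSq))
  obtain ⟨a, b, c, d, ha, hb, hc, hd, rfl⟩ := (mem_varSet_iff hF v).1 hv
  let I : ℝ × ℝ → (ℝ × ℝ → ℝ) → ℝ := fun e ψ => ∫ p, |fderiv ℝ ψ p e|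
  have hI : ∀ e ψ, 0 ≤ I e ψ := fun e ψ => integral_nonneg fun _ => abs_nonneg _
  have key : ∀ (e : ℝ × ℝ) {ψ u w : ℝ × ℝ → ℝ} {δ : ℝ}, IsTest (Ioo 0 1 ×ˢ Ioo 0 1) ψ →
      Continuous u → Continuous w → (∀ p ∈ Ioo 0 1 ×ˢ Ioo 0 1, |u p - w p| ≤ δ) →
      pairing e u ψ - δ * I e ψ ≤ pairing e w ψ := by
    intro e ψ u w δ hψ hu hw hd
    have i1 := hψ.integrable_mul_fderiv hu e
    have i2 := hψ.integrable_mul_fderiv hw e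
    have i3 : Integrable (fun p => |fderiv ℝ ψ p e|) := by
      simpa using (hψ.integrable_mul_fderiv (u := fun _ => (1 : ℝ)) continuous_const e).abs
    have : pairing e u ψ - pairing e w ψ ≤ δ * I e ψ := by
      unfold pairing
      rw [← integral_sub i1 i2, ← integral_const_mul]
      refine integral_mono (i1.sub i2) (i3.const_mul _) fun p => ?_
      simp only
      by_cases hp : p ∈ Ioo (0 : ℝ) 1 ×ˢ Ioo (0 : ℝ) 1
      · rw [← sub_mul]
        refine (le_abs_self _).trans ?_
        rw [abs_mul]
        exact mul_le_mul_of_nonneg_right (hd p hp) (abs_nonneg _)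
      · have : fderiv ℝ ψ p = 0 := image_eq_zero_of_notMem_tsupport fun hx =>
          hp (hψ.subset (tsupport_fderiv_subset ℝ hx))
        simp [this]
    linarith
  set T := I (1, 0) a + I (0, 1) b + (I (1, 0) c + I (0, 1) d) with hT
  have hT0 : 0 ≤ T := by
    simp only [hT]
    linarith [hI (1, 0) a, hI (0, 1) b, hI (1, 0) c, hI (0, 1) d]
  refine ⟨η / (2 * (T + 1)), by positivity, fun g G₀ G₁ hG hbdd hdist => ?_⟩
  have h1 : fieldPairing G₀ G₁ a b c d ≤ Var g unitSq :=
    le_csSup hbdd ((mem_varSet_iff hG _).2 ⟨a, b, c, d, ha, hb, hc, hd, rfl⟩)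
  have k1 := key (1, 0) ha hF.cont_zero hG.cont_zero fun p hp => (hdist p hp).1
  have k2 := key (0, 1) hb hF.cont_zero hG.cont_zero fun p hp => (hdist p hp).1
  have k3 := key (1, 0) hc hF.cont_one hG.cont_one fun p hp => (hdist p hp).2
  have k4 := key (0, 1) hd hF.cont_one hG.cont_one fun p hp => (hdist p hp).2
  have k5 : η / (2 * (T + 1)) * T ≤ η / 2 := by
    rw [div_mul_eq_mul_div, div_le_div_iff₀ (by positivity) (by positivity)]
    nlinarith
  simp only [fieldPairing] at h1 hlt
  rw [hT] at k5
  nlinarith [k1, k2, k3, k4]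

/-- The distributional derivative in direction `e` is controlled by difference quotients. -/
theorem pairing_le_of_integral_abs_sub_le {O : Set (ℝ × ℝ)} (hO : MeasurableSet O)
    (hb : Bornology.IsBounded O) {u φ : ℝ × ℝ → ℝ} (hu : Continuous u) (hφ : IsTest O φ)
    (e : ℝ × ℝ) {K C : ℝ}
    (h : ∀ s ∈ Ioc (0 : ℝ) 1, ∫ p in O, |u (p + s • e) - u p| ≤ s * (K + C * s)) :
    pairing e u φ ≤ K := by
  have hφc : Continuous φ := hφ.contDiff.continuous
  have hti : ∀ a, Integrable (fun p => φ (p - a) * u p) := fun a => by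
    apply Continuous.integrable_of_hasCompactSupport (by fun_prop)
    exact (hφ.compact.comp_homeomorph (Homeomorph.subRight a)).mul_right
  have hshift : ∀ s : ℝ, ∫ p, φ p * (u (p + s • e) - u p) = ∫ p, (φ (p - s • e) - φ p) * u p := by
    intro s
    have e1 : ∫ p, φ p * u (p + s • e) = ∫ p, φ (p - s • e) * u p := by
      rw [← integral_add_right_eq_self (fun p => φ (p - s • e) * u p) (s • e)]
      simp
    have hi : Integrable (fun p => φ p * u (p + s • e)) := by
      apply Continuous.integrable_of_hasCompactSupport (by fun_prop)
      exact hφ.compact.mul_right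
    have hi0 := hti 0
    simp only [sub_zero] at hi0
    simp only [mul_sub, sub_mul]
    rw [integral_sub hi hi0, integral_sub (hti _) hi0, e1]
  obtain ⟨L, hL⟩ := hφ.contDiff.lipschitzWith_of_hasCompactSupport hφ.compact one_ne_zero
  -- the support of all small translates is contained in a fixed compact set
  let S : Set (ℝ × ℝ) := (fun q : ℝ × (ℝ × ℝ) => q.2 + q.1 • e) '' (Icc 0 1 ×ˢ tsupport φ)
  have hS : IsCompact S := (isCompact_Icc.prod hφ.compact).image (by fun_prop)
  have hout : ∀ s ∈ Icc (0 : ℝ) 1, ∀ p ∉ S, φ (p - s • e) = 0 := fun s hs p hp =>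
    image_eq_zero_of_notMem_tsupport fun hx => hp ⟨(s, p - s • e), ⟨hs, hx⟩, by simp⟩
  have hlim : Tendsto (fun s : ℝ => ∫ p, s⁻¹ * ((φ p - φ (p - s • e)) * u p)) (𝓝[>] 0)
      (𝓝 (pairing e u φ)) := by
    apply tendsto_integral_filter_of_dominated_convergence
      (S.indicator fun p => L * ‖e‖ * |u p|)
    · filter_upwards with s
      exact (Continuous.aestronglyMeasurable (by fun_prop))
    · filter_upwards [Ioc_mem_nhdsGT (zero_lt_one' ℝ)] with s hs
      filter_upwards with p
      by_cases hp : p ∈ S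
      · rw [indicator_of_mem hp, norm_mul, norm_mul, ← mul_assoc, norm_inv,
          Real.norm_of_nonneg hs.1.le, Real.norm_eq_abs (u p)]
        refine mul_le_mul_of_nonneg_right ?_ (abs_nonneg _)
        rw [inv_mul_le_iff₀ hs.1]
        have := hL.norm_sub_le p (p - s • e)
        rw [sub_sub_cancel, norm_smul, Real.norm_of_nonneg hs.1.le] at this
        linarith
      · have h1 := hout s (Ioc_subset_Icc_self hs) p hp
        have h2 := hout 0 (by simp) p hp
        rw [zero_smul, sub_zero] at h2
        simp [h1, h2, hp]
    · rw [integrable_indicator_iff hS.measurableSet]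
      exact (Continuous.continuousOn (by fun_prop)).integrableOn_compact hS
    · filter_upwards with p
      have hd : HasDerivAt (fun s : ℝ => φ (p - s • e)) (-(fderiv ℝ φ p e)) 0 := by
        have a1 : HasDerivAt (fun s : ℝ => p - s • e) (-e) 0 := by
          simpa using ((hasDerivAt_id (0 : ℝ)).smul_const e).const_sub p
        have a2 := (hφ.contDiff.differentiable one_ne_zero (p - (0 : ℝ) • e)).hasFDerivAt
        have := a2.comp_hasDerivAt 0 a1
        simp only [map_neg, zero_smul, sub_zero] at this
        exact this
      have := (hasDerivAt_iff_tendsto_slope_zero.1 hd).mono_left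
        (nhdsWithin_mono 0 (fun s (hs : s ∈ Ioi (0 : ℝ)) => ne_of_gt hs))
      have := (this.neg.mul_const (u p))
      refine (this.congr fun s => ?_).trans_eq ?_
      · simp; ring
      · simp [mul_comm]
  have hK : Tendsto (fun s : ℝ => K + C * s) (𝓝[>] 0) (𝓝 K) := by
    have : Tendsto (fun s : ℝ => K + C * s) (𝓝 0) (𝓝 (K + C * 0)) :=
      Continuous.tendsto (by fun_prop) 0
    simpa using this.mono_left nhdsWithin_le_nhds
  refine le_of_tendsto_of_tendsto hlim hK ?_
  filter_upwards [Ioc_mem_nhdsGT (zero_lt_one' ℝ)] with s hs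
  rw [integral_const_mul, inv_mul_le_iff₀ hs.1]
  refine le_trans ?_ (h s hs)
  have e2 : ∫ p, (φ p - φ (p - s • e)) * u p = ∫ p, -(φ p * (u (p + s • e) - u p)) := by
    rw [integral_neg, hshift, ← integral_neg]
    congr 1 with p
    ring
  have e3 : ∫ p, -(φ p * (u (p + s • e) - u p)) = ∫ p in O, -(φ p * (u (p + s • e) - u p)) := by
    symm
    apply setIntegral_eq_integral_of_forall_compl_eq_zero
    intro p hp
    rw [image_eq_zero_of_notMem_tsupport fun hx => hp (hφ.subset hx)]
    simp
  rw [e2, e3]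
  have h_int : ∀ w : ℝ × ℝ → ℝ, Continuous w → IntegrableOn w O := fun w hw =>
    (hw.continuousOn.integrableOn_compact hb.isCompact_closure).mono_set subset_closure
  refine setIntegral_mono_on (h_int _ (by fun_prop)) (h_int _ (by fun_prop)) hO fun p _ => ?_
  refine (neg_le_abs _).trans ?_
  rw [abs_mul]
  exact mul_le_of_le_one_left (abs_nonneg _) (hφ.bound p)

theorem volume_real_strip {a b : ℝ} (hab : a ≤ b) :
    (volume : Measure (ℝ × ℝ)).real (Ioo a b ×ˢ Ioo (0 : ℝ) 1) = b - a := by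
  rw [Measure.real, Measure.volume_eq_prod, Measure.prod_prod, Real.volume_Ioo, Real.volume_Ioo,
    ← ENNReal.ofReal_mul (by linarith), ENNReal.toReal_ofReal (by linarith)]
  ring

theorem pairing_horizontal_le_of_lipschitz {a b : ℝ} (hab : a ≤ b) {u φ : ℝ × ℝ → ℝ}
    (hu : Continuous u) {L : ℝ} (hL : ∀ x x' y, |u (x, y) - u (x', y)| ≤ L * |x - x'|)
    (hφ : IsTest (Ioo a b ×ˢ Ioo 0 1) φ) : pairing (1, 0) u φ ≤ L * (b - a) := by
  have hbd := (Metric.isBounded_Ioo a b).prod (Metric.isBounded_Ioo (0 : ℝ) 1)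
  refine pairing_le_of_integral_abs_sub_le (measurableSet_Ioo.prod measurableSet_Ioo)
    hbd hu hφ (1, 0) (C := 0) fun s hs => ?_
  have h1 : ∀ p : ℝ × ℝ, |u (p + s • (1, 0)) - u p| ≤ L * s := fun p => by
    have := hL (p.1 + s) p.1 p.2
    rw [add_sub_cancel_left, abs_of_pos hs.1] at this
    refine le_trans (le_of_eq ?_) this
    congr 3
    simp [Prod.ext_iff]
  have := norm_setIntegral_le_of_norm_le_const (μ := volume) (s := Ioo a b ×ˢ Ioo (0 : ℝ) 1)
    (f := fun p : ℝ × ℝ => |u (p + s • (1, 0)) - u p|) (C := L * s)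
    ((measure_mono subset_closure).trans_lt hbd.isCompact_closure.measure_lt_top)
    (fun p _ => by simpa using h1 p)
  rw [volume_real_strip hab] at this
  refine (le_abs_self _).trans (this.trans_eq ?_)
  ring

theorem pairing_vertical_le_of_monotone {a b : ℝ} (hab : a ≤ b) {u φ : ℝ × ℝ → ℝ}
    (hu : Continuous u) (hm : ∀ x, Monotone fun y => u (x, y)) (h0 : ∀ x, ∀ y ≥ 0, 0 ≤ u (x, y))
    (h1 : ∀ x, ∀ y ≥ 1, u (x, y) ≤ y)
    (hφ : IsTest (Ioo a b ×ˢ Ioo 0 1) φ) : pairing (0, 1) u φ ≤ b - a := by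
  refine pairing_le_of_integral_abs_sub_le (measurableSet_Ioo.prod measurableSet_Ioo)
    ((Metric.isBounded_Ioo a b).prod (Metric.isBounded_Ioo (0 : ℝ) 1)) hu hφ (0, 1)
    (C := b - a) fun s hs => ?_
  have h_int : IntegrableOn (fun p : ℝ × ℝ => |u (p + s • (0, 1)) - u p|)
      (Ioo a b ×ˢ Ioo (0 : ℝ) 1) :=
    ((Continuous.continuousOn (by fun_prop)).integrableOn_compact
      ((isCompact_Icc (a := a) (b := b)).prod (isCompact_Icc (a := (0 : ℝ)) (b := 1)))).mono_set
      (prod_mono Ioo_subset_Icc_self Ioo_subset_Icc_self)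
  have hslice : ∀ x, ∫ y in Ioo (0 : ℝ) 1, |u ((x, y) + s • (0, 1)) - u (x, y)| ≤ s * (1 + s) := by
    intro x
    have hc : Continuous fun y => u (x, y) := by fun_prop
    have hi : ∀ c d : ℝ, IntervalIntegrable (fun y => u (x, y)) volume c d :=
      fun c d => hc.intervalIntegrable c d
    have e1 : ∫ y in Ioo (0 : ℝ) 1, |u ((x, y) + s • (0, 1)) - u (x, y)| =
        ∫ y in (0 : ℝ)..1, (u (x, y + s) - u (x, y)) := by
      rw [intervalIntegral.integral_of_le zero_le_one, integral_Ioc_eq_integral_Ioo]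
      congr 1 with y
      have : ((x, y) : ℝ × ℝ) + s • ((0 : ℝ), (1 : ℝ)) = (x, y + s) := by simp
      rw [this, abs_of_nonneg]
      exact sub_nonneg.2 (hm x (by linarith [hs.1]))
    have e2 : ∫ y in (0 : ℝ)..1, (u (x, y + s) - u (x, y)) =
        (∫ y in (1 : ℝ)..1 + s, u (x, y)) - ∫ y in (0 : ℝ)..s, u (x, y) := by
      have hcs : Continuous fun y => u (x, y + s) := by fun_prop
      rw [intervalIntegral.integral_sub (hcs.intervalIntegrable _ _) (hi _ _),
        intervalIntegral.integral_comp_add_right (fun y => u (x, y)), zero_add]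
      have a1 := intervalIntegral.integral_add_adjacent_intervals (hi 0 s) (hi s (1 + s))
      have a2 := intervalIntegral.integral_add_adjacent_intervals (hi 0 1) (hi 1 (1 + s))
      linarith
    rw [e1, e2]
    have b1 : ∫ y in (1 : ℝ)..1 + s, u (x, y) ≤ ∫ y in (1 : ℝ)..1 + s, (1 + s) :=
      intervalIntegral.integral_mono_on (by linarith [hs.1]) (hi _ _) (by simp)
        fun y hy => (h1 x y hy.1).trans hy.2
    have b2 : 0 ≤ ∫ y in (0 : ℝ)..s, u (x, y) :=
      intervalIntegral.integral_nonneg hs.1.le fun y hy => h0 x y hy.1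
    simp only [intervalIntegral.integral_const, smul_eq_mul, add_sub_cancel_left] at b1
    linarith
  rw [Measure.volume_eq_prod, setIntegral_prod _ (by rwa [Measure.volume_eq_prod] at h_int)]
  have := norm_setIntegral_le_of_norm_le_const (μ := volume) (s := Ioo a b)
    (f := fun x => ∫ y in Ioo (0 : ℝ) 1, |u ((x, y) + s • (0, 1)) - u (x, y)|) (C := s * (1 + s))
    (by simp) (fun x _ => by
      rw [Real.norm_of_nonneg (integral_nonneg fun _ => abs_nonneg _)]; exact hslice x)
  rw [Real.volume_real_Ioo_of_le hab] at this
  refine (le_abs_self _).trans (this.trans_eq ?_)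
  ring

theorem pairing_vertical_le_of_forall_eq {O : Set (ℝ × ℝ)} (hO : MeasurableSet O)
    (hb : Bornology.IsBounded O) {u φ : ℝ × ℝ → ℝ} (hu : Continuous u)
    (h : ∀ x y y', u (x, y) = u (x, y')) (hφ : IsTest O φ) : pairing (0, 1) u φ ≤ 0 := by
  refine pairing_le_of_integral_abs_sub_le hO hb hu hφ (0, 1) (C := 0) fun s hs => ?_
  have : ∀ p : ℝ × ℝ, u (p + s • ((0 : ℝ), (1 : ℝ))) = u p := fun p => by
    have e1 : p + s • ((0 : ℝ), (1 : ℝ)) = (p.1, p.2 + s) := by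
      ext <;> simp
    rw [e1]
    exact h p.1 _ p.2
  simp only [this, sub_self, abs_zero, integral_zero, zero_mul, add_zero, mul_zero, le_refl]

theorem pairing_congr {O : Set (ℝ × ℝ)} {u w φ : ℝ × ℝ → ℝ} (hφ : IsTest O φ) (h : EqOn u w O)
    (e : ℝ × ℝ) : pairing e u φ = pairing e w φ := by
  unfold pairing
  congr 1 with p
  by_cases hp : p ∈ tsupport φ
  · rw [h (hφ.subset hp)]
  · have : fderiv ℝ φ p = 0 :=
      image_eq_zero_of_notMem_tsupport fun hx => hp (tsupport_fderiv_subset ℝ hx)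
    simp [this]

theorem IsTest.mono {O O' : Set (ℝ × ℝ)} {φ : ℝ × ℝ → ℝ} (hφ : IsTest O φ) (h : O ⊆ O') :
    IsTest O' φ := ⟨hφ.contDiff, hφ.compact, hφ.subset.trans h, hφ.bound⟩

theorem exists_abs_deriv_smoothTransition_le :
    ∃ C, 0 ≤ C ∧ ∀ x, |deriv Real.smoothTransition x| ≤ C := by
  have hc : Continuous (deriv Real.smoothTransition) :=
    (Real.smoothTransition.contDiff (n := 1)).continuous_deriv le_rfl
  obtain ⟨C, hC⟩ := (isCompact_Icc (a := (0 : ℝ)) (b := 1)).exists_bound_of_continuousOn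
    hc.continuousOn
  have hC0 : 0 ≤ C := (norm_nonneg _).trans (hC 0 (by simp))
  refine ⟨C, hC0, fun x => ?_⟩
  rcases lt_or_ge x 0 with hx | hx
  · have : Real.smoothTransition =ᶠ[𝓝 x] fun _ => 0 := by
      filter_upwards [Iio_mem_nhds hx] with y hy
      exact Real.smoothTransition.zero_of_nonpos (le_of_lt hy)
    rw [this.deriv_eq]; simpa using hC0
  rcases lt_or_ge 1 x with hx1 | hx1
  · have : Real.smoothTransition =ᶠ[𝓝 x] fun _ => 1 := by
      filter_upwards [Ioi_mem_nhds hx1] with y hy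
      exact Real.smoothTransition.one_of_one_le (le_of_lt hy)
    rw [this.deriv_eq]; simpa using hC0
  · exact hC x ⟨hx, hx1⟩

/-- A partition of unity adapted to the two sides of the line `x = c`. -/
theorem exists_cutoffs : ∃ C, 0 ≤ C ∧ ∀ c r : ℝ, 0 < r → ∃ l m : ℝ → ℝ, ContDiff ℝ 1 l ∧
    ContDiff ℝ 1 m ∧ (∀ x, |l x| ≤ 1) ∧ (∀ x, |m x| ≤ 1) ∧ (∀ x ≥ c - r / 2, l x = 0) ∧
    (∀ x ≤ c + r / 2, m x = 0) ∧ (∀ x, |1 - l x - m x| ≤ 1) ∧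
    (∀ x, r ≤ |x - c| → 1 - l x - m x = 0) ∧
    ∀ x, |deriv (fun x => 1 - l x - m x) x| ≤ C / r := by
  obtain ⟨C, hC, hCd⟩ := exists_abs_deriv_smoothTransition_le
  refine ⟨4 * C, by positivity, fun c r hr => ?_⟩
  have hs : ContDiff ℝ 1 Real.smoothTransition := Real.smoothTransition.contDiff
  have h01 : ∀ x, 0 ≤ Real.smoothTransition x ∧ Real.smoothTransition x ≤ 1 := fun x =>
    ⟨Real.smoothTransition.nonneg x, Real.smoothTransition.le_one x⟩
  have hz : ∀ {x}, x ≤ 0 → Real.smoothTransition x = 0 :=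
    fun hx => Real.smoothTransition.zero_of_nonpos hx
  let l : ℝ → ℝ := fun x => Real.smoothTransition ((2 / r) * (c - x) - 1)
  let m : ℝ → ℝ := fun x => Real.smoothTransition ((2 / r) * (x - c) - 1)
  have hl0 : ∀ x ≥ c - r / 2, l x = 0 := fun x hx => hz (by
    have : (2 / r) * (c - x) ≤ (2 / r) * (r / 2) :=
      mul_le_mul_of_nonneg_left (by linarith) (by positivity)
    have e : (2 / r) * (r / 2) = 1 := by field_simp
    linarith)
  have hm0 : ∀ x ≤ c + r / 2, m x = 0 := fun x hx => hz (by
    have : (2 / r) * (x - c) ≤ (2 / r) * (r / 2) :=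
      mul_le_mul_of_nonneg_left (by linarith) (by positivity)
    have e : (2 / r) * (r / 2) = 1 := by field_simp
    linarith)
  have e2 : (2 / r) * r = 2 := by field_simp
  refine ⟨l, m, hs.comp (by fun_prop), hs.comp (by fun_prop), fun x => ?_, fun x => ?_, hl0, hm0,
    fun x => ?_, fun x hx => ?_, fun x => ?_⟩
  · exact abs_le.2 ⟨by linarith [(h01 ((2 / r) * (c - x) - 1)).1], (h01 _).2⟩
  · exact abs_le.2 ⟨by linarith [(h01 ((2 / r) * (x - c) - 1)).1], (h01 _).2⟩
  · have a := h01 ((2 / r) * (c - x) - 1)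
    have b := h01 ((2 / r) * (x - c) - 1)
    rw [abs_le]
    exact ⟨by linarith, by linarith⟩
  · rcases le_abs.1 hx with h | h
    · have : (2 / r) * r ≤ (2 / r) * (x - c) := mul_le_mul_of_nonneg_left h (by positivity)
      rw [hl0 x (by linarith)]
      simp only [m]
      rw [Real.smoothTransition.one_of_one_le (by linarith)]
      ring
    · have : (2 / r) * r ≤ (2 / r) * (c - x) := mul_le_mul_of_nonneg_left (by linarith)
        (by positivity)
      rw [hm0 x (by linarith)]
      simp only [l]
      rw [Real.smoothTransition.one_of_one_le (by linarith)]
      ring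
  · have hd : ∀ y, HasDerivAt Real.smoothTransition (deriv Real.smoothTransition y) y := fun y =>
      (hs.differentiable one_ne_zero y).hasDerivAt
    have d1 : HasDerivAt l (deriv Real.smoothTransition ((2 / r) * (c - x) - 1) * (2 / r * -1)) x :=
      (hd _).comp x ((((hasDerivAt_id x).const_sub c).const_mul (2 / r)).sub_const 1)
    have d2 : HasDerivAt m (deriv Real.smoothTransition ((2 / r) * (x - c) - 1) * (2 / r * 1)) x :=
      (hd _).comp x ((((hasDerivAt_id x).sub_const c).const_mul (2 / r)).sub_const 1)
    rw [((d1.const_sub 1).fun_sub d2).deriv]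
    have b1 := hCd ((2 / r) * (c - x) - 1)
    have b2 := hCd ((2 / r) * (x - c) - 1)
    have e3 : 4 * C / r = C * (2 / r) + C * (2 / r) := by ring
    have e4 : -(deriv Real.smoothTransition ((2 / r) * (c - x) - 1) * (2 / r * -1)) -
      deriv Real.smoothTransition ((2 / r) * (x - c) - 1) * (2 / r * 1) =
      (deriv Real.smoothTransition ((2 / r) * (c - x) - 1)) * (2 / r) -
      deriv Real.smoothTransition ((2 / r) * (x - c) - 1) * (2 / r) := by ring
    rw [e4, e3]
    refine (abs_sub _ _).trans (add_le_add ?_ ?_)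
    · rw [abs_mul, abs_of_pos (by positivity : 0 < 2 / r)]
      exact mul_le_mul_of_nonneg_right b1 (by positivity)
    · rw [abs_mul, abs_of_pos (by positivity : 0 < 2 / r)]
      exact mul_le_mul_of_nonneg_right b2 (by positivity)

theorem IsTest.fderiv_cutoff_mul {O : Set (ℝ × ℝ)} {φ : ℝ × ℝ → ℝ} (hφ : IsTest O φ) {k : ℝ → ℝ}
    (hk : ContDiff ℝ 1 k) (p e : ℝ × ℝ) :
    fderiv ℝ (fun p : ℝ × ℝ => k p.1 * φ p) p e =
      k p.1 * fderiv ℝ φ p e + e.1 * deriv k p.1 * φ p := by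
  have h1 := (hφ.contDiff.differentiable one_ne_zero p).hasFDerivAt
  have h2 : HasFDerivAt (fun p : ℝ × ℝ => k p.1) _ p :=
    (hk.differentiable one_ne_zero p.1).hasFDerivAt.comp p hasFDerivAt_fst
  rw [(h2.fun_mul h1).fderiv]
  simp
  ring

/-- Distributional derivatives of continuous functions do not charge vertical lines. -/
theorem pairing_le_add_of_split {a b c : ℝ} (hac : a < c) (hcb : c < b) {u φ : ℝ × ℝ → ℝ}
    (hu : Continuous u) {e : ℝ × ℝ} (he : e = (1, 0) ∨ e = (0, 1)) {K₁ K₂ : ℝ}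
    (h₁ : ∀ ψ, IsTest (Ioo a c ×ˢ Ioo 0 1) ψ → pairing e u ψ ≤ K₁)
    (h₂ : ∀ ψ, IsTest (Ioo c b ×ˢ Ioo 0 1) ψ → pairing e u ψ ≤ K₂)
    (hφ : IsTest (Ioo a b ×ˢ Ioo 0 1) φ) : pairing e u φ ≤ K₁ + K₂ := by
  -- subtracting the values on the line does not change horizontal pairings
  obtain ⟨w, hw, hwu, hwc⟩ : ∃ w : ℝ × ℝ → ℝ, Continuous w ∧
      (∀ O ψ, IsTest O ψ → pairing e w ψ = pairing e u ψ) ∧ (e.1 ≠ 0 → ∀ y, w (c, y) = 0) := by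
    rcases he with rfl | rfl
    · refine ⟨fun p => u p - u (c, p.2), by fun_prop, fun O ψ hψ => ?_, fun _ y => by simp⟩
      have hv : Continuous fun p : ℝ × ℝ => u (c, p.2) := by fun_prop
      unfold pairing
      simp only [sub_mul]
      rw [integral_sub (hψ.integrable_mul_fderiv hu _) (hψ.integrable_mul_fderiv hv _)]
      have hi := hψ.integrable_mul_fderiv hv (1, 0)
      have : ∫ p : ℝ × ℝ, u (c, p.2) * fderiv ℝ ψ p (1, 0) = 0 := by
        rw [Measure.volume_eq_prod] at hi ⊢
        rw [integral_prod_symm _ hi]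
        simp only [← hψ.deriv_slice]
        refine integral_eq_zero_of_ae (Eventually.of_forall fun y => ?_)
        simp only [integral_const_mul]
        have hc : ContDiff ℝ 1 (fun x => ψ (x, y)) :=
          hψ.contDiff.comp (contDiff_id.prodMk contDiff_const)
        have hs : HasCompactSupport (fun x => ψ (x, y)) := by
          refine HasCompactSupport.intro (hψ.compact.image continuous_fst) fun x hx => ?_
          exact image_eq_zero_of_notMem_tsupport fun h => hx ⟨_, h, rfl⟩
        rw [integral_eq_zero_of_hasDerivAt_of_integrable
          (fun x => (hc.differentiable one_ne_zero x).hasDerivAt)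
          ((hc.continuous_deriv le_rfl).integrable_of_hasCompactSupport hs.deriv)
          (hc.continuous.integrable_of_hasCompactSupport hs)]
        simp
      rw [this, sub_zero]
    · exact ⟨u, hu, fun _ _ _ => rfl, fun h => absurd rfl h⟩
  have he1 : |e.1| ≤ 1 := by rcases he with rfl | rfl <;> simp
  obtain ⟨C, hC, hcut⟩ := exists_cutoffs
  have hdφ : Continuous (fderiv ℝ φ) := hφ.contDiff.continuous_fderiv one_ne_zero
  let S : Set (ℝ × ℝ) := Icc a b ×ˢ Icc 0 1
  have hS : IsCompact S := isCompact_Icc.prod isCompact_Icc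
  obtain ⟨D, hD⟩ := hS.exists_bound_of_continuousOn
    (Continuous.continuousOn (by fun_prop : Continuous fun p => fderiv ℝ φ p e))
  obtain ⟨B, hB⟩ := hS.exists_bound_of_continuousOn hw.continuousOn
  have hmem : (c, (0 : ℝ)) ∈ S := ⟨⟨hac.le, hcb.le⟩, by simp⟩
  have hD0 : 0 ≤ D := (norm_nonneg _).trans (hD _ hmem)
  have hB0 : 0 ≤ B := (norm_nonneg _).trans (hB _ hmem)
  refine le_of_forall_pos_le_add fun ε hε => ?_
  -- choose the width of the transition region
  obtain ⟨r, hr, hrb, hsmall⟩ : ∃ r > 0, 2 * B * D * r ≤ ε / 2 ∧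
      ∀ p ∈ S, |p.1 - c| ≤ r → |e.1| * |w p| * (2 * C) ≤ ε / 2 := by
    have hr1 : 0 < ε / (4 * (B * D + 1)) := by positivity
    have hbd : ∀ r ≤ ε / (4 * (B * D + 1)), 2 * B * D * r ≤ ε / 2 := fun r hr => by
      have h0 : 0 ≤ B * D := by positivity
      calc 2 * B * D * r = 2 * (B * D) * r := by ring
        _ ≤ 2 * (B * D) * (ε / (4 * (B * D + 1))) := by gcongr
        _ = (ε / 2) * ((B * D) / (B * D + 1)) := by field_simp; ring
        _ ≤ (ε / 2) * 1 := by
            gcongr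
            rw [div_le_one (by positivity)]; linarith
        _ = ε / 2 := mul_one _
    by_cases he0 : e.1 = 0
    · exact ⟨_, hr1, hbd _ le_rfl, fun p _ _ => by simp [he0]; positivity⟩
    · obtain ⟨d, hd, hdw⟩ := Metric.uniformContinuousOn_iff.1
        (hS.uniformContinuousOn_of_continuous hw.continuousOn) (ε / (4 * (C + 1))) (by positivity)
      refine ⟨min (ε / (4 * (B * D + 1))) (d / 2), by positivity, hbd _ (min_le_left _ _),
        fun p hp hpc => ?_⟩
      have h1 := hdw p hp (c, p.2) ⟨⟨hac.le, hcb.le⟩, hp.2⟩ (by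
        rw [Prod.dist_eq]
        simp only [dist_self, Real.dist_eq]
        rw [max_eq_left (abs_nonneg _)]
        linarith [min_le_right (ε / (4 * (B * D + 1))) (d / 2)])
      rw [hwc he0, Real.dist_eq, sub_zero] at h1
      calc |e.1| * |w p| * (2 * C) ≤ 1 * (ε / (4 * (C + 1))) * (2 * C) := by gcongr
        _ = (ε / 2) * (C / (C + 1)) := by field_simp; ring
        _ ≤ (ε / 2) * 1 := by
            gcongr
            rw [div_le_one (by positivity)]; linarith
        _ = ε / 2 := mul_one _
  obtain ⟨l, m, hl, hm, hl1, hm1, hl0, hm0, hk1, hk0, hkd⟩ := hcut c r hr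
  set k : ℝ → ℝ := fun x => 1 - l x - m x with hk
  have hkc : ContDiff ℝ 1 k := (contDiff_const.sub hl).sub hm
  have htest : ∀ (n : ℝ → ℝ) (O : Set (ℝ × ℝ)), ContDiff ℝ 1 n → (∀ x, |n x| ≤ 1) →
      (tsupport (fun p : ℝ × ℝ => n p.1 * φ p) ⊆ O) → IsTest O (fun p => n p.1 * φ p) :=
    fun n O hn hn1 hO => ⟨(hn.comp contDiff_fst).mul hφ.contDiff, hφ.compact.mul_left,
      hO, fun p => by
      rw [abs_mul]; exact mul_le_one₀ (hn1 _) (abs_nonneg _) (hφ.bound p)⟩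
  have hsupp : ∀ n : ℝ → ℝ, tsupport (fun p : ℝ × ℝ => n p.1 * φ p) ⊆ tsupport φ :=
    fun n => tsupport_mul_subset_right
  have tl : IsTest (Ioo a c ×ˢ Ioo 0 1) (fun p => l p.1 * φ p) := by
    refine htest l _ hl hl1 fun p hp => ?_
    have h1 := hφ.subset (hsupp l hp)
    have h2 : p ∈ {p : ℝ × ℝ | p.1 ≤ c - r / 2} := by
      refine closure_minimal (fun q hq => ?_) (isClosed_le continuous_fst continuous_const) hp
      by_contra hn
      simp only [mem_ofPred_eq, not_le] at hn
      exact hq (by simp only [hl0 q.1 hn.le, zero_mul])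
    simp only [mem_ofPred_eq] at h2
    exact ⟨⟨h1.1.1, by linarith⟩, h1.2⟩
  have tm : IsTest (Ioo c b ×ˢ Ioo 0 1) (fun p => m p.1 * φ p) := by
    refine htest m _ hm hm1 fun p hp => ?_
    have h1 := hφ.subset (hsupp m hp)
    have h2 : p ∈ {p : ℝ × ℝ | c + r / 2 ≤ p.1} := by
      refine closure_minimal (fun q hq => ?_) (isClosed_le continuous_const continuous_fst) hp
      by_contra hn
      simp only [mem_ofPred_eq, not_le] at hn
      exact hq (by simp only [hm0 q.1 hn.le, zero_mul])
    simp only [mem_ofPred_eq] at h2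
    exact ⟨⟨by linarith, h1.1.2⟩, h1.2⟩
  have tk : IsTest (Ioo a b ×ˢ Ioo 0 1) (fun p => k p.1 * φ p) :=
    htest k _ hkc hk1 ((hsupp k).trans hφ.subset)
  have hsum : pairing e w φ = pairing e w (fun p => l p.1 * φ p) +
      pairing e w (fun p => m p.1 * φ p) + pairing e w (fun p => k p.1 * φ p) := by
    unfold pairing
    rw [← integral_add (tl.integrable_mul_fderiv hw e) (tm.integrable_mul_fderiv hw e),
      ← integral_add ((tl.integrable_mul_fderiv hw e).fun_add (tm.integrable_mul_fderiv hw e))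
        (tk.integrable_mul_fderiv hw e)]
    congr 1 with p
    rw [hφ.fderiv_cutoff_mul hl, hφ.fderiv_cutoff_mul hm, hφ.fderiv_cutoff_mul hkc]
    have hdk : deriv k p.1 = -deriv l p.1 - deriv m p.1 := by
      have := (((hl.differentiable one_ne_zero p.1).hasDerivAt.const_sub 1).sub
        (hm.differentiable one_ne_zero p.1).hasDerivAt).deriv
      exact this
    rw [hdk]
    simp only [hk]
    ring
  have hkbound : pairing e w (fun p => k p.1 * φ p) ≤ ε := by
    let O : Set (ℝ × ℝ) := Icc (c - r) (c + r) ×ˢ Icc 0 1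
    have hOfin : volume O < ∞ := (isCompact_Icc.prod isCompact_Icc).measure_lt_top
    have hOr : (volume : Measure (ℝ × ℝ)).real O = 2 * r := by
      rw [Measure.real, Measure.volume_eq_prod, Measure.prod_prod, Real.volume_Icc, Real.volume_Icc,
        ← ENNReal.ofReal_mul (by linarith), ENNReal.toReal_ofReal (by nlinarith)]
      ring
    have hzero : ∀ p, p ∉ O ∩ S → w p * fderiv ℝ (fun p : ℝ × ℝ => k p.1 * φ p) p e = 0 := by
      intro p hp
      suffices h : fderiv ℝ (fun p : ℝ × ℝ => k p.1 * φ p) p = 0 by simp [h]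
      refine image_eq_zero_of_notMem_tsupport fun hx => hp ?_
      have hx' := tsupport_fderiv_subset ℝ hx
      have h1 := hφ.subset (hsupp k hx')
      have h2 : p ∈ {p : ℝ × ℝ | |p.1 - c| ≤ r} := by
        refine closure_minimal (fun q hq => ?_) (isClosed_le (by fun_prop) continuous_const) hx'
        by_contra hn
        simp only [mem_ofPred_eq, not_le] at hn
        exact hq (by simp only [hk0 q.1 hn.le, hk, zero_mul])
      simp only [mem_ofPred_eq, abs_le] at h2
      exact ⟨⟨⟨by linarith, by linarith⟩, Ioo_subset_Icc_self h1.2⟩,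
        ⟨Ioo_subset_Icc_self h1.1, Ioo_subset_Icc_self h1.2⟩⟩
    have hbound : ∀ p ∈ O, ‖w p * fderiv ℝ (fun p : ℝ × ℝ => k p.1 * φ p) p e‖ ≤ ε / (2 * r) := by
      intro p hp
      by_cases hpS : p ∈ S
      · rw [hφ.fderiv_cutoff_mul hkc, norm_mul, Real.norm_eq_abs, Real.norm_eq_abs]
        have b1 : |k p.1 * fderiv ℝ φ p e + e.1 * deriv k p.1 * φ p| ≤ D + |e.1| * (C / r) := by
          refine (abs_add_le _ _).trans (add_le_add ?_ ?_)
          · rw [abs_mul]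
            calc _ ≤ 1 * D := mul_le_mul (hk1 _) (hD p hpS) (abs_nonneg _) zero_le_one
              _ = D := one_mul D
          · rw [abs_mul, abs_mul]
            calc _ ≤ |e.1| * (C / r) * 1 := by
                  gcongr
                  · exact hkd _
                  · exact hφ.bound p
              _ = _ := mul_one _
        have b2 : |w p| * D ≤ B * D := mul_le_mul_of_nonneg_right (hB p hpS) hD0
        have b3 := hsmall p hpS (by
          have := hp.1
          simp only [mem_Icc] at this
          rw [abs_le]; exact ⟨by linarith, by linarith⟩)
        calc |w p| * |k p.1 * fderiv ℝ φ p e + e.1 * deriv k p.1 * φ p|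
            ≤ |w p| * (D + |e.1| * (C / r)) := by gcongr
          _ = (2 * r * (|w p| * D) + |e.1| * |w p| * (2 * C)) / (2 * r) := by field_simp
          _ ≤ ε / (2 * r) := by
              gcongr
              nlinarith
      · rw [hzero p fun h => hpS h.2, norm_zero]
        positivity
    have := norm_setIntegral_le_of_norm_le_const hOfin hbound
    rw [hOr, div_mul_cancel₀ _ (by positivity)] at this
    unfold pairing
    rw [← setIntegral_eq_integral_of_forall_compl_eq_zero (s := O)
      fun p hp => hzero p fun h => hp h.1]
    exact (le_abs_self _).trans this
  have q1 := hwu _ _ tl ▸ h₁ _ tl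
  have q2 := hwu _ _ tm ▸ h₂ _ tm
  rw [← hwu _ _ hφ, hsum]
  linarith

/-- The affine homeomorphism `(x, y) ↦ (δ + ℓ x, y)`. -/
def stretch (δ ℓ : ℝ) (hℓ : ℓ ≠ 0) : (ℝ × ℝ) ≃ₜ (ℝ × ℝ) where
  toFun p := (δ + ℓ * p.1, p.2)
  invFun p := ((p.1 - δ) / ℓ, p.2)
  left_inv p := by ext <;> simp [hℓ]
  right_inv p := by
    ext
    · simp; field_simp; ring
    · rfl
  continuous_toFun := by fun_prop
  continuous_invFun := by fun_prop

theorem stretch_apply {δ ℓ : ℝ} (hℓ : ℓ ≠ 0) (p : ℝ × ℝ) :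
    stretch δ ℓ hℓ p = (δ + ℓ * p.1, p.2) := rfl

theorem stretch_symm_apply {δ ℓ : ℝ} (hℓ : ℓ ≠ 0) (p : ℝ × ℝ) :
    (stretch δ ℓ hℓ).symm p = ((p.1 - δ) / ℓ, p.2) := rfl

theorem integral_comp_stretch {δ ℓ : ℝ} (hℓ : 0 < ℓ) {f : ℝ × ℝ → ℝ} (hf : Continuous f)
    (hc : HasCompactSupport f) : ∫ p, f (stretch δ ℓ hℓ.ne' p) = ℓ⁻¹ * ∫ p, f p := by
  have hi : Integrable f := hf.integrable_of_hasCompactSupport hc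
  have hi' : Integrable fun p => f (stretch δ ℓ hℓ.ne' p) :=
    (hf.comp (stretch δ ℓ hℓ.ne').continuous).integrable_of_hasCompactSupport
      (hc.comp_homeomorph _)
  rw [Measure.volume_eq_prod] at hi hi' ⊢
  rw [integral_prod_symm _ hi, integral_prod_symm _ hi', ← integral_const_mul]
  congr 1 with y
  simp only [stretch_apply]
  have h1 := Measure.integral_comp_mul_left (fun x => f (δ + x, y)) ℓ
  have h2 : ∫ x, f (δ + x, y) = ∫ x, f (x, y) := integral_add_left_eq_self (fun x => f (x, y)) δ
  rw [h1, h2, abs_of_pos (by positivity)]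
  rfl

theorem IsTest.comp_stretch {δ ℓ : ℝ} (hℓ : 0 < ℓ) {φ : ℝ × ℝ → ℝ}
    (hφ : IsTest (Ioo δ (δ + ℓ) ×ˢ Ioo 0 1) φ) :
    IsTest (Ioo 0 1 ×ˢ Ioo 0 1) fun p => φ (stretch δ ℓ hℓ.ne' p) where
  contDiff := hφ.contDiff.comp
    ((contDiff_const.add (contDiff_const.mul contDiff_fst)).prodMk contDiff_snd)
  compact := hφ.compact.comp_homeomorph _
  subset := by
    intro p hp
    have h1 : p ∈ stretch δ ℓ hℓ.ne' ⁻¹' tsupport φ := by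
      refine closure_minimal (fun q hq => ?_)
        ((isClosed_tsupport φ).preimage (stretch δ ℓ hℓ.ne').continuous) hp
      exact subset_tsupport φ hq
    have h2 := hφ.subset h1
    simp only [stretch_apply, mem_prod, mem_Ioo] at h2
    exact ⟨⟨by nlinarith [h2.1.1], by nlinarith [h2.1.2]⟩, h2.2⟩
  bound _ := hφ.bound _

theorem IsTest.fderiv_comp_stretch {δ ℓ : ℝ} (hℓ : ℓ ≠ 0) {O : Set (ℝ × ℝ)} {φ : ℝ × ℝ → ℝ}
    (hφ : IsTest O φ) (p e : ℝ × ℝ) :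
    fderiv ℝ (fun p => φ (stretch δ ℓ hℓ p)) p e =
      fderiv ℝ φ (stretch δ ℓ hℓ p) (ℓ * e.1, e.2) := by
  have h1 := (hφ.contDiff.differentiable one_ne_zero (stretch δ ℓ hℓ p)).hasFDerivAt
  have h2 : HasFDerivAt (fun p : ℝ × ℝ => (δ + ℓ * p.1, p.2)) _ p :=
    (((hasFDerivAt_fst (𝕜 := ℝ) (p := p)).const_mul ℓ).const_add δ).prodMk
      (hasFDerivAt_snd (𝕜 := ℝ) (p := p))
  have h3 : HasFDerivAt (fun p => φ (stretch δ ℓ hℓ p)) _ p := h1.comp p h2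
  rw [h3.fderiv]
  simp

theorem pairing_comp_stretch_symm {δ ℓ : ℝ} (hℓ : 0 < ℓ) {u φ : ℝ × ℝ → ℝ} (hu : Continuous u)
    {O : Set (ℝ × ℝ)} (hφ : IsTest O φ) :
    pairing (1, 0) (fun p => u ((stretch δ ℓ hℓ.ne').symm p)) φ =
        pairing (1, 0) u (fun p => φ (stretch δ ℓ hℓ.ne' p)) ∧
      pairing (0, 1) (fun p => u ((stretch δ ℓ hℓ.ne').symm p)) φ =
        ℓ * pairing (0, 1) u (fun p => φ (stretch δ ℓ hℓ.ne' p)) := by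
  have hdφ : Continuous (fderiv ℝ φ) := hφ.contDiff.continuous_fderiv one_ne_zero
  have key : ∀ e, ∫ p, u p * fderiv ℝ φ (stretch δ ℓ hℓ.ne' p) e =
      ℓ⁻¹ * pairing e (fun p => u ((stretch δ ℓ hℓ.ne').symm p)) φ := fun e => by
    have hus : Continuous fun p => u ((stretch δ ℓ hℓ.ne').symm p) :=
      hu.comp (stretch δ ℓ hℓ.ne').symm.continuous
    have := integral_comp_stretch (δ := δ) hℓ
      (f := fun p => u ((stretch δ ℓ hℓ.ne').symm p) * fderiv ℝ φ p e)
      (by fun_prop) (HasCompactSupport.mul_left (hφ.compact.fderiv_apply ℝ e))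
    simpa [pairing] using this
  constructor
  · have h1 : pairing (1, 0) u (fun p => φ (stretch δ ℓ hℓ.ne' p)) =
        ℓ * ∫ p, u p * fderiv ℝ φ (stretch δ ℓ hℓ.ne' p) (1, 0) := by
      unfold pairing
      rw [← integral_const_mul]
      congr 1 with p
      rw [hφ.fderiv_comp_stretch]
      have : ((ℓ * (1 : ℝ), (0 : ℝ)) : ℝ × ℝ) = ℓ • (1, 0) := by simp
      simp only [this, map_smul, smul_eq_mul]
      ring
    rw [h1, key]
    field_simp
  · have h1 : pairing (0, 1) u (fun p => φ (stretch δ ℓ hℓ.ne' p)) =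
        ∫ p, u p * fderiv ℝ φ (stretch δ ℓ hℓ.ne' p) (0, 1) := by
      unfold pairing
      congr 1 with p
      rw [hφ.fderiv_comp_stretch]
      simp
    rw [h1, key]
    field_simp

theorem pairing_stretch_symm_le {δ ℓ : ℝ} (hℓ : 0 < ℓ) (hℓ1 : ℓ ≤ 1) {u φ : ℝ × ℝ → ℝ}
    (hu : Continuous u) {e : ℝ × ℝ} (he : e = (1, 0) ∨ e = (0, 1)) {K : ℝ}
    (hK : ∀ ψ, IsTest (Ioo 0 1 ×ˢ Ioo 0 1) ψ → pairing e u ψ ≤ K)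
    (hφ : IsTest (Ioo δ (δ + ℓ) ×ˢ Ioo 0 1) φ) :
    pairing e (fun p => u ((stretch δ ℓ hℓ.ne').symm p)) φ ≤ K := by
  have hK0 : 0 ≤ K := by simpa [pairing] using hK _ (IsTest.zero _)
  have h := hK _ (hφ.comp_stretch hℓ)
  rcases he with rfl | rfl
  · rwa [(pairing_comp_stretch_symm hℓ hu hφ).1]
  · rw [(pairing_comp_stretch_symm hℓ hu hφ).2]
    exact (mul_le_mul_of_nonneg_left h hℓ.le).trans (mul_le_of_le_one_left hK0 hℓ1)

theorem pairing_const {O : Set (ℝ × ℝ)} {φ : ℝ × ℝ → ℝ} (hφ : IsTest O φ) (e : ℝ × ℝ) (c : ℝ) :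
    pairing e (fun _ => c) φ = 0 := by
  unfold pairing
  rw [integral_const_mul]
  have := integral_mul_fderiv_eq_neg_fderiv_mul_of_integrable
      (𝕜 := ℝ) (μ := (volume : Measure (ℝ × ℝ)))
    (f := fun _ => (1 : ℝ)) (g := φ) (v := e) (by simp)
    (by simpa using hφ.integrable_mul_fderiv (u := fun _ => (1 : ℝ)) continuous_const e)
    (by simpa using hφ.contDiff.continuous.integrable_of_hasCompactSupport hφ.compact)
    (by fun_prop) (fun x _ => hφ.contDiff.differentiable one_ne_zero x)
  simp at this
  simp [this]

theorem pairing_affine_le {O : Set (ℝ × ℝ)} {u φ : ℝ × ℝ → ℝ} (hu : Continuous u)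
    (hφ : IsTest O φ) (e : ℝ × ℝ) {δ ℓ K : ℝ} (hℓ : 0 ≤ ℓ) (hℓ1 : ℓ ≤ 1) (hK0 : 0 ≤ K)
    (hK : pairing e u φ ≤ K) : pairing e (fun p => δ + ℓ * u p) φ ≤ K := by
  have h : pairing e (fun p => δ + ℓ * u p) φ = pairing e (fun _ => δ) φ + ℓ * pairing e u φ := by
    unfold pairing
    rw [← integral_const_mul, ← integral_add
      (hφ.integrable_mul_fderiv continuous_const e) ((hφ.integrable_mul_fderiv hu e).const_mul ℓ)]
    congr 1 with p
    ring
  rw [h, pairing_const hφ, zero_add]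
  exact (mul_le_mul_of_nonneg_left hK hℓ).trans (mul_le_of_le_one_left hK0 hℓ1)

/-- A dyadic partition of unity of `(0, 1)`, with countably many pieces accumulating only at the
end points. -/
theorem exists_dyadic_partition {δ : ℝ} (hδ : 0 < δ) : ∃ c : ℕ → ℝ → ℝ, (∀ k, Continuous (c k)) ∧
    (∀ k x, 0 ≤ c k x ∧ c k x ≤ 1) ∧
    (∀ k x x', |c k x - c k x'| ≤ 3 * 2 ^ k / δ * |x - x'|) ∧
    (∀ x ∈ Ioo (0 : ℝ) 1, HasSum (fun k => c k x) 1) ∧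
    (∀ k, ∀ x ∉ Ioo (0 : ℝ) 1, c k x = 0) ∧
    ∀ x ∈ Icc δ (1 - δ), ∀ k, c k x = if k = 0 then 1 else 0 := by
  let s : ℝ → ℝ := fun x => min x (1 - x)
  let cl : ℝ → ℝ := fun z => max 0 (min 1 z)
  have hcl : ∀ z z', |cl z - cl z'| ≤ |z - z'| := fun z z' => by
    simp only [cl]
    rw [max_comm 0, max_comm 0, min_comm 1, min_comm 1]
    refine (abs_max_sub_max_le_abs _ _ _).trans ((abs_min_sub_min_le_max _ _ _ _).trans ?_)
    simp
  have hs : ∀ x x', |s x - s x'| ≤ |x - x'| := fun x x' => by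
    refine (abs_min_sub_min_le_max _ _ _ _).trans (max_le le_rfl ?_)
    rw [← abs_neg]; apply le_of_eq; congr 1; ring
  have hcl0 : ∀ z ≤ 0, cl z = 0 := fun z hz => by
    simp only [cl]; rw [min_eq_right (by linarith), max_eq_left hz]
  have hcl1 : ∀ z ≥ 1, cl z = 1 := fun z hz => by
    simp only [cl]; rw [min_eq_left hz, max_eq_right zero_le_one]
  have hclm : Monotone cl := fun z z' h => max_le_max le_rfl (min_le_min le_rfl h)
  let a : ℕ → ℝ → ℝ := fun k x => if k = 0 then 0 else cl (2 ^ k * s x / δ - 1)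
  have ha01 : ∀ k x, 0 ≤ a k x ∧ a k x ≤ 1 := fun k x => by
    simp only [a]; split_ifs
    · simp
    · exact ⟨le_max_left _ _, max_le zero_le_one (min_le_left _ _)⟩
  have hac : ∀ k, Continuous (a k) := fun k => by
    simp only [a]; split_ifs
    · exact continuous_const
    · simp only [cl, s]; fun_prop
  have haL : ∀ k x x', |a k x - a k x'| ≤ 2 ^ k / δ * |x - x'| := fun k x x' => by
    simp only [a]; split_ifs
    · simp; positivity
    · refine (hcl _ _).trans ?_
      have : 2 ^ k * s x / δ - 1 - (2 ^ k * s x' / δ - 1) = 2 ^ k / δ * (s x - s x') := by ring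
      rw [this, abs_mul, abs_of_pos (by positivity)]
      exact mul_le_mul_of_nonneg_left (hs _ _) (by positivity)
  have hneg : ∀ k x, s x ≤ 0 → a k x = 0 := fun k x hx => by
    simp only [a]; split_ifs
    · rfl
    · refine hcl0 _ ?_
      have : 2 ^ k * s x / δ ≤ 0 :=
        div_nonpos_of_nonpos_of_nonneg (mul_nonpos_of_nonneg_of_nonpos (by positivity) hx) hδ.le
      linarith
  have ham : ∀ k x, a k x ≤ a (k + 1) x := fun k x => by
    rcases le_or_gt (s x) 0 with hx | hx
    · rw [hneg _ _ hx, hneg _ _ hx]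
    by_cases hk : k = 0
    · simp only [a, hk, if_true]; simpa [a] using (ha01 1 x).1
    · simp only [a, hk, if_false, Nat.succ_ne_zero]
      refine hclm (sub_le_sub_right ?_ 1)
      have : (2 : ℝ) ^ k ≤ 2 ^ (k + 1) := pow_le_pow_right₀ one_le_two k.le_succ
      gcongr
  have hone : ∀ k x, k ≠ 0 → 2 * δ ≤ 2 ^ k * s x → a k x = 1 := fun k x hk h => by
    simp only [a, hk, if_false]
    refine hcl1 _ ?_
    have : 2 ≤ 2 ^ k * s x / δ := by rwa [le_div_iff₀ hδ]
    linarith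
  have hs0 : ∀ x ∉ Ioo (0 : ℝ) 1, s x ≤ 0 := fun x hx => by
    simp only [s]
    rcases le_or_gt x 0 with h | h
    · exact (min_le_left _ _).trans h
    · refine (min_le_right _ _).trans ?_
      linarith [not_lt.1 fun h' => hx ⟨h, h'⟩]
  refine ⟨fun k x => a (k + 1) x - a k x, fun k => (hac _).sub (hac _),
    fun k x => ⟨by linarith [ham k x], by linarith [(ha01 (k + 1) x).2, (ha01 k x).1]⟩,
    fun k x x' => ?_, fun x hx => ?_, fun k x hx => ?_, fun x hx k => ?_⟩
  · have h1 := haL (k + 1) x x'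
    have h2 := haL k x x'
    have : a (k + 1) x - a k x - (a (k + 1) x' - a k x') =
      (a (k + 1) x - a (k + 1) x') - (a k x - a k x') := by ring
    rw [this]
    refine (abs_sub _ _).trans ((add_le_add h1 h2).trans_eq ?_)
    ring
  · rw [hasSum_iff_tendsto_nat_of_nonneg fun k => by linarith [ham k x]]
    refine tendsto_const_nhds.congr' ?_
    have hsx : 0 < s x := lt_min hx.1 (by linarith [hx.2])
    obtain ⟨n, hn⟩ := pow_unbounded_of_one_lt (2 * δ / s x) one_lt_two
    filter_upwards [eventually_ge_atTop (n + 1)] with m hm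
    rw [Finset.sum_range_sub (fun k => a k x), hone m x (by omega)]
    · simp [a]
    · rw [div_lt_iff₀ hsx] at hn
      refine hn.le.trans ?_
      have : (2 : ℝ) ^ n ≤ 2 ^ m := pow_le_pow_right₀ one_le_two (by omega)
      gcongr
  · simp only; rw [hneg _ _ (hs0 x hx), hneg _ _ (hs0 x hx), sub_zero]
  · have hsx : δ ≤ s x := le_min hx.1 (by linarith [hx.2])
    have h1 : ∀ k, k ≠ 0 → a k x = 1 := fun k hk => hone k x hk (by
      have : (2 : ℝ) ^ 1 ≤ 2 ^ k := pow_le_pow_right₀ one_le_two (Nat.one_le_iff_ne_zero.2 hk)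
      rw [pow_one] at this
      gcongr)
    by_cases hk : k = 0
    · simp only [hk, zero_add, h1 1 one_ne_zero, if_true]; simp [a]
    · simp only [h1 _ k.succ_ne_zero, h1 k hk, hk, if_false, sub_self]

/-- Interpolating countably many reparametrisations of the unit interval. -/
theorem exists_interpolation {δ : ℝ} (hδ : 0 < δ) (t : ℕ → ℝ ≃o ℝ)
    (ht : ∀ k, ∀ y ∉ Ioo (0 : ℝ) 1, t k y = y) (htc : ∀ k y, |t k y - y| ≤ δ / 8 * (1 / 4) ^ k) :
    ∃ R : ℝ → ℝ ≃o ℝ, (Continuous fun p : ℝ × ℝ => R p.1 p.2) ∧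
      (∀ x, ∀ y ∉ Ioo (0 : ℝ) 1, R x y = y) ∧ (∀ x ∉ Ioo (0 : ℝ) 1, ∀ y, R x y = y) ∧
      (∀ x ∈ Icc δ (1 - δ), ∀ y, R x y = t 0 y) ∧ (∀ x y, |R x y - y| ≤ δ) ∧
      (∀ x x' y, |R x y - R x' y| ≤ |x - x'|) ∧
      ∀ N, MeasurableSet N → (∀ k, volume ((t k).symm ⁻¹' N) = 0) →
        ∀ x ∈ Ioo (0 : ℝ) 1, volume ((R x).symm ⁻¹' N) = 0 := by
  obtain ⟨c, hcc, hc01, hcL, hcs, hc0, hcm⟩ := exists_dyadic_partition hδ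
  have hg := hasSum_geometric_two
  have hbound : ∀ k (p : ℝ × ℝ), ‖c k p.1 * (t k p.2 - p.2)‖ ≤ δ / 8 * (1 / 2) ^ k := by
    intro k p
    rw [norm_mul, Real.norm_of_nonneg (hc01 k _).1, Real.norm_eq_abs]
    calc _ ≤ 1 * (δ / 8 * (1 / 4) ^ k) := by
          gcongr
          · exact (hc01 k _).2
          · exact htc k _
      _ ≤ δ / 8 * (1 / 2) ^ k := by rw [one_mul]; gcongr; norm_num
  have hsb : Summable fun k : ℕ => δ / 8 * (1 / 2 : ℝ) ^ k := hg.summable.mul_left _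
  have hsum : ∀ x y, Summable fun k => c k x * (t k y - y) := fun x y =>
    Summable.of_norm_bounded hsb fun k => hbound k (x, y)
  let r : ℝ → ℝ → ℝ := fun x y => y + ∑' k, c k x * (t k y - y)
  have hrc : Continuous fun p : ℝ × ℝ => r p.1 p.2 := by
    refine continuous_snd.add (continuous_tsum (fun k => ?_) hsb hbound)
    have h1 : Continuous fun p : ℝ × ℝ => c k p.1 := (hcc k).comp continuous_fst
    have h2 : Continuous fun p : ℝ × ℝ => t k p.2 := (t k).continuous.comp continuous_snd
    fun_prop
  have hrx : ∀ x ∉ Ioo (0 : ℝ) 1, ∀ y, r x y = y := fun x hx y => by simp [r, hc0 _ x hx]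
  have hry : ∀ x, ∀ y ∉ Ioo (0 : ℝ) 1, r x y = y := fun x y hy => by simp [r, ht _ y hy]
  have hrs : ∀ x ∈ Ioo (0 : ℝ) 1, ∀ y, HasSum (fun k => c k x * t k y) (r x y) := fun x hx y => by
    have h1 := ((hcs x hx).mul_right y).add (hsum x y).hasSum
    rw [one_mul] at h1
    refine h1.congr_fun fun k => ?_
    ring
  have hrm : ∀ x, StrictMono (r x) := fun x => by
    by_cases hx : x ∈ Ioo (0 : ℝ) 1
    · intro y z hyz
      obtain ⟨k, hk⟩ : ∃ k, c k x ≠ 0 := by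
        by_contra! h
        have := (hcs x hx)
        simp only [h] at this
        exact zero_ne_one (hasSum_zero.unique this)
      exact hasSum_lt (i := k) (fun j => mul_le_mul_of_nonneg_left ((t j).monotone hyz.le)
          (hc01 j x).1)
        (mul_lt_mul_of_pos_left ((t k).strictMono hyz) ((hc01 k x).1.lt_of_ne' hk))
        (hrs x hx y) (hrs x hx z)
    · intro y z hyz; rwa [hrx x hx, hrx x hx]
  have hrsurj : ∀ x, Function.Surjective (r x) := fun x => by
    refine (hrc.comp (Continuous.prodMk_right x)).surjective ?_ ?_
    · refine tendsto_id.congr' ?_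
      filter_upwards [eventually_ge_atTop 1] with y hy
      exact (hry x y fun h => absurd h.2 (not_lt.2 hy)).symm
    · refine tendsto_id.congr' ?_
      filter_upwards [eventually_le_atBot 0] with y hy
      exact (hry x y fun h => absurd h.1 (not_lt.2 hy)).symm
  let R : ℝ → ℝ ≃o ℝ := fun x => (hrm x).orderIsoOfSurjective (r x) (hrsurj x)
  have hR : ∀ x y, R x y = r x y := fun _ _ => rfl
  refine ⟨R, hrc, hry, hrx, fun x hx y => ?_, fun x y => ?_, fun x x' y => ?_,
    fun N hN hNt x hx => ?_⟩
  · rw [hR]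
    simp only [r]
    rw [tsum_eq_single 0 fun k hk => by rw [hcm x hx k, if_neg hk, zero_mul], hcm x hx 0]
    simp
  · rw [hR]
    simp only [r, add_sub_cancel_left]
    have := tsum_of_norm_bounded (hg.mul_left (δ / 8)) fun k => hbound k (x, y)
    rw [Real.norm_eq_abs] at this
    simp only at this
    linarith
  · rw [hR, hR]
    have h1 : r x y - r x' y = ∑' k, (c k x - c k x') * (t k y - y) := by
      simp only [r, add_sub_add_left_eq_sub]
      rw [← (hsum x y).tsum_sub (hsum x' y)]
      congr 1 with k
      ring
    have h2 : ∀ k, ‖(c k x - c k x') * (t k y - y)‖ ≤ 3 / 8 * |x - x'| * (1 / 2) ^ k := fun k => by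
      rw [norm_mul, Real.norm_eq_abs, Real.norm_eq_abs]
      calc _ ≤ (3 * 2 ^ k / δ * |x - x'|) * (δ / 8 * (1 / 4) ^ k) :=
            mul_le_mul (hcL k x x') (htc k y) (abs_nonneg _) (by positivity)
        _ = 3 / 8 * |x - x'| * (2 ^ k * (1 / 4) ^ k) := by field_simp
        _ = _ := by rw [← mul_pow]; norm_num
    have h3 := tsum_of_norm_bounded (hg.mul_left (3 / 8 * |x - x'|)) h2
    rw [h1]
    rw [Real.norm_eq_abs] at h3
    linarith [abs_nonneg (x - x')]
  · have hmR : Measurable (R x).symm := (R x).symm.continuous.measurable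
    have hmt : ∀ k, Measurable (t k).symm := fun k => (t k).symm.continuous.measurable
    have hIoc : ∀ (e : ℝ ≃o ℝ) a b, e.symm ⁻¹' Ioc a b = Ioc (e a) (e b) := fun e a b => by
      ext z; simp
    have key : Measure.map (R x).symm volume =
        Measure.sum fun k => ENNReal.ofReal (c k x) • Measure.map (t k).symm volume := by
      refine Measure.ext_of_Ioc' _ _ (fun a b _ => ?_) fun a b hab => ?_
      · rw [Measure.map_apply hmR measurableSet_Ioc, hIoc]
        simp
      · rw [Measure.map_apply hmR measurableSet_Ioc, hIoc, Measure.sum_apply _ measurableSet_Ioc,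
          Real.volume_Ioc]
        have hs := (hrs x hx b).sub (hrs x hx a)
        rw [hR, hR, ← hs.tsum_eq, ENNReal.ofReal_tsum_of_nonneg _ hs.summable]
        · congr 1 with k
          rw [Measure.smul_apply, Measure.map_apply (hmt k) measurableSet_Ioc, hIoc,
            Real.volume_Ioc, smul_eq_mul, ← ENNReal.ofReal_mul (hc01 k x).1, mul_sub]
        · intro k
          rw [← mul_sub]
          exact mul_nonneg (hc01 k x).1 (sub_nonneg.2 ((t k).monotone hab.le))
    rw [← Measure.map_apply hmR hN, key, Measure.sum_apply _ hN]
    simp [Measure.map_apply (hmt _) hN, hNt]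

theorem Equiv.symm_eq_of_fixed_compl {α : Type*} (e : α ≃ α) {U : Set α} (h : ∀ p ∉ U, e p = p) :
    ∀ p ∉ U, e.symm p = p := fun p hp => by rw [Equiv.symm_apply_eq, h p hp]

theorem Equiv.apply_mem_iff_of_fixed_compl {α : Type*} (e : α ≃ α) {U : Set α}
    (h : ∀ p ∉ U, e p = p) (p : α) : e p ∈ U ↔ p ∈ U := by
  refine ⟨fun h1 => ?_, fun h1 => ?_⟩ <;> by_contra h2
  · exact h2 (h p h2 ▸ h1)
  · have h3 : e p = p := e.injective (h _ h2)
    exact h2 (by rwa [h3])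

/-- A continuous bijection fixing the complement of a relatively compact open set is a
homeomorphism. -/
def Equiv.toHomeomorphOfFixedCompl {α : Type*} [TopologicalSpace α] [T2Space α] (e : α ≃ α)
    (hc : Continuous e) {U : Set α} (hU : IsOpen U) (hK : IsCompact (closure U))
    (h : ∀ p ∉ U, e p = p) : α ≃ₜ α :=
  e.toHomeomorphOfContinuousClosed hc <| by
    intro C hC
    have h1 : e '' C = e '' (closure U ∩ C) ∪ C ∩ Uᶜ := by
      ext q
      constructor
      · rintro ⟨p, hp, rfl⟩
        by_cases hpU : p ∈ U
        · exact Or.inl ⟨p, ⟨subset_closure hpU, hp⟩, rfl⟩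
        · rw [h p hpU]; exact Or.inr ⟨hp, hpU⟩
      · rintro (⟨p, hp, rfl⟩ | hq)
        · exact ⟨p, hp.2, rfl⟩
        · exact ⟨q, hq.1, h q hq.2⟩
    rw [h1]
    exact ((hK.inter_right hC).image hc).isClosed.union (hC.inter hU.isClosed_compl)

theorem Equiv.toHomeomorphOfFixedCompl_apply {α : Type*} [TopologicalSpace α] [T2Space α]
    (e : α ≃ α) (hc : Continuous e) {U : Set α} (hU : IsOpen U) (hK : IsCompact (closure U))
    (h : ∀ p ∉ U, e p = p) (p : α) : e.toHomeomorphOfFixedCompl hc hU hK h p = e p := rfl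

theorem Equiv.toHomeomorphOfFixedCompl_symm_apply {α : Type*} [TopologicalSpace α] [T2Space α]
    (e : α ≃ α) (hc : Continuous e) {U : Set α} (hU : IsOpen U) (hK : IsCompact (closure U))
    (h : ∀ p ∉ U, e p = p) (p : α) : (e.toHomeomorphOfFixedCompl hc hU hK h).symm p = e.symm p :=
  rfl

theorem isCompact_closure_sq :
    IsCompact (closure (Ioo 0 1 ×ˢ Ioo 0 1 : Set (ℝ × ℝ))) := by
  rw [closure_prod_eq]
  exact ((Metric.isBounded_Ioo 0 1).isCompact_closure).prod
      (Metric.isBounded_Ioo 0 1).isCompact_closure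

theorem planeEquiv_mem_unitSq {p : ℝ × ℝ} :
    planeEquiv p ∈ unitSq ↔ p ∈ (Ioo 0 1 ×ˢ Ioo 0 1 : Set (ℝ × ℝ)) := by
  rw [← preimage_planeEquiv_unitSq, mem_preimage]

theorem exists_homeomorph_of_isHomeoOn {f g : Plane → Plane} (h : IsHomeoOn f g unitSq unitSq)
    (he : ExtendsToId f) : ∃ Φ : (ℝ × ℝ) ≃ₜ (ℝ × ℝ),
    (∀ p ∉ (Ioo 0 1 ×ˢ Ioo 0 1 : Set (ℝ × ℝ)), Φ p = p) ∧
    (∀ p ∈ (Ioo 0 1 ×ˢ Ioo 0 1 : Set (ℝ × ℝ)), f (planeEquiv p) = planeEquiv (Φ p)) ∧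
    ∀ p ∈ (Ioo 0 1 ×ˢ Ioo 0 1 : Set (ℝ × ℝ)), g (planeEquiv p) = planeEquiv (Φ.symm p) := by
  classical
  obtain ⟨hb, -, hinv, -⟩ := h
  have hf : ∀ p ∈ (Ioo 0 1 ×ˢ Ioo 0 1 : Set (ℝ × ℝ)),
      planeEquiv.symm (f (planeEquiv p)) ∈ (Ioo 0 1 ×ˢ Ioo 0 1 : Set (ℝ × ℝ)) := fun p hp => by
    rw [← planeEquiv_mem_unitSq, planeEquiv.apply_symm_apply]
    exact hb.mapsTo (planeEquiv_mem_unitSq.2 hp)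
  have hg : ∀ p ∈ (Ioo 0 1 ×ˢ Ioo 0 1 : Set (ℝ × ℝ)),
      planeEquiv.symm (g (planeEquiv p)) ∈ (Ioo 0 1 ×ˢ Ioo 0 1 : Set (ℝ × ℝ)) := fun p hp => by
    rw [← planeEquiv_mem_unitSq, planeEquiv.apply_symm_apply]
    exact (hinv.1.mapsTo hb.surjOn) (planeEquiv_mem_unitSq.2 hp)
  let e : (ℝ × ℝ) ≃ (ℝ × ℝ) :=
    { toFun := fun p => if p ∈ (Ioo 0 1 ×ˢ Ioo 0 1 : Set (ℝ × ℝ)) then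
        planeEquiv.symm (f (planeEquiv p)) else p
      invFun := fun p => if p ∈ (Ioo 0 1 ×ˢ Ioo 0 1 : Set (ℝ × ℝ)) then
        planeEquiv.symm (g (planeEquiv p)) else p
      left_inv := fun p => by
        by_cases hp : p ∈ (Ioo 0 1 ×ˢ Ioo 0 1 : Set (ℝ × ℝ))
        · simp only [if_pos hp, if_pos (hf p hp), planeEquiv.apply_symm_apply]
          rw [hinv.1 (planeEquiv_mem_unitSq.2 hp), planeEquiv.symm_apply_apply]
        · simp only [if_neg hp]
      right_inv := fun p => by
        by_cases hp : p ∈ (Ioo 0 1 ×ˢ Ioo 0 1 : Set (ℝ × ℝ))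
        · simp only [if_pos hp, if_pos (hg p hp), planeEquiv.apply_symm_apply]
          rw [hinv.2 (planeEquiv_mem_unitSq.2 hp), planeEquiv.symm_apply_apply]
        · simp only [if_neg hp] }
  have hsq : {p : ℝ × ℝ | p ∈ (Ioo 0 1 ×ˢ Ioo 0 1 : Set (ℝ × ℝ))} =
      planeEquiv.toHomeomorph ⁻¹' unitSq := preimage_planeEquiv_unitSq.symm
  have hc : Continuous e := by
    refine continuous_if ?_ ?_ continuousOn_id
    · intro p hp
      rw [hsq, ← planeEquiv.toHomeomorph.preimage_frontier] at hp
      have h2 : f (planeEquiv p) = planeEquiv p := he.2 hp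
      rw [h2, planeEquiv.symm_apply_apply]
    · rw [hsq, ← planeEquiv.toHomeomorph.preimage_closure]
      exact planeEquiv.symm.continuous.comp_continuousOn
        (he.1.comp planeEquiv.continuous.continuousOn fun p hp => hp)
  refine ⟨e.toHomeomorphOfFixedCompl hc (isOpen_Ioo.prod isOpen_Ioo) isCompact_closure_sq
    fun p hp => if_neg hp, fun p hp => if_neg hp, fun p hp => ?_, fun p hp => ?_⟩
  · rw [Equiv.toHomeomorphOfFixedCompl_apply]
    simp only [e, Equiv.coe_fn_mk, if_pos hp, planeEquiv.apply_symm_apply]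
  · rw [Equiv.toHomeomorphOfFixedCompl_symm_apply]
    simp only [e, Equiv.coe_fn_symm_mk, if_pos hp, planeEquiv.apply_symm_apply]

/-- The homeomorphism of `ℝ × ℝ` viewed as a homeomorphism of the Euclidean plane. -/
def planeConj (G : (ℝ × ℝ) ≃ₜ (ℝ × ℝ)) : Plane ≃ₜ Plane :=
  planeEquiv.toHomeomorph.symm.trans (G.trans planeEquiv.toHomeomorph)

theorem planeConj_planeEquiv (G : (ℝ × ℝ) ≃ₜ (ℝ × ℝ)) (p : ℝ × ℝ) :
    planeConj G (planeEquiv p) = planeEquiv (G p) := by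
  show planeEquiv (G (planeEquiv.symm (planeEquiv p))) = _
  rw [planeEquiv.symm_apply_apply]

theorem planeConj_symm_planeEquiv (G : (ℝ × ℝ) ≃ₜ (ℝ × ℝ)) (p : ℝ × ℝ) :
    (planeConj G).symm (planeEquiv p) = planeEquiv (G.symm p) := by
  show planeEquiv (G.symm (planeEquiv.symm (planeEquiv p))) = _
  rw [planeEquiv.symm_apply_apply]

section
variable {G : (ℝ × ℝ) ≃ₜ (ℝ × ℝ)}

theorem planeConj_fixed (hG : ∀ p ∉ (Ioo 0 1 ×ˢ Ioo 0 1 : Set (ℝ × ℝ)), G p = p) :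
    ∀ z ∉ unitSq, planeConj G z = z := by
  intro z hz
  obtain ⟨p, rfl⟩ := planeEquiv.surjective z
  rw [planeConj_planeEquiv, hG p (by rwa [planeEquiv_mem_unitSq] at hz)]

theorem isHomeoOn_planeConj (hG : ∀ p ∉ (Ioo 0 1 ×ˢ Ioo 0 1 : Set (ℝ × ℝ)), G p = p) :
    IsHomeoOn (planeConj G) (planeConj G).symm unitSq unitSq := by
  have h := (planeConj G).toEquiv.apply_mem_iff_of_fixed_compl (planeConj_fixed hG)
  refine ⟨⟨fun z hz => (h z).2 hz, (planeConj G).injective.injOn, fun z hz => ?_⟩,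
    (planeConj G).continuous.continuousOn,
    ⟨fun z _ => (planeConj G).symm_apply_apply z, fun z _ => (planeConj G).apply_symm_apply z⟩,
    (planeConj G).symm.continuous.continuousOn⟩
  exact ⟨(planeConj G).symm z, (h _).1 (((planeConj G).apply_symm_apply z).symm ▸ hz),
    (planeConj G).apply_symm_apply z⟩

theorem extendsToId_planeConj (hG : ∀ p ∉ (Ioo 0 1 ×ˢ Ioo 0 1 : Set (ℝ × ℝ)), G p = p) :
    ExtendsToId (planeConj G) := by
  refine ⟨(planeConj G).continuous.continuousOn, fun z hz => planeConj_fixed hG z fun h => ?_⟩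
  rw [isOpen_unitSq.frontier_eq] at hz
  exact hz.2 h

theorem isCoords_planeConj (G : (ℝ × ℝ) ≃ₜ (ℝ × ℝ)) :
    IsCoords (planeConj G) (fun p => (G p).1) (fun p => (G p).2) where
  cont_zero := continuous_fst.comp G.continuous
  cont_one := continuous_snd.comp G.continuous
  eq_zero p _ := by rw [planeConj_planeEquiv, planeEquiv_apply_zero]
  eq_one p _ := by rw [planeConj_planeEquiv, planeEquiv_apply_one]

theorem integrableOn_planeConj (G : (ℝ × ℝ) ≃ₜ (ℝ × ℝ)) :
    IntegrableOn (planeConj G) unitSq := by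
  have h : IsCompact (closure unitSq) := by
    have h1 := isCompact_closure_sq.image planeEquiv.continuous
    refine h1.closure_of_subset ?_
    rw [← preimage_planeEquiv_unitSq]
    intro z hz
    obtain ⟨p, rfl⟩ := planeEquiv.surjective z
    exact ⟨p, subset_closure hz, rfl⟩
  exact ((planeConj G).continuous.continuousOn.integrableOn_compact h).mono_set subset_closure

end

/-- The variation is at most the sum of bounds for the four partial derivatives. -/
theorem bddAbove_varSet_of_bounds {f : Plane → Plane} {F₀ F₁ : ℝ × ℝ → ℝ} (hF : IsCoords f F₀ F₁)
    {A B C D : ℝ}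
    (hA : ∀ ψ, IsTest (Ioo 0 1 ×ˢ Ioo 0 1) ψ → pairing (1, 0) F₀ ψ ≤ A)
    (hB : ∀ ψ, IsTest (Ioo 0 1 ×ˢ Ioo 0 1) ψ → pairing (0, 1) F₀ ψ ≤ B)
    (hC : ∀ ψ, IsTest (Ioo 0 1 ×ˢ Ioo 0 1) ψ → pairing (1, 0) F₁ ψ ≤ C)
    (hD : ∀ ψ, IsTest (Ioo 0 1 ×ˢ Ioo 0 1) ψ → pairing (0, 1) F₁ ψ ≤ D) :
    BddAbove (varSet f unitSq) ∧ Var f unitSq ≤ A + B + (C + D) := by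
  have h : ∀ v ∈ varSet f unitSq, v ≤ A + B + (C + D) := by
    intro v hv
    obtain ⟨a, b, c, d, ha, hb, hc, hd, rfl⟩ := (mem_varSet_iff hF v).1 hv
    exact add_le_add (add_le_add (hA a ha) (hB b hb)) (add_le_add (hC c hc) (hD d hd))
  refine ⟨⟨_, h⟩, csSup_le ⟨0, ?_⟩ h⟩
  rw [mem_varSet_iff hF]
  exact ⟨_, _, _, _, .zero _, .zero _, .zero _, .zero _, by simp [fieldPairing, pairing_zero]⟩

theorem exists_dist_le_of_fixed_compl {Φ : ℝ × ℝ → ℝ × ℝ} (hc : Continuous Φ)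
    (hΦ : ∀ p ∉ (Ioo 0 1 ×ˢ Ioo 0 1 : Set (ℝ × ℝ)), Φ p = p) {ρ : ℝ} (hρ : 0 < ρ) :
    ∃ r > 0, ∀ p q, dist p q ≤ r → dist (Φ p) (Φ q) ≤ ρ := by
  have h1 : HasCompactSupport (fun p => Φ p - p) :=
    HasCompactSupport.intro isCompact_closure_sq fun p hp => by
      rw [hΦ p fun h => hp (subset_closure h), sub_self]
  have h2 := h1.uniformContinuous_of_continuous (hc.sub continuous_id)
  have h3 : UniformContinuous Φ := by
    have := h2.add uniformContinuous_id
    refine this.congr fun p => ?_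
    simp
  obtain ⟨r, hr, h⟩ := Metric.uniformContinuous_iff.1 h3 ρ hρ
  exact ⟨r / 2, by positivity, fun p q hpq => (h (by linarith)).le⟩

/-- The homeomorphism acting on each vertical line `{x} × ℝ` by `R x`. -/
theorem exists_fiber_homeomorph (R : ℝ → ℝ ≃o ℝ) (hR : Continuous fun p : ℝ × ℝ => R p.1 p.2)
    (h1 : ∀ x, ∀ y ∉ Ioo (0 : ℝ) 1, R x y = y) (h2 : ∀ x ∉ Ioo (0 : ℝ) 1, ∀ y, R x y = y) :
    ∃ T : (ℝ × ℝ) ≃ₜ (ℝ × ℝ), (∀ p, T p = (p.1, R p.1 p.2)) ∧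
      ∀ p, T.symm p = (p.1, (R p.1).symm p.2) := by
  let e : (ℝ × ℝ) ≃ (ℝ × ℝ) :=
    { toFun := fun p => (p.1, R p.1 p.2)
      invFun := fun p => (p.1, (R p.1).symm p.2)
      left_inv := fun p => by simp
      right_inv := fun p => by simp }
  refine ⟨e.toHomeomorphOfFixedCompl (continuous_fst.prodMk hR) (isOpen_Ioo.prod isOpen_Ioo)
    isCompact_closure_sq fun p hp => ?_, fun p => rfl, fun p => rfl⟩
  have h : R p.1 p.2 = p.2 := by
    by_cases hx : p.1 ∈ Ioo (0 : ℝ) 1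
    · exact h1 _ _ fun hy => hp ⟨hx, hy⟩
    · exact h2 _ hx _
  exact Prod.ext rfl h

theorem dist_stretch_self_le {δ : ℝ} (hδ : 0 < δ) (hδ' : δ ≤ 1 / 4) {p : ℝ × ℝ}
    (hp : p.1 ∈ Icc (0 : ℝ) 1) : dist (stretch δ (1 - 2 * δ) (by linarith) p) p ≤ δ := by
  rw [stretch_apply, Prod.dist_eq]
  refine max_le ?_ (by simp [hδ.le])
  rw [Real.dist_eq, abs_le]
  constructor <;> nlinarith [hp.1, hp.2]

theorem dist_stretch_symm_self_le {δ : ℝ} (hδ : 0 < δ) (hδ' : δ ≤ 1 / 4) {p : ℝ × ℝ}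
    (hp : p.1 ∈ Icc (0 : ℝ) 1) :
    dist ((stretch δ (1 - 2 * δ) (by linarith)).symm p) p ≤ 2 * δ := by
  rw [stretch_symm_apply, Prod.dist_eq]
  refine max_le ?_ (by simp [hδ.le])
  have h : (p.1 - δ) / (1 - 2 * δ) - p.1 = δ * (2 * p.1 - 1) / (1 - 2 * δ) := by
    rw [div_sub' (by linarith)]; ring
  rw [Real.dist_eq, h, abs_le, div_le_iff₀ (by linarith), le_div_iff₀ (by linarith)]
  constructor <;> nlinarith [hp.1, hp.2]

/-- Conjugating by the stretch moves a homeomorphism only a little. -/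
theorem dist_stretch_conj_le {δ : ℝ} (hδ : 0 < δ) (hδ' : δ ≤ 1 / 4) (Φ : (ℝ × ℝ) ≃ (ℝ × ℝ))
    (hΦ : ∀ p ∉ (Ioo 0 1 ×ˢ Ioo 0 1 : Set (ℝ × ℝ)), Φ p = p) {p : ℝ × ℝ}
    (hp : p.1 ∈ Icc (0 : ℝ) 1) :
    dist (stretch δ (1 - 2 * δ) (by linarith)
      (Φ ((stretch δ (1 - 2 * δ) (by linarith)).symm p)))
      (Φ ((stretch δ (1 - 2 * δ) (by linarith)).symm p)) ≤ 2 * δ := by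
  set S := stretch δ (1 - 2 * δ) (by linarith)
  by_cases h : S.symm p ∈ (Ioo 0 1 ×ˢ Ioo 0 1 : Set (ℝ × ℝ))
  · have h1 := (Φ.apply_mem_iff_of_fixed_compl hΦ _).2 h
    exact (dist_stretch_self_le hδ hδ' (Ioo_subset_Icc_self h1.1)).trans (by linarith)
  · rw [hΦ _ h, S.apply_symm_apply, dist_comm]
    exact dist_stretch_symm_self_le hδ hδ' hp

theorem pairing_le_of_strips {δ : ℝ} (hδ : 0 < δ) (hδ' : δ ≤ 1 / 4) {u φ : ℝ × ℝ → ℝ}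
    (hu : Continuous u) {e : ℝ × ℝ} (he : e = (1, 0) ∨ e = (0, 1)) {k K : ℝ}
    (h₁ : ∀ ψ, IsTest (Ioo 0 δ ×ˢ Ioo 0 1) ψ → pairing e u ψ ≤ k)
    (h₂ : ∀ ψ, IsTest (Ioo δ (1 - δ) ×ˢ Ioo 0 1) ψ → pairing e u ψ ≤ K)
    (h₃ : ∀ ψ, IsTest (Ioo (1 - δ) 1 ×ˢ Ioo 0 1) ψ → pairing e u ψ ≤ k)
    (hφ : IsTest (Ioo 0 1 ×ˢ Ioo 0 1) φ) : pairing e u φ ≤ K + 2 * k := by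
  have := pairing_le_add_of_split hδ (by linarith : δ < 1) hu he h₁ (fun ψ hψ =>
    pairing_le_add_of_split (by linarith : δ < 1 - δ) (by linarith) hu he h₂ h₃ hψ) hφ
  linarith

/-- A map acting as `(x, y) ↦ (x, R x y)` on two thin strips and as a stretched version of a given
map in between has the variation of the latter, up to a multiple of the width. -/
theorem pairing_bounds_of_strips {δ : ℝ} (hδ : 0 < δ) (hδ' : δ ≤ 1 / 4) {F₀ F₁ G₀ G₁ : ℝ × ℝ → ℝ}
    (hF₀ : Continuous F₀) (hF₁ : Continuous F₁) (hG₀ : Continuous G₀) (hG₁ : Continuous G₁)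
    (R : ℝ → ℝ ≃o ℝ) (hR : Continuous fun p : ℝ × ℝ => R p.1 p.2)
    (hR1 : ∀ x, ∀ y ∉ Ioo (0 : ℝ) 1, R x y = y) (hRL : ∀ x x' y, |R x y - R x' y| ≤ |x - x'|)
    (hmid : ∀ p ∈ (Ioo δ (1 - δ) ×ˢ Ioo 0 1 : Set (ℝ × ℝ)),
      G₀ p = δ + (1 - 2 * δ) * F₀ ((stretch δ (1 - 2 * δ) (by linarith)).symm p) ∧
      G₁ p = F₁ ((stretch δ (1 - 2 * δ) (by linarith)).symm p))
    (hend : ∀ p : ℝ × ℝ, p.1 ∉ Icc δ (1 - δ) → G₀ p = p.1 ∧ G₁ p = R p.1 p.2)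
    {A B C D : ℝ}
    (hA : ∀ ψ, IsTest (Ioo 0 1 ×ˢ Ioo 0 1) ψ → pairing (1, 0) F₀ ψ ≤ A)
    (hB : ∀ ψ, IsTest (Ioo 0 1 ×ˢ Ioo 0 1) ψ → pairing (0, 1) F₀ ψ ≤ B)
    (hC : ∀ ψ, IsTest (Ioo 0 1 ×ˢ Ioo 0 1) ψ → pairing (1, 0) F₁ ψ ≤ C)
    (hD : ∀ ψ, IsTest (Ioo 0 1 ×ˢ Ioo 0 1) ψ → pairing (0, 1) F₁ ψ ≤ D) :
    (∀ ψ, IsTest (Ioo 0 1 ×ˢ Ioo 0 1) ψ → pairing (1, 0) G₀ ψ ≤ A + 2 * δ) ∧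
    (∀ ψ, IsTest (Ioo 0 1 ×ˢ Ioo 0 1) ψ → pairing (0, 1) G₀ ψ ≤ B + 2 * 0) ∧
    (∀ ψ, IsTest (Ioo 0 1 ×ˢ Ioo 0 1) ψ → pairing (1, 0) G₁ ψ ≤ C + 2 * δ) ∧
    (∀ ψ, IsTest (Ioo 0 1 ×ˢ Ioo 0 1) ψ → pairing (0, 1) G₁ ψ ≤ D + 2 * δ) := by
  have hℓ : 0 < 1 - 2 * δ := by linarith
  have hℓ1 : 1 - 2 * δ ≤ 1 := by linarith
  set S := stretch δ (1 - 2 * δ) hℓ.ne' with hS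
  have hnn : ∀ {e u K}, (∀ ψ, IsTest (Ioo 0 1 ×ˢ Ioo 0 1) ψ → pairing e u ψ ≤ K) → 0 ≤ K :=
    fun {e u K} h => (pairing_zero e u).symm.le.trans (h _ (.zero _))
  have hwid : δ + (1 - 2 * δ) = 1 - δ := by ring
  have hmid₀ : ∀ e : ℝ × ℝ, (e = (1, 0) ∨ e = (0, 1)) → ∀ K,
      (∀ ψ, IsTest (Ioo 0 1 ×ˢ Ioo 0 1) ψ → pairing e F₀ ψ ≤ K) →
      ∀ ψ, IsTest (Ioo δ (1 - δ) ×ˢ Ioo 0 1) ψ → pairing e G₀ ψ ≤ K := by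
    intro e he K hK ψ hψ
    rw [pairing_congr hψ fun p hp => (hmid p hp).1]
    refine pairing_affine_le (hF₀.comp S.symm.continuous) hψ e hℓ.le hℓ1 (hnn hK) ?_
    exact pairing_stretch_symm_le hℓ hℓ1 hF₀ he hK (hwid.symm ▸ hψ)
  have hmid₁ : ∀ e : ℝ × ℝ, (e = (1, 0) ∨ e = (0, 1)) → ∀ K,
      (∀ ψ, IsTest (Ioo 0 1 ×ˢ Ioo 0 1) ψ → pairing e F₁ ψ ≤ K) →
      ∀ ψ, IsTest (Ioo δ (1 - δ) ×ˢ Ioo 0 1) ψ → pairing e G₁ ψ ≤ K := by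
    intro e he K hK ψ hψ
    rw [pairing_congr hψ fun p hp => (hmid p hp).2]
    exact pairing_stretch_symm_le hℓ hℓ1 hF₁ he hK (hwid.symm ▸ hψ)
  have hstrip : ∀ a b : ℝ, a ≤ b → Disjoint (Ioo a b) (Icc δ (1 - δ)) → ∀ ψ,
      IsTest (Ioo a b ×ˢ Ioo 0 1) ψ → pairing (1, 0) G₀ ψ ≤ b - a ∧ pairing (0, 1) G₀ ψ ≤ 0 ∧
        pairing (1, 0) G₁ ψ ≤ b - a ∧ pairing (0, 1) G₁ ψ ≤ b - a := by
    intro a b hab hd ψ hψ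
    have he : ∀ p ∈ (Ioo a b ×ˢ Ioo 0 1 : Set (ℝ × ℝ)), p.1 ∉ Icc δ (1 - δ) := fun p hp =>
      disjoint_left.1 hd hp.1
    have e₀ : EqOn G₀ (fun p => p.1) (Ioo a b ×ˢ Ioo 0 1) := fun p hp => (hend p (he p hp)).1
    have e₁ : EqOn G₁ (fun p => R p.1 p.2) (Ioo a b ×ˢ Ioo 0 1) :=
      fun p hp => (hend p (he p hp)).2
    rw [pairing_congr hψ e₀, pairing_congr hψ e₁, pairing_congr hψ e₀, pairing_congr hψ e₁]
    refine ⟨?_, ?_, ?_, ?_⟩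
    · simpa using pairing_horizontal_le_of_lipschitz hab (u := fun p => p.1) continuous_fst (L := 1)
        (fun x x' y => by simp) hψ
    · exact pairing_vertical_le_of_forall_eq (measurableSet_Ioo.prod measurableSet_Ioo)
        ((Metric.isBounded_Ioo a b).prod (Metric.isBounded_Ioo 0 1)) continuous_fst
        (fun _ _ _ => rfl) hψ
    · simpa using pairing_horizontal_le_of_lipschitz hab hR (L := 1)
        (fun x x' y => by simpa using hRL x x' y) hψ
    · refine pairing_vertical_le_of_monotone hab hR (fun x => (R x).monotone) (fun x y hy => ?_)
        (fun x y hy => (hR1 x y fun h => by linarith [h.2]).le) hψ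
      rw [← hR1 x 0 (by simp)]
      exact (R x).monotone hy
  have hl := hstrip 0 δ hδ.le
    (disjoint_left.2 fun x h h' => by linarith [h.2, h'.1])
  have hr := hstrip (1 - δ) 1 (by linarith)
    (disjoint_left.2 fun x h h' => by linarith [h.1, h'.2])
  simp only [sub_zero, sub_sub_cancel] at hl hr
  refine ⟨fun ψ hψ => ?_, fun ψ hψ => ?_, fun ψ hψ => ?_, fun ψ hψ => ?_⟩
  · exact pairing_le_of_strips hδ hδ' hG₀ (.inl rfl) (fun ψ h => (hl ψ h).1)
      (hmid₀ _ (.inl rfl) A hA) (fun ψ h => (hr ψ h).1) hψ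
  · exact pairing_le_of_strips hδ hδ' hG₀ (.inr rfl) (fun ψ h => (hl ψ h).2.1)
      (hmid₀ _ (.inr rfl) B hB) (fun ψ h => (hr ψ h).2.1) hψ
  · exact pairing_le_of_strips hδ hδ' hG₁ (.inl rfl) (fun ψ h => (hl ψ h).2.2.1)
      (hmid₁ _ (.inl rfl) C hC) (fun ψ h => (hr ψ h).2.2.1) hψ
  · exact pairing_le_of_strips hδ hδ' hG₁ (.inr rfl) (fun ψ h => (hl ψ h).2.2.2)
      (hmid₁ _ (.inr rfl) D hD) (fun ψ h => (hr ψ h).2.2.2) hψ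

/-- If `t k` maps a set of full measure into the null set `Z k`, then `p ↦ Ψ (p.1, R p.1 p.2)`
maps a null set of horizontal lines onto almost all of the square. -/
theorem exists_null_full_image {I : Set ℝ} (Ψ T : (ℝ × ℝ) ≃ₜ (ℝ × ℝ))
    (hΨ : ∀ p ∉ (Ioo 0 1 ×ˢ Ioo 0 1 : Set (ℝ × ℝ)), Ψ p = p)
    (hΨI : ∀ p : ℝ × ℝ, p.1 ∉ I → Ψ p = p) (t : ℕ → ℝ ≃o ℝ) (R : ℝ → ℝ ≃o ℝ)
    (hT : ∀ p, T p = (p.1, R p.1 p.2))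
    (hTsq : ∀ p ∉ (Ioo 0 1 ×ˢ Ioo 0 1 : Set (ℝ × ℝ)), T p = p)
    (hRI : ∀ x ∈ I, ∀ y, R x y = t 0 y)
    (hRnull : ∀ N, MeasurableSet N → (∀ k, volume ((t k).symm ⁻¹' N) = 0) →
      ∀ x ∈ Ioo (0 : ℝ) 1, volume ((R x).symm ⁻¹' N) = 0)
    {Z : ℕ → Set ℝ} (hZ : ∀ k, MeasurableSet (Z k))
    (hZt : ∀ k, volume {y ∈ Ioo (0 : ℝ) 1 | t k y ∉ Z k} = 0) (hZ0 : ∀ k, volume (Z k) = 0)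
    (hZΨ : ∀ᵐ w : ℝ × ℝ, (Ψ.symm w).2 ∉ Z 0) :
    ∃ E ⊆ (Ioo 0 1 ×ˢ Ioo 0 1 : Set (ℝ × ℝ)), volume E = 0 ∧
      volume ((Ioo 0 1 ×ˢ Ioo 0 1 : Set (ℝ × ℝ)) \ (fun p => Ψ (T p)) '' E) = 0 := by
  set N : Set ℝ := ⋃ k, {y ∈ Ioo (0 : ℝ) 1 | t k y ∉ Z k} with hN
  set N' : Set ℝ := Ioo 0 1 ∩ ⋂ k, t k ⁻¹' Z k with hN'
  have hN0 : volume N = 0 := measure_iUnion_null hZt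
  have hN'm : MeasurableSet N' := measurableSet_Ioo.inter
    (MeasurableSet.iInter fun k => (t k).continuous.measurable (hZ k))
  have hN't : ∀ k, volume ((t k).symm ⁻¹' N') = 0 := fun k =>
    measure_mono_null (fun w hw => by
      have := mem_iInter.1 hw.2 k
      simpa using this) (hZ0 k)
  have hTs : ∀ p, T.symm p = (p.1, (R p.1).symm p.2) := fun p => by
    rw [Homeomorph.symm_apply_eq, hT]; simp
  have hB : volume {w : ℝ × ℝ | w.1 ∈ Ioo (0 : ℝ) 1 ∧ (T.symm w).2 ∈ N'} = 0 := by
    have hm : MeasurableSet {w : ℝ × ℝ | w.1 ∈ Ioo (0 : ℝ) 1 ∧ (T.symm w).2 ∈ N'} :=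
      (measurable_fst measurableSet_Ioo).inter
        ((measurable_snd.comp T.symm.continuous.measurable) hN'm)
    rw [Measure.volume_eq_prod, Measure.measure_prod_null hm]
    refine ae_of_all _ fun x => ?_
    by_cases hx : x ∈ Ioo (0 : ℝ) 1
    · refine measure_mono_null (fun y hy => ?_) (hRnull N' hN'm hN't x hx)
      have := hy.2
      rwa [hTs] at this
    · refine measure_mono_null (fun y hy => hx hy.1) measure_empty
  refine ⟨Ioo 0 1 ×ˢ N, prod_mono_right (iUnion_subset fun k y hy => hy.1), ?_, ?_⟩
  · rw [Measure.volume_eq_prod, Measure.prod_prod, hN0, mul_zero]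
  · refine measure_mono_null (fun w hw => ?_) (measure_union_null (ae_iff.1 hZΨ) hB)
    obtain ⟨hw, hwE⟩ := hw
    set q := Ψ.symm w with hq
    have hΨq : Ψ q = w := Ψ.apply_symm_apply w
    have hqsq : q ∈ (Ioo 0 1 ×ˢ Ioo 0 1 : Set (ℝ × ℝ)) :=
      (Ψ.toEquiv.apply_mem_iff_of_fixed_compl hΨ q).1 (by rw [← hΨq] at hw; exact hw)
    set p := T.symm q with hp
    have hTp : T p = q := T.apply_symm_apply q
    have hpsq : p ∈ (Ioo 0 1 ×ˢ Ioo 0 1 : Set (ℝ × ℝ)) :=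
      (T.toEquiv.apply_mem_iff_of_fixed_compl hTsq p).1 (by rw [← hTp] at hqsq; exact hqsq)
    have hpN : p.2 ∉ N := fun h => hwE ⟨p, ⟨hpsq.1, h⟩, by simp only [hTp, hΨq]⟩
    have hpZ : ∀ k, t k p.2 ∈ Z k := fun k => by
      by_contra h
      exact hpN (mem_iUnion.2 ⟨k, hpsq.2, h⟩)
    by_cases hqI : q.1 ∈ I
    · left
      have h1 : q.2 = t 0 p.2 := by
        have h2 : p.1 = q.1 := by rw [← hTp, hT]
        rw [← hRI _ hqI, ← h2]
        conv_lhs => rw [← hTp, hT]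
      simp only [mem_ofPred_eq, not_not]
      show q.2 ∈ Z 0
      rw [h1]; exact hpZ 0
    · right
      have h1 : q = w := by rw [← hΨq, hΨI q hqI]
      refine ⟨hw.1, ?_⟩
      rw [← h1]
      exact ⟨hpsq.2, mem_iInter.2 hpZ⟩

theorem exists_perturbation (Φ : (ℝ × ℝ) ≃ₜ (ℝ × ℝ))
    (hΦ : ∀ p ∉ (Ioo 0 1 ×ˢ Ioo 0 1 : Set (ℝ × ℝ)), Φ p = p) {f : Plane → Plane}
    (hF : IsCoords f (fun p => (Φ p).1) (fun p => (Φ p).2)) (hb : BddAbove (varSet f unitSq))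
    {ρ : ℝ} (hρ : 0 < ρ) : ∃ G : (ℝ × ℝ) ≃ₜ (ℝ × ℝ),
      (∀ p ∉ (Ioo 0 1 ×ˢ Ioo 0 1 : Set (ℝ × ℝ)), G p = p) ∧
      (∀ p ∈ (Ioo 0 1 ×ˢ Ioo 0 1 : Set (ℝ × ℝ)), dist (G p) (Φ p) ≤ ρ) ∧
      (∀ p ∈ (Ioo 0 1 ×ˢ Ioo 0 1 : Set (ℝ × ℝ)), dist (G.symm p) (Φ.symm p) ≤ ρ) ∧
      BddAbove (varSet (planeConj G) unitSq) ∧ Var (planeConj G) unitSq ≤ Var f unitSq + ρ ∧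
      ∃ E ⊆ (Ioo 0 1 ×ˢ Ioo 0 1 : Set (ℝ × ℝ)), volume E = 0 ∧
        volume ((Ioo 0 1 ×ˢ Ioo 0 1 : Set (ℝ × ℝ)) \ G '' E) = 0 := by
  have hΦs := Φ.toEquiv.symm_eq_of_fixed_compl hΦ
  obtain ⟨r₁, hr₁, hcl₁⟩ := exists_dist_le_of_fixed_compl Φ.continuous hΦ (half_pos hρ)
  obtain ⟨r₂, hr₂, hcl₂⟩ := exists_dist_le_of_fixed_compl Φ.symm.continuous hΦs (half_pos hρ)
  obtain ⟨δ, hδ, hδ4, hδρ, hδ₁, hδ₂⟩ : ∃ δ : ℝ, 0 < δ ∧ δ ≤ 1 / 4 ∧ 8 * δ ≤ ρ ∧ 4 * δ ≤ r₁ ∧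
      4 * δ ≤ r₂ := by
    refine ⟨min (1 / 4) (min (ρ / 8) (min (r₁ / 4) (r₂ / 4))), by positivity, min_le_left _ _,
      ?_, ?_, ?_⟩
    · have := (min_le_right (1 / 4) _).trans (min_le_left (ρ / 8) (min (r₁ / 4) (r₂ / 4)))
      linarith
    · have := ((min_le_right (1 / 4) _).trans (min_le_right (ρ / 8) _)).trans
        (min_le_left (r₁ / 4) (r₂ / 4))
      linarith
    · have := ((min_le_right (1 / 4) _).trans (min_le_right (ρ / 8) _)).trans
        (min_le_right (r₁ / 4) (r₂ / 4))
      linarith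
  have hℓ : 0 < 1 - 2 * δ := by linarith
  set S := stretch δ (1 - 2 * δ) hℓ.ne' with hS
  set Ψ : (ℝ × ℝ) ≃ₜ (ℝ × ℝ) := S.symm.trans (Φ.trans S) with hΨ
  have hΨa : ∀ p, Ψ p = S (Φ (S.symm p)) := fun p => rfl
  have hΨs : ∀ p, Ψ.symm p = S (Φ.symm (S.symm p)) := fun p => rfl
  have hΨfix : ∀ p : ℝ × ℝ, p ∉ (Ioo δ (1 - δ) ×ˢ Ioo 0 1 : Set (ℝ × ℝ)) → Ψ p = p := by
    intro p hp
    rw [hΨa, hΦ, S.apply_symm_apply]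
    rintro ⟨⟨h1, h2⟩, h3⟩
    rw [stretch_symm_apply] at h1 h2 h3
    simp only at h1 h2 h3
    rw [lt_div_iff₀ hℓ] at h1
    rw [div_lt_one hℓ] at h2
    exact hp ⟨⟨by linarith, by linarith⟩, h3⟩
  have hΨsq : ∀ p ∉ (Ioo 0 1 ×ˢ Ioo 0 1 : Set (ℝ × ℝ)), Ψ p = p := fun p hp =>
    hΨfix p fun h => hp ⟨⟨hδ.trans h.1.1, by linarith [h.1.2]⟩, h.2⟩
  obtain ⟨V, hVm, hV⟩ := exists_weight_variation hF hb
  obtain ⟨t₀, ht₀, ht₀c, ht₀V, Z₀, hZ₀m, hZ₀, hZ₀'⟩ := exists_singular_orderIso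
    ((volume : Measure (ℝ × ℝ)).map (fun w => (Ψ.symm w).2) + (volume : Measure ℝ)) id
    measurable_id V hVm (ε := δ / 8 * (1 / 4) ^ 0) (by positivity)
  have hs : ∀ k : ℕ, ∃ t : ℝ ≃o ℝ, (∀ y ∉ Ioo (0 : ℝ) 1, t y = y) ∧
      (∀ y, |t y - y| ≤ δ / 8 * (1 / 4) ^ (k + 1)) ∧
      ∃ Z, MeasurableSet Z ∧ volume {y ∈ Ioo (0 : ℝ) 1 | t y ∉ Z} = 0 ∧ volume Z = 0 := by
    intro k
    obtain ⟨t, h1, h2, -, Z, h3, h4, h5⟩ := exists_singular_orderIso (volume : Measure ℝ) id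
      measurable_id (fun _ => 0) measurable_const (ε := δ / 8 * (1 / 4) ^ (k + 1)) (by positivity)
    exact ⟨t, h1, h2, Z, h3, h4, by simpa [ae_iff] using h5⟩
  choose t' ht' ht'c Z' hZ'm hZ' hZ'0 using hs
  set t : ℕ → ℝ ≃o ℝ := fun k => Nat.casesOn k t₀ t' with ht
  set Z : ℕ → Set ℝ := fun k => Nat.casesOn k Z₀ Z' with hZ
  rw [ae_add_measure_iff] at hZ₀'
  have hZ₀0 : volume Z₀ = 0 := by simpa [ae_iff] using hZ₀'.2
  obtain ⟨R, hRc, hR1, hR2, hRI, hRcl, hRL, hRnull⟩ := exists_interpolation hδ t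
    (fun k => by cases k; exacts [ht₀, ht' _]) (fun k => by cases k; exacts [ht₀c, ht'c _])
  obtain ⟨T, hT, hTs⟩ := exists_fiber_homeomorph R hRc hR1 hR2
  have hTsq : ∀ p ∉ (Ioo 0 1 ×ˢ Ioo 0 1 : Set (ℝ × ℝ)), T p = p := by
    intro p hp
    rw [hT]
    refine Prod.ext rfl ?_
    by_cases hx : p.1 ∈ Ioo (0 : ℝ) 1
    · exact hR1 _ _ fun hy => hp ⟨hx, hy⟩
    · exact hR2 _ hx _
  have hTcl : ∀ p, dist (T p) p ≤ δ := fun p => by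
    rw [hT, Prod.dist_eq]
    exact max_le (by simp [hδ.le]) (hRcl p.1 p.2)
  obtain ⟨A, B, C, D, hA, hB, hC, hD, hsum⟩ := hV t₀ (ht₀ 0 (by simp)) (ht₀ 1 (by simp)) ht₀V
  have hvar := pairing_bounds_of_strips hδ hδ4 (F₀ := fun p => (Φ (p.1, t₀ p.2)).1)
    (F₁ := fun p => (Φ (p.1, t₀ p.2)).2) (G₀ := fun p => (Ψ (T p)).1) (G₁ := fun p => (Ψ (T p)).2)
    (continuous_fst.comp (Φ.continuous.comp (continuous_fst.prodMk
      (t₀.continuous.comp continuous_snd))))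
    (continuous_snd.comp (Φ.continuous.comp (continuous_fst.prodMk
      (t₀.continuous.comp continuous_snd))))
    (continuous_fst.comp (Ψ.continuous.comp T.continuous))
    (continuous_snd.comp (Ψ.continuous.comp T.continuous)) R hRc hR1 hRL
    (fun p hp => by
      have h1 : T p = (p.1, t₀ p.2) := by rw [hT, hRI p.1 (Ioo_subset_Icc_self hp.1)]; rfl
      rw [hΨa, h1]
      exact ⟨rfl, rfl⟩)
    (fun p hp => by
      rw [hΨfix, hT]
      · exact ⟨rfl, rfl⟩
      · intro h
        rw [hT] at h
        exact hp (Ioo_subset_Icc_self h.1)) hA hB hC hD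
  have hbv := bddAbove_varSet_of_bounds (isCoords_planeConj (T.trans Ψ)) hvar.1 hvar.2.1
    hvar.2.2.1 hvar.2.2.2
  refine ⟨T.trans Ψ, fun p hp => ?_, fun p hp => ?_, fun p hp => ?_, hbv.1, ?_, ?_⟩
  · show Ψ (T p) = p
    rw [hTsq p hp, hΨsq p hp]
  · show dist (Ψ (T p)) (Φ p) ≤ ρ
    have h1 : (T p).1 ∈ Icc (0 : ℝ) 1 := by rw [hT]; exact Ioo_subset_Icc_self hp.1
    have h2 := dist_stretch_conj_le hδ hδ4 Φ.toEquiv hΦ h1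
    have h3 := dist_stretch_symm_self_le hδ hδ4 h1
    have h4 := hcl₁ (S.symm (T p)) p (by
      linarith [dist_triangle (S.symm (T p)) (T p) p, hTcl p])
    have h5 := dist_triangle (Ψ (T p)) (Φ (S.symm (T p))) (Φ p)
    have h6 : dist (Ψ (T p)) (Φ (S.symm (T p))) ≤ 2 * δ := h2
    linarith
  · show dist (T.symm (Ψ.symm p)) (Φ.symm p) ≤ ρ
    have h1 : p.1 ∈ Icc (0 : ℝ) 1 := Ioo_subset_Icc_self hp.1
    have h2 : dist (Ψ.symm p) (Φ.symm (S.symm p)) ≤ 2 * δ :=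
      dist_stretch_conj_le hδ hδ4 Φ.symm.toEquiv hΦs h1
    have h3 := dist_stretch_symm_self_le hδ hδ4 h1
    have h4 := hcl₂ (S.symm p) p (by linarith)
    have h5 := hTcl (T.symm (Ψ.symm p))
    rw [T.apply_symm_apply, dist_comm] at h5
    have h6 := dist_triangle4 (T.symm (Ψ.symm p)) (Ψ.symm p) (Φ.symm (S.symm p)) (Φ.symm p)
    linarith
  · linarith [hbv.2]
  · exact exists_null_full_image Ψ T hΨsq (I := Icc δ (1 - δ)) (fun p hp => hΨfix p fun h =>
      hp (Ioo_subset_Icc_self h.1)) t R hT hTsq hRI hRnull (Z := Z)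
      (fun k => by cases k; exacts [hZ₀m, hZ'm _]) (fun k => by cases k; exacts [hZ₀, hZ' _])
      (fun k => by cases k; exacts [hZ₀0, hZ'0 _])
      (ae_of_ae_map (continuous_snd.comp Ψ.symm.continuous).measurable.aemeasurable hZ₀'.1)

theorem supDist_le_of_planeEquiv {f g : Plane → Plane} {F G : ℝ × ℝ → ℝ × ℝ} {ρ : ℝ}
    (hf : ∀ p ∈ (Ioo 0 1 ×ˢ Ioo 0 1 : Set (ℝ × ℝ)), f (planeEquiv p) = planeEquiv (F p))
    (hg : ∀ p, g (planeEquiv p) = planeEquiv (G p))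
    (h : ∀ p ∈ (Ioo 0 1 ×ˢ Ioo 0 1 : Set (ℝ × ℝ)), dist (G p) (F p) ≤ ρ) :
    supDist f g unitSq ≤ ‖(planeEquiv : (ℝ × ℝ) →L[ℝ] Plane)‖ * ρ := by
  have : Nonempty unitSq := by
    refine nonempty_coe_sort.2 (nonempty_of_measure_ne_zero (μ := volume) ?_)
    rw [volume_unitSq]; exact one_ne_zero
  refine ciSup_le fun ⟨z, hz⟩ => ?_
  obtain ⟨p, rfl⟩ := planeEquiv.surjective z
  have hp := planeEquiv_mem_unitSq.1 hz
  simp only [hf p hp, hg p]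
  rw [dist_comm]
  exact (planeEquiv.lipschitz.dist_le_mul _ _).trans
    (mul_le_mul_of_nonneg_left (h p hp) (norm_nonneg _))

theorem volume_image_planeConj {G : (ℝ × ℝ) ≃ₜ (ℝ × ℝ)}
    (hG : ∀ p ∉ (Ioo 0 1 ×ˢ Ioo 0 1 : Set (ℝ × ℝ)), G p = p) {E : Set (ℝ × ℝ)}
    (hE : E ⊆ Ioo 0 1 ×ˢ Ioo 0 1) (h0 : volume E = 0)
    (h1 : volume ((Ioo 0 1 ×ˢ Ioo 0 1 : Set (ℝ × ℝ)) \ G '' E) = 0) :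
    ∃ E' ⊆ unitSq, volume E' = 0 ∧ volume (planeConj G '' E') = 1 := by
  have hv : ∀ A : Set (ℝ × ℝ), volume (planeEquiv '' A) = volume A := fun A => by
    rw [← measurePreserving_planeEquiv.measure_preimage_emb measurableEmbedding_planeEquiv,
      preimage_image_eq _ planeEquiv.injective]
  refine ⟨planeEquiv '' E, ?_, by rw [hv, h0], ?_⟩
  · rintro _ ⟨p, hp, rfl⟩
    exact planeEquiv_mem_unitSq.2 (hE hp)
  · have h2 : planeConj G '' (planeEquiv '' E) = planeEquiv '' (G '' E) := by
      simp only [image_image, planeConj_planeEquiv]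
    have h3 : G '' E ⊆ Ioo 0 1 ×ˢ Ioo 0 1 := by
      rintro _ ⟨p, hp, rfl⟩
      exact (G.toEquiv.apply_mem_iff_of_fixed_compl hG p).2 (hE hp)
    rw [h2, hv, measure_eq_measure_of_null_sdiff h3 h1, Measure.volume_eq_prod, Measure.prod_prod]
    simp

theorem exists_mem_Afull_dX_lt {M : ℝ} {p : (Plane → Plane) × (Plane → Plane)} (hp : p ∈ X M)
    {ε : ℝ} (hε : 0 < ε) : ∃ q ∈ Afull M, dX M p q < ε := by
  obtain ⟨hhom, hext, ⟨-, hb⟩, hvar⟩ := hp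
  obtain ⟨Φ, hΦ, hΦf, hΦg⟩ := exists_homeomorph_of_isHomeoOn hhom hext
  have hF : IsCoords p.1 (fun x => (Φ x).1) (fun x => (Φ x).2) :=
    { cont_zero := continuous_fst.comp Φ.continuous
      cont_one := continuous_snd.comp Φ.continuous
      eq_zero := fun x hx => by
        rw [hΦf x (planeEquiv_mem_unitSq.1 hx), planeEquiv_apply_zero]
      eq_one := fun x hx => by
        rw [hΦf x (planeEquiv_mem_unitSq.1 hx), planeEquiv_apply_one] }
  set c := ‖(planeEquiv : (ℝ × ℝ) →L[ℝ] Plane)‖ with hc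
  have hc0 : 0 ≤ c := norm_nonneg _
  have ha : 0 < M - Var p.1 unitSq := by linarith
  obtain ⟨κ, hκ, hcont⟩ := Metric.continuousAt_iff.1
    (continuousAt_const.div continuousAt_id ha.ne' :
      ContinuousAt (fun b : ℝ => 1 / b) (M - Var p.1 unitSq)) (ε / 2) (by positivity)
  obtain ⟨r, hr, hlow⟩ := exists_delta_var_lower hF (half_pos hκ)
  obtain ⟨ρ, hρ, h1, h2, h3, h4⟩ : ∃ ρ : ℝ, 0 < ρ ∧ ρ ≤ r ∧ ρ ≤ κ / 2 ∧
      ρ ≤ (M - Var p.1 unitSq) / 2 ∧ ρ ≤ ε / (8 * (c + 1)) :=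
    ⟨min (min r (κ / 2)) (min ((M - Var p.1 unitSq) / 2) (ε / (8 * (c + 1)))), by positivity,
      (min_le_left _ _).trans (min_le_left _ _), (min_le_left _ _).trans (min_le_right _ _),
      (min_le_right _ _).trans (min_le_left _ _), (min_le_right _ _).trans (min_le_right _ _)⟩
  obtain ⟨G, hG, hGΦ, hGΦs, hGb, hGv, E, hE, hE0, hE1⟩ := exists_perturbation Φ hΦ hF hb hρ
  have hlow' := hlow _ _ _ (isCoords_planeConj G) hGb fun x hx => by
    have h5 := (hGΦ x hx).trans h1
    rw [dist_comm, Prod.dist_eq, max_le_iff] at h5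
    exact h5
  refine ⟨(planeConj G, (planeConj G).symm), ⟨⟨isHomeoOn_planeConj hG, extendsToId_planeConj hG,
    ⟨integrableOn_planeConj G, hGb⟩, ?_⟩, volume_image_planeConj hG hE hE0 hE1⟩, ?_⟩
  · show Var (planeConj G) unitSq < M
    linarith
  · have d1 := supDist_le_of_planeEquiv hΦf (planeConj_planeEquiv G) hGΦ
    have d2 := supDist_le_of_planeEquiv hΦg (planeConj_symm_planeEquiv G) hGΦs
    have d3 := @hcont (M - Var (planeConj G) unitSq) (by
      rw [Real.dist_eq, abs_lt]; constructor <;> linarith)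
    rw [dist_comm, Real.dist_eq] at d3
    change |1 / (M - Var p.1 unitSq) - 1 / (M - Var (planeConj G) unitSq)| < ε / 2 at d3
    rw [← hc] at d1 d2
    have d4 : c * ρ < ε / 4 := by
      have h5 : c * ρ ≤ c * (ε / (8 * (c + 1))) := mul_le_mul_of_nonneg_left h4 hc0
      have h6 : c * (ε / (8 * (c + 1))) = ε / 8 * (c / (c + 1)) := by field_simp
      have h7 : c / (c + 1) ≤ 1 := (div_le_one (by positivity)).2 (by linarith)
      nlinarith
    show supDist p.1 (planeConj G) unitSq + supDist p.2 (planeConj G).symm unitSq +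
      |1 / (M - Var p.1 unitSq) - 1 / (M - Var (planeConj G) unitSq)| < ε
    linarith

theorem id_mem_X {M : ℝ} (hM : 2 < M) :
    (⇑(planeConj (Homeomorph.refl _)), ⇑(planeConj (Homeomorph.refl _)).symm) ∈ X M := by
  have hfix : ∀ p ∉ (Ioo 0 1 ×ˢ Ioo 0 1 : Set (ℝ × ℝ)), Homeomorph.refl (ℝ × ℝ) p = p :=
    fun _ _ => rfl
  have h := bddAbove_varSet_of_bounds (isCoords_planeConj (Homeomorph.refl _)) (A := 1) (B := 0)
    (C := 0) (D := 1)
    (fun ψ hψ => by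
      simpa using pairing_horizontal_le_of_lipschitz zero_le_one (u := fun p => p.1) continuous_fst
        (L := 1) (fun x x' y => by simp) hψ)
    (fun ψ hψ => pairing_vertical_le_of_forall_eq (measurableSet_Ioo.prod measurableSet_Ioo)
        ((Metric.isBounded_Ioo _ _).prod (Metric.isBounded_Ioo _ _)) continuous_fst
        (fun _ _ _ => rfl) hψ)
    (fun ψ hψ => by
      simpa using pairing_horizontal_le_of_lipschitz zero_le_one (u := fun p => p.2) continuous_snd
        (L := 0) (fun x x' y => by simp) hψ)
    (fun ψ hψ => by
      simpa using pairing_vertical_le_of_monotone zero_le_one (u := fun p => p.2) continuous_snd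
        (fun x y y' h => h) (fun x y h => h) (fun x y h => le_rfl) hψ)
  exact ⟨isHomeoOn_planeConj hfix, extendsToId_planeConj hfix, ⟨integrableOn_planeConj _, h.1⟩,
    by linarith [h.2]⟩

end

/-- the set `A` is dense in the metric space `(X, d)`; in particular `A`
is non-empty. -/
theorem Afull_dense (M : ℝ) (hM : 2 < M) :
    (∀ p ∈ X M, ∀ ε : ℝ, 0 < ε → ∃ q ∈ Afull M, dX M p q < ε) ∧ (Afull M).Nonempty := by
  refine ⟨fun p hp ε hε => exists_mem_Afull_dX_lt hp hε, ?_⟩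
  obtain ⟨q, hq, -⟩ := exists_mem_Afull_dX_lt (id_mem_X hM) one_pos
  exact ⟨q, hq⟩

end
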